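/- arXiv:2603.07033 — 4 statements merged into one kernel-verified Lean document; each statement's English description precedes it below -/
import Mathlib

section
/- Let G be a finitely generated group which is virtually nilpotent, i.e., G has a nilpotent subgroup of finite index. Then G is verbally elliptic: for every word w (a nontrivial element of a free group on finitely many generators x₁,…,x_k) there exists N ≥ 1 such that every element of the subgroup ⟨w(G)⟩ generated by w(G) is a product of at most N elements, each of which belongs to w(G) or is the inverse of an element of w(G). -/
namespace Romankov
open Subgroup
open scoped commutatorElement
universe u

theorem fg_subgroup_of_comm {A : Type*} [CommGroup A] (hA : Group.FG A) (H : Subgroup A) :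
    H.FG := by
  have h1 : AddGroup.FG (Additive A) := inferInstance
  have h2 : Module.Finite ℤ (Additive A) := Module.Finite.iff_addGroup_fg.mpr h1
  have h3 : IsNoetherian ℤ (Additive A) := isNoetherian_of_isNoetherianRing_of_finite ℤ _
  rw [Subgroup.fg_iff_add_fg]
  have h4 := h3.noetherian (AddSubgroup.toIntSubmodule (Subgroup.toAddSubgroup H))
  rw [Submodule.fg_iff_addSubgroup_fg] at h4
  simpa using h4

theorem fg_map {G G' : Type*} [Group G] [Group G'] (f : G →* G') {H : Subgroup G}
    (h : H.FG) : (H.map f).FG := by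
  rw [Subgroup.fg_iff_submonoid_fg] at h ⊢
  exact h.map f

theorem fg_of_le_comm {G : Type*} [Group G] {A : Subgroup G} (hA : A.FG)
    (hc : ∀ x ∈ A, ∀ y ∈ A, x * y = y * x) {H : Subgroup G} (hH : H ≤ A) : H.FG := by
  let _ : CommGroup A := { (inferInstance : Group A) with
    mul_comm := fun a b => Subtype.ext (hc a a.2 b b.2) }
  have h1 : Group.FG A := (Group.fg_iff_subgroup_fg A).mpr hA
  have h2 := fg_subgroup_of_comm h1 (H.subgroupOf A)
  have h3 := fg_map A.subtype h2
  rwa [Subgroup.subgroupOf_map_subtype, inf_eq_left.mpr hH] at h3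

/-- lifting a finite generating set of an image -/
theorem exists_finite_lift {G G' : Type*} [Group G] [Group G'] (f : G →* G') (H : Subgroup G)
    (h : (H.map f).FG) : ∃ T : Set G, T.Finite ∧ T ⊆ H ∧ (closure T).map f = H.map f := by
  classical
  obtain ⟨S, hS⟩ := h
  have h1 : (S : Set G') ⊆ f '' (H : Set G) := by
    rw [← Subgroup.coe_map, ← hS]; exact subset_closure
  obtain ⟨T, hT, hT2⟩ := Finset.subset_set_image_iff.mp h1
  refine ⟨T, T.finite_toSet, hT, ?_⟩
  rw [MonoidHom.map_closure, ← hS, ← hT2, Finset.coe_image]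

theorem fg_extension {G : Type*} [Group G] (A : Subgroup G) [A.Normal]
    (hA : ∀ H ≤ A, H.FG) (hQ : ∀ H : Subgroup (G ⧸ A), H.FG) (H : Subgroup G) : H.FG := by
  obtain ⟨T, hT, hTH, hTm⟩ := exists_finite_lift (QuotientGroup.mk' A) H (hQ _)
  have h1 : H = closure T ⊔ (H ⊓ A) := by
    apply le_antisymm
    · intro h hh
      have : QuotientGroup.mk' A h ∈ (closure T).map (QuotientGroup.mk' A) := by
        rw [hTm]; exact mem_map_of_mem _ hh
      obtain ⟨t, ht, hte⟩ := this
      have ht' : t ∈ H := (closure_le H).mpr hTH ht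
      have h2 : t⁻¹ * h ∈ A := by
        rw [← QuotientGroup.eq]; exact hte
      have : h = t * (t⁻¹ * h) := by group
      rw [this]
      exact mul_mem_sup ht ⟨H.mul_mem (H.inv_mem ht') hh, h2⟩
    · exact sup_le ((closure_le H).mpr hTH) inf_le_left
  rw [h1]
  exact Subgroup.FG.sup ⟨hT.toFinset, by simp⟩ (hA _ inf_le_right)

theorem commutator_fg {G : Type*} [Group G] (X Y : Set G) (hX : X.Finite) (hY : Y.Finite)
    (hXt : closure X = ⊤) (A : Subgroup G) (hAc : A ≤ center G)
    (B : Subgroup G) (hB : B ≤ closure Y ⊔ A) (hA : A = ⁅B, (⊤ : Subgroup G)⁆) (hYB : Y ⊆ B) :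
    A.FG := by
  set C : Set G := Set.image2 (fun y x => ⁅y, x⁆) Y X with hC
  have hCA : closure C ≤ A := by
    rw [closure_le, hA]
    rintro _ ⟨y, hy, x, hx, rfl⟩
    exact commutator_mem_commutator (hYB hy) (mem_top _)
  have hn : (closure C).Normal := by
    refine ⟨fun n hn g => ?_⟩
    have := mem_center_iff.mp (hAc (hCA hn)) g
    rw [this]; simpa using hn
  have key : A ≤ closure C := by
    rw [hA, commutator_le]
    intro b hb g _
    set π := QuotientGroup.mk' (closure C)
    have e1 : ∀ y ∈ Y, ∀ x ∈ X, π x * π y = π y * π x := by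
      intro y hy x hx
      have : π ⁅y, x⁆ = 1 := by
        rw [← MonoidHom.mem_ker, QuotientGroup.ker_mk']
        exact subset_closure ⟨y, hy, x, hx, rfl⟩
      rw [map_commutatorElement, commutatorElement_eq_one_iff_mul_comm] at this
      exact this.symm
    have e2 : ∀ y ∈ Y, ∀ g, π g * π y = π y * π g := by
      intro y hy g
      have : (⊤ : Subgroup G) ≤ (centralizer {π y}).comap π := by
        rw [← hXt, closure_le]
        intro x hx
        simp only [coe_comap, Set.mem_preimage, SetLike.mem_coe, mem_centralizer_singleton_iff]
        exact e1 y hy x hx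
      have := this (mem_top g)
      simpa [mem_centralizer_singleton_iff] using this
    have e3 : closure Y ⊔ A ≤ (center _).comap π := by
      refine sup_le ((closure_le _).mpr ?_) ?_
      · intro y hy
        simp only [coe_comap, Set.mem_preimage, SetLike.mem_coe, mem_center_iff]
        intro q
        obtain ⟨g, rfl⟩ := QuotientGroup.mk'_surjective _ q
        exact e2 y hy g
      · intro a ha
        rw [mem_comap, mem_center_iff]
        intro q
        obtain ⟨g, rfl⟩ := QuotientGroup.mk'_surjective _ q
        have := mem_center_iff.mp (hAc ha) g
        change π g * π a = π a * π g
        rw [← map_mul, this, map_mul]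
    have e4 := mem_center_iff.mp (mem_comap.mp (e3 (hB hb))) (π g)
    have : π ⁅b, g⁆ = 1 := by
      rw [map_commutatorElement, commutatorElement_eq_one_iff_mul_comm]; exact e4.symm
    rwa [← MonoidHom.mem_ker, QuotientGroup.ker_mk'] at this
  rw [le_antisymm key hCA]
  exact ⟨(hY.image2 (fun y x => ⁅y, x⁆) hX).toFinset, by simp [hC]⟩

theorem fg_of_lcs : ∀ (n : ℕ) (N : Type u) [Group N], Group.FG N →
    (⊤ : Subgroup N).lowerCentralSeries n = ⊥ → ∀ H : Subgroup N, H.FG := by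
  intro n
  induction n with
  | zero =>
    intro N _ hfg h H
    have : H = ⊥ := by
      rw [eq_bot_iff, ← h]; exact le_top
    rw [this]; exact Subgroup.FG.bot
  | succ n ih =>
    intro N _ hfg h
    set A := (⊤ : Subgroup N).lowerCentralSeries n with hA
    have hAc : A ≤ center N := by
      rw [Subgroup.lowerCentralSeries_succ, commutator_eq_bot_iff_le_centralizer] at h
      intro x hx
      have := h hx
      rw [mem_center_iff]; intro g
      exact (mem_centralizer_iff.mp this g (mem_top g))
    have hcomm : ∀ x ∈ A, ∀ y ∈ A, x * y = y * x := fun x _ y hy => mem_center_iff.mp (hAc hy) x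
    have hnA : A.Normal := lowerCentralSeries_normal _ _
    have hQ : ∀ H : Subgroup (N ⧸ A), H.FG := by
      apply ih
      · infer_instance
      · rw [← Subgroup.map_top_of_surjective _ (QuotientGroup.mk'_surjective A),
          ← map_lowerCentralSeries, ← hA, QuotientGroup.map_mk'_self]
    apply fg_extension A _ hQ
    intro H hH
    refine fg_of_le_comm ?_ hcomm hH
    rcases n with _ | m
    · have : A = ⊤ := hA
      rw [this]; exact hfg.out
    · set B := (⊤ : Subgroup N).lowerCentralSeries m with hB
      obtain ⟨Y, hY, hYB, hYm⟩ := exists_finite_lift (QuotientGroup.mk' A) B (hQ _)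
      obtain ⟨X, hXt, hX⟩ := Group.fg_iff.mp hfg
      refine commutator_fg X Y hX hY hXt A hAc B ?_ rfl hYB
      intro b hb
      have : QuotientGroup.mk' A b ∈ (closure Y).map (QuotientGroup.mk' A) := by
        rw [hYm]; exact mem_map_of_mem _ hb
      obtain ⟨t, ht, hte⟩ := this
      have h2 : t⁻¹ * b ∈ A := by
        rw [← QuotientGroup.eq]; exact hte
      have : b = t * (t⁻¹ * b) := by group
      rw [this]
      exact mul_mem_sup ht h2

theorem fg_of_le_nilpotent {G : Type*} [Group G] (N : Subgroup G) (hN : N.FG)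
    (hnil : Group.IsNilpotent N) (H : Subgroup G) (hH : H ≤ N) : H.FG := by
  obtain ⟨n, hn⟩ := Subgroup.nilpotent_iff_lowerCentralSeries.mp hnil
  have h2 := fg_of_lcs n N ((Group.fg_iff_subgroup_fg N).mpr hN) hn (H.subgroupOf N)
  have h3 := fg_map N.subtype h2
  rwa [Subgroup.subgroupOf_map_subtype, inf_eq_left.mpr hH] at h3

/-- maximal subgroups with a property, under the maximal condition -/
theorem exists_maximal_subgroup {G : Type*} [Group G] (N : Subgroup G)
    (hmax : ∀ H ≤ N, H.FG) (P : Subgroup G → Prop) (hP : ∀ H, P H → H ≤ N) (h0 : ∃ H, P H) :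
    ∃ M, Maximal P M := by
  obtain ⟨H0, hH0⟩ := h0
  obtain ⟨M, -, hM⟩ := zorn_le_nonempty₀ {H | P H} (fun c hc hchain y hy => by
    have hdir : DirectedOn (· ≤ ·) c := hchain.directedOn
    have hle : sSup c ≤ N := sSup_le fun H hH => hP H (hc hH)
    obtain ⟨S, hS⟩ := hmax _ hle
    have h1 : ∀ T : Finset G, (T : Set G) ⊆ (sSup c : Subgroup G) → ∃ H ∈ c, (T : Set G) ⊆ H := by
      classical
      intro T
      induction T using Finset.induction_on with
      | empty => intro _; exact ⟨y, hy, by simp⟩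
      | insert a T _ ih =>
        intro hT
        rw [Finset.coe_insert, Set.insert_subset_iff] at hT
        obtain ⟨H, hH, hTH⟩ := ih hT.2
        obtain ⟨H', hH', haH'⟩ := (Subgroup.mem_sSup_of_directedOn ⟨y, hy⟩ hdir).mp hT.1
        obtain ⟨H'', hH'', l1, l2⟩ := hdir H hH H' hH'
        refine ⟨H'', hH'', ?_⟩
        rw [Finset.coe_insert, Set.insert_subset_iff]
        exact ⟨l2 haH', hTH.trans l1⟩
    obtain ⟨H, hH, hSH⟩ := h1 S (by rw [← hS]; exact subset_closure)
    refine ⟨H, hc hH, fun z hz => ?_⟩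
    have : sSup c ≤ H := by rw [← hS]; exact (closure_le H).mpr hSH
    exact (le_sSup hz).trans this) H0 hH0
  exact ⟨M, hM⟩

/-! ### Boundedness -/

/-- Every element of `B` is a product of boundedly many elements of `S`. -/
def Bdd {G : Type*} [Group G] (S B : Set G) : Prop :=
  ∃ m : ℕ, ∀ g ∈ B, ∃ l : List G, l.length ≤ m ∧ (∀ y ∈ l, y ∈ S) ∧ l.prod = g

section bdd
variable {G : Type*} [Group G] {S : Set G}

theorem Bdd.mono {B C : Set G} (h : Bdd S B) (hC : C ⊆ B) : Bdd S C := by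
  obtain ⟨m, hm⟩ := h
  exact ⟨m, fun g hg => hm g (hC hg)⟩

theorem Bdd.mul {B C : Set G} (hB : Bdd S B) (hC : Bdd S C) :
    Bdd S {x | ∃ b ∈ B, ∃ c ∈ C, x = b * c} := by
  obtain ⟨m, hm⟩ := hB
  obtain ⟨n, hn⟩ := hC
  refine ⟨m + n, ?_⟩
  rintro _ ⟨b, hb, c, hc, rfl⟩
  obtain ⟨l, h1, h2, h3⟩ := hm b hb
  obtain ⟨l', h1', h2', h3'⟩ := hn c hc
  refine ⟨l ++ l', by simp; omega, ?_, by simp [h3, h3']⟩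
  intro y hy
  rcases List.mem_append.mp hy with h | h
  exacts [h2 y h, h2' y h]

theorem Bdd.inv (hS : ∀ y ∈ S, y⁻¹ ∈ S) {B : Set G} (hB : Bdd S B) :
    Bdd S {x | x⁻¹ ∈ B} := by
  obtain ⟨m, hm⟩ := hB
  refine ⟨m, fun g hg => ?_⟩
  obtain ⟨l, h1, h2, h3⟩ := hm _ hg
  refine ⟨(l.map (·⁻¹)).reverse, by simpa using h1, ?_, ?_⟩
  · intro y hy
    simp only [List.mem_reverse, List.mem_map] at hy
    obtain ⟨z, hz, rfl⟩ := hy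
    exact hS z (h2 z hz)
  · rw [← List.prod_inv_reverse, h3, inv_inv]

theorem Bdd.conj (hS : ∀ y ∈ S, ∀ g, g * y * g⁻¹ ∈ S) {B : Set G} (hB : Bdd S B) :
    Bdd S {x | ∃ g, ∃ b ∈ B, x = g * b * g⁻¹} := by
  obtain ⟨m, hm⟩ := hB
  refine ⟨m, ?_⟩
  rintro _ ⟨g, b, hb, rfl⟩
  obtain ⟨l, h1, h2, h3⟩ := hm _ hb
  refine ⟨l.map (MulAut.conj g), by simpa using h1, ?_, ?_⟩
  · intro y hy
    simp only [List.mem_map] at hy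
    obtain ⟨z, hz, rfl⟩ := hy
    exact hS z (h2 z hz) g
  · rw [← map_list_prod, h3]; simp

theorem Bdd.union {B C : Set G} (hB : Bdd S B) (hC : Bdd S C) : Bdd S (B ∪ C) := by
  obtain ⟨m, hm⟩ := hB
  obtain ⟨n, hn⟩ := hC
  refine ⟨m + n, ?_⟩
  rintro g (hg | hg)
  · obtain ⟨l, h1, h2⟩ := hm g hg
    exact ⟨l, by omega, h2⟩
  · obtain ⟨l, h1, h2⟩ := hn g hg
    exact ⟨l, by omega, h2⟩

theorem Bdd.singleton (hS : ∀ y ∈ S, y⁻¹ ∈ S) {g : G} (hg : g ∈ Subgroup.closure S) :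
    Bdd S {g} := by
  induction hg using Subgroup.closure_induction with
  | mem x hx => exact ⟨1, fun g hg => ⟨[x], by simp, by simpa using hx, by
      rw [Set.mem_singleton_iff.mp hg]; simp⟩⟩
  | one => exact ⟨0, by rintro _ rfl; exact ⟨[], by simp, by simp, by simp⟩⟩
  | mul x y _ _ hx hy => exact (hx.mul hy).mono (by rintro _ rfl; exact ⟨x, rfl, y, rfl, rfl⟩)
  | inv x _ hx => exact (hx.inv hS).mono (by rintro _ rfl; simp)

theorem Bdd.of_finite (hS : ∀ y ∈ S, y⁻¹ ∈ S) {B : Set G} (hB : B.Finite)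
    (hBS : B ⊆ Subgroup.closure S) : Bdd S B := by
  induction B, hB using Set.Finite.induction_on with
  | empty => exact ⟨0, by simp⟩
  | @insert a s _ _ ih =>
    rw [Set.insert_eq]
    exact (Bdd.singleton hS (hBS (Set.mem_insert _ _))).union
      (ih ((Set.subset_insert _ _).trans hBS))

theorem Bdd.closure_comm {T : Set G} (hT : T.Finite)
    (hc : ∀ x ∈ T, ∀ y ∈ T, x * y = y * x) (hb : ∀ x ∈ T, Bdd S (Subgroup.zpowers x : Set G)) :
    Bdd S (Subgroup.closure T : Set G) := by
  induction T, hT using Set.Finite.induction_on with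
  | empty =>
    refine ⟨0, fun g hg => ⟨[], by simp, by simp, ?_⟩⟩
    simp only [Subgroup.closure_empty, Subgroup.coe_bot, Set.mem_singleton_iff] at hg
    simp [hg]
  | @insert a s _ _ ih =>
    have h1 := ih (fun x hx y hy => hc x (Set.mem_insert_of_mem _ hx) y (Set.mem_insert_of_mem _ hy))
      (fun x hx => hb x (Set.mem_insert_of_mem _ hx))
    have h2 := (hb a (Set.mem_insert _ _)).mul h1
    refine h2.mono ?_
    have hca : ∀ y ∈ Subgroup.closure s, Commute a y := by
      intro y hy
      have : Subgroup.closure s ≤ Subgroup.centralizer {a} := by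
        rw [Subgroup.closure_le]
        intro z hz
        rw [SetLike.mem_coe, Subgroup.mem_centralizer_singleton_iff]
        exact hc _ (Set.mem_insert_of_mem _ hz) _ (Set.mem_insert _ _)
      exact (Subgroup.mem_centralizer_singleton_iff.mp (this hy)).symm
    intro x hx
    induction hx using Subgroup.closure_induction with
    | mem x hx =>
      rcases hx with rfl | hx
      · exact ⟨x, Subgroup.mem_zpowers x, 1, one_mem _, by simp⟩
      · exact ⟨1, one_mem _, x, Subgroup.subset_closure hx, by simp⟩
    | one => exact ⟨1, one_mem _, 1, one_mem _, by simp⟩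
    | mul x y _ _ hx hy =>
      obtain ⟨_, ⟨n, rfl⟩, c, hc1, rfl⟩ := hx
      obtain ⟨_, ⟨m, rfl⟩, d, hd1, rfl⟩ := hy
      refine ⟨a ^ (n + m), ⟨n + m, rfl⟩, c * d, mul_mem hc1 hd1, ?_⟩
      have : c * a ^ m = a ^ m * c := ((hca c hc1).zpow_left m).eq.symm
      simp only [zpow_add]
      rw [mul_assoc, ← mul_assoc c, this]; group
    | inv x _ hx =>
      obtain ⟨_, ⟨n, rfl⟩, c, hc1, rfl⟩ := hx
      refine ⟨a ^ (-n), ⟨-n, rfl⟩, c⁻¹, inv_mem hc1, ?_⟩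
      have : c⁻¹ * a ^ (-n) = a ^ (-n) * c⁻¹ := ((hca _ (inv_mem hc1)).zpow_left (-n)).eq.symm
      rw [← this]; simp

end bdd

/-! ### Polynomial sequences -/

section pol
variable {G : Type*} [Group G]

/-- Polynomial sequences of weight at least `k`. -/
inductive Pol (N : Subgroup G) : ℕ → (ℤ → G) → Prop
  | lin (b : G) (hb : b ∈ N) : Pol N 1 (fun n => b ^ n)
  | const (g : G) (hg : g ∈ N) : Pol N 2 (fun _ => g)
  | one (k : ℕ) : Pol N k 1
  | mul {k : ℕ} {f g : ℤ → G} (hf : Pol N k f) (hg : Pol N k g) : Pol N k (f * g)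
  | inv {k : ℕ} {f : ℤ → G} (hf : Pol N k f) : Pol N k f⁻¹
  | comm {i j : ℕ} {f g : ℤ → G} (hf : Pol N i f) (hg : Pol N j g) : Pol N (i + j) ⁅f, g⁆
  | weaken {k : ℕ} {f : ℤ → G} (hf : Pol N (k + 1) f) : Pol N k f

variable {N : Subgroup G}

theorem Pol.anti {k l : ℕ} {f : ℤ → G} (hf : Pol N k f) (h : l ≤ k) : Pol N l f := by
  induction k, h using Nat.le_induction with
  | base => exact hf
  | succ k _ ih => exact ih hf.weaken

theorem Pol.conj {i k : ℕ} {f g : ℤ → G} (hg : Pol N i g) (hf : Pol N k f) :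
    Pol N k (g * f * g⁻¹) := by
  have h : g * f * g⁻¹ = ⁅g, f⁆ * f := by simp [commutatorElement_def]
  rw [h]
  exact ((hg.comm hf).anti (by omega)).mul hf

/-- the shift -/
def shift (f : ℤ → G) : ℤ → G := fun n => f (n + 1)

theorem Pol.delta {k : ℕ} {f : ℤ → G} (hf : Pol N k f) :
    Pol N (k + 1) (shift f * f⁻¹) := by
  induction hf with
  | lin b hb =>
    have : (shift (fun n : ℤ => b ^ n) * (fun n : ℤ => b ^ n)⁻¹) = fun _ => b := by
      funext n
      simp [shift, zpow_add, ((Commute.refl b).zpow_left n).eq]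
    rw [this]; exact Pol.const b hb
  | const g hg =>
    have : (shift (fun _ : ℤ => g) * (fun _ : ℤ => g)⁻¹) = 1 := by
      funext n; simp [shift]
    rw [this]; exact Pol.one _
  | one k =>
    have : (shift (1 : ℤ → G) * (1 : ℤ → G)⁻¹) = 1 := by
      funext n; simp [shift]
    rw [this]; exact Pol.one _
  | @mul k f g hf hg ihf ihg =>
    have : shift (f * g) * (f * g)⁻¹ = (shift f * f⁻¹) * (f * (shift g * g⁻¹) * f⁻¹) := by
      funext n; simp [shift, mul_assoc]
    rw [this]; exact ihf.mul (hf.conj ihg)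
  | @inv k f hf ih =>
    have : shift f⁻¹ * f⁻¹⁻¹ = f⁻¹ * (shift f * f⁻¹)⁻¹ * f⁻¹⁻¹ := by
      funext n; simp [shift]
    rw [this]; exact hf.inv.conj ih.inv
  | @comm i j a b ha hb iha ihb =>
    set u := shift a * a⁻¹ with hu
    set v := shift b * b⁻¹ with hv
    have e1 : shift a = u * a := by simp [hu]
    have e2 : shift b = v * b := by simp [hv]
    have e : shift ⁅a, b⁆ = ⁅shift a, shift b⁆ := rfl
    have hvb : Pol N j (v * b) := ihb.weaken.mul hb
    have h1 : Pol N (i + j + 1) ⁅u, v * b⁆ := (iha.comm hvb).anti (by omega)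
    have h2 : Pol N (i + j + 1) ⁅a, v⁆ := (ha.comm ihb).anti (by omega)
    have huv : Pol N 1 (u * v) := (iha.anti (by omega)).mul (ihb.anti (by omega))
    have h3 : Pol N (i + j + 1) ⁅u * v, ⁅a, b⁆⁆ := (huv.comm (ha.comm hb)).anti (by omega)
    have h4 : Pol N (i + j) ⁅a, b⁆ := ha.comm hb
    have : shift ⁅a, b⁆ * ⁅a, b⁆⁻¹ =
        (u * ⁅a, v⁆ * u⁻¹) * ⁅u * v, ⁅a, b⁆⁆ * (⁅a, b⁆ * ⁅u, v * b⁆ * ⁅a, b⁆⁻¹) := by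
      rw [e, e1, e2]; simp only [commutatorElement_def]; group
    rw [this]
    exact ((iha.conj h2).mul h3).mul (h4.conj h1)
  | @weaken k f _ ih => exact ih.weaken

theorem Pol.conjG [N.Normal] {k : ℕ} {f : ℤ → G} (hf : Pol N k f) (g : G) :
    Pol N k (fun n => g * f n * g⁻¹) := by
  induction hf with
  | lin b hb =>
    have := Pol.lin (N := N) (g * b * g⁻¹) (Subgroup.Normal.conj_mem inferInstance b hb g)
    simpa only [conj_zpow] using this
  | const c hc => exact Pol.const _ (Subgroup.Normal.conj_mem inferInstance c hc g)
  | one k =>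
    have : (fun n : ℤ => g * (1 : ℤ → G) n * g⁻¹) = 1 := by funext n; simp
    rw [this]; exact Pol.one _
  | @mul k a b _ _ iha ihb =>
    have : (fun n : ℤ => g * (a * b) n * g⁻¹) =
      (fun n : ℤ => g * a n * g⁻¹) * (fun n : ℤ => g * b n * g⁻¹) := by funext n; simp [mul_assoc]
    rw [this]; exact iha.mul ihb
  | @inv k a _ iha =>
    have : (fun n : ℤ => g * (a⁻¹) n * g⁻¹) =
      (fun n : ℤ => g * a n * g⁻¹)⁻¹ := by funext n; simp [mul_assoc]
    rw [this]; exact iha.inv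
  | @comm i j a b _ _ iha ihb =>
    have : (fun n : ℤ => g * (⁅a, b⁆) n * g⁻¹) =
      ⁅(fun n : ℤ => g * a n * g⁻¹), (fun n : ℤ => g * b n * g⁻¹)⁆ := by
      funext n
      exact conjugate_commutatorElement _ _ _
    rw [this]; exact iha.comm ihb
  | @weaken k f _ ih => exact ih.weaken

theorem three_subgroups {H₁ H₂ H₃ D : Subgroup G} [D.Normal] (h1 : ⁅⁅H₂, H₃⁆, H₁⁆ ≤ D)
    (h2 : ⁅⁅H₃, H₁⁆, H₂⁆ ≤ D) : ⁅⁅H₁, H₂⁆, H₃⁆ ≤ D := by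
  have key : ∀ H : Subgroup G, H ≤ D ↔ H.map (QuotientGroup.mk' D) = ⊥ := by
    intro H
    rw [Subgroup.map_eq_bot_iff, QuotientGroup.ker_mk']
  rw [key] at h1 h2 ⊢
  simp only [Subgroup.map_commutator] at h1 h2 ⊢
  exact Subgroup.commutator_commutator_eq_bot_of_rotate h1 h2

theorem lcs_commutator [N.Normal] (j : ℕ) : ∀ i : ℕ,
    ⁅N.lowerCentralSeries i, N.lowerCentralSeries j⁆ ≤ N.lowerCentralSeries (i + j + 1) := by
  induction j with
  | zero => intro i; exact le_rfl
  | succ j ih =>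
    intro i
    rw [Subgroup.commutator_comm, Subgroup.lowerCentralSeries_succ N j]
    apply three_subgroups
    · rw [Subgroup.commutator_comm N]
      have := ih (i + 1)
      rw [show i + 1 + j + 1 = i + (j + 1) + 1 by omega] at this
      exact this
    · exact Subgroup.commutator_mono (ih i) le_rfl

theorem Pol.mem_lcs [N.Normal] {k : ℕ} {f : ℤ → G} (hf : Pol N k f) (n : ℤ) :
    f n ∈ N.lowerCentralSeries ((k - 1) / 2) := by
  induction hf with
  | lin b hb => exact N.zpow_mem hb n
  | const c hc => exact hc
  | one k => exact one_mem _
  | mul _ _ h1 h2 => exact mul_mem h1 h2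
  | inv _ h => exact inv_mem h
  | @comm i j a b _ _ h1 h2 =>
    have h3 := lcs_commutator _ _ (Subgroup.commutator_mem_commutator h1 h2)
    exact Subgroup.lowerCentralSeries_antitone N (by omega) h3
  | @weaken k f _ h => exact Subgroup.lowerCentralSeries_antitone N (by omega) h

theorem Pol.mem [N.Normal] {k : ℕ} {f : ℤ → G} (hf : Pol N k f) (n : ℤ) : f n ∈ N :=
  Subgroup.lowerCentralSeries_le_self N _ (hf.mem_lcs n)

end pol

/-! ### Reduced groups -/

section red
variable {G : Type*} [Group G] {S : Set G} {N : Subgroup G}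

theorem central_trivial [N.Normal] [N.FiniteIndex]
    (hconj : ∀ y ∈ S, ∀ g, g * y * g⁻¹ ∈ S)
    (hred : ∀ L : Subgroup G, L.Normal → L ≤ N → Bdd S (L : Set G) → L = ⊥)
    {t : G} (htN : t ∈ N) (htc : ∀ g ∈ N, g * t = t * g)
    (hb : Bdd S (Subgroup.zpowers t : Set G)) : t = 1 := by
  have hle : Subgroup.normalClosure {t} ≤ N := by
    apply Subgroup.normalClosure_le_normal; simpa using htN
  have hfin : (Group.conjugatesOfSet {t}).Finite := by
    refine (Set.finite_range (fun q : G ⧸ N => q.out * t * q.out⁻¹)).subset ?_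
    intro x hx
    rw [Group.mem_conjugatesOfSet_iff] at hx
    obtain ⟨a, ha, hx⟩ := hx
    rw [Set.mem_singleton_iff] at ha
    subst ha
    obtain ⟨g, rfl⟩ := isConj_iff.mp hx
    refine ⟨(g : G ⧸ N), ?_⟩
    obtain ⟨n, hn⟩ := QuotientGroup.mk_out_eq_mul N g
    have := htc n n.2
    simp only [hn, mul_inv_rev]
    calc g * n * a * ((n : G)⁻¹ * g⁻¹) = g * (n * a) * (n : G)⁻¹ * g⁻¹ := by group
      _ = _ := by rw [this]; group
  have h1 : Bdd S (Subgroup.normalClosure {t} : Set G) := by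
    apply Bdd.closure_comm hfin
    · intro x hx y hy
      rw [Group.mem_conjugatesOfSet_iff] at hx hy
      obtain ⟨a, ha, hx⟩ := hx
      obtain ⟨b, hb, hy⟩ := hy
      rw [Set.mem_singleton_iff] at ha hb
      subst ha; subst hb
      obtain ⟨g, rfl⟩ := isConj_iff.mp hx
      obtain ⟨h, rfl⟩ := isConj_iff.mp hy
      have hm : h⁻¹ * (g * b * g⁻¹) * h ∈ N := by
        have h1 : g * b * g⁻¹ ∈ N := Subgroup.Normal.conj_mem inferInstance b htN g
        simpa using Subgroup.Normal.conj_mem (H := N) inferInstance _ h1 h⁻¹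
      have := htc _ hm
      calc g * b * g⁻¹ * (h * b * h⁻¹) = h * (h⁻¹ * (g * b * g⁻¹) * h * b) * h⁻¹ := by group
        _ = _ := by rw [this]; group
    · intro x hx
      rw [Group.mem_conjugatesOfSet_iff] at hx
      obtain ⟨a, ha, hx⟩ := hx
      rw [Set.mem_singleton_iff] at ha
      subst ha
      obtain ⟨g, rfl⟩ := isConj_iff.mp hx
      refine (hb.conj hconj).mono ?_
      rintro _ ⟨n, rfl⟩
      exact ⟨g, a ^ n, ⟨n, rfl⟩, by simp [conj_zpow]⟩
  have h2 := hred _ inferInstance hle h1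
  have h3 : t ∈ Subgroup.normalClosure {t} := Subgroup.subset_normalClosure rfl
  rw [h2] at h3
  simpa using h3

theorem pol_const [N.Normal] [N.FiniteIndex]
    (hinv : ∀ y ∈ S, y⁻¹ ∈ S) (hconj : ∀ y ∈ S, ∀ g, g * y * g⁻¹ ∈ S)
    (hred : ∀ L : Subgroup G, L.Normal → L ≤ N → Bdd S (L : Set G) → L = ⊥)
    (c : ℕ) (hc : N.lowerCentralSeries c = ⊥) (j : ℕ) :
    ∀ (k : ℕ) (f : ℤ → G), 2 * c + 1 ≤ k + j → Pol N k f → Bdd S (Set.range f) →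
      ∀ n, f n = f 0 := by
  induction j with
  | zero =>
    intro k f hk hf _ n
    have h : ∀ n, f n = 1 := by
      intro n
      have h1 := Subgroup.lowerCentralSeries_antitone N (show c ≤ (k - 1) / 2 by omega)
        (hf.mem_lcs n)
      rw [hc] at h1
      simpa using h1
    rw [h, h]
  | succ j ih =>
    intro k f hk hf hb
    have hbi := hb.inv hinv
    have hd := ih (k + 1) _ (by omega) hf.delta ((hb.mul hbi).mono (by
      rintro _ ⟨n, rfl⟩
      exact ⟨f (n + 1), ⟨_, rfl⟩, (f n)⁻¹, by simp, rfl⟩))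
    set t := (shift f * f⁻¹) 0 with ht
    have hstep : ∀ n, f (n + 1) = t * f n := by
      intro n
      have h1 : f (n + 1) * (f n)⁻¹ = t := hd n
      rw [← h1]; group
    have hpow : ∀ n : ℤ, f n = t ^ n * f 0 := by
      intro n
      induction n using Int.induction_on with
      | zero => simp
      | succ n ihn =>
        rw [hstep, ihn, add_comm, zpow_add, zpow_one, mul_assoc]
      | pred n ihn =>
        have h1 := hstep (-n - 1)
        rw [sub_add_cancel, ihn] at h1
        have : f (-n - 1) = t⁻¹ * (t ^ (-n : ℤ) * f 0) := by rw [h1]; group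
        rw [this, sub_eq_neg_add, zpow_add, zpow_neg_one, mul_assoc]
    have htN : t ∈ N := hf.delta.mem 0
    have hcomm : ∀ g ∈ N, g * t = t * g := by
      intro g' hg'
      set g := (f 0)⁻¹ * g' * f 0 with hg
      have hgN : g ∈ N := N.mul_mem (N.mul_mem (N.inv_mem (hf.mem 0)) hg') (hf.mem 0)
      have h1 : Pol N (k + 1) ⁅f, fun _ => g⁆ := (hf.comm (Pol.const g hgN)).weaken
      have h2 := ih (k + 1) _ (by omega) h1 ((hb.mul (hbi.conj hconj)).mono (by
        rintro _ ⟨n, rfl⟩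
        refine ⟨f n, ⟨_, rfl⟩, g * (f n)⁻¹ * g⁻¹, ⟨g, _, by simp, rfl⟩, ?_⟩
        change f n * g * (f n)⁻¹ * g⁻¹ = _
        group)) 1
      have h3 : f 1 * g * (f 1)⁻¹ * g⁻¹ = f 0 * g * (f 0)⁻¹ * g⁻¹ := h2
      have h4 := mul_right_cancel h3
      rw [hpow 1] at h4
      have e1 : f 0 * g * (f 0)⁻¹ = g' := by rw [hg]; group
      have e2 : t ^ (1 : ℤ) * f 0 * g * (t ^ (1 : ℤ) * f 0)⁻¹ = t * (f 0 * g * (f 0)⁻¹) * t⁻¹ := by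
        group
      rw [e2, e1] at h4
      calc g' * t = t * g' * t⁻¹ * t := by rw [h4]
        _ = t * g' := by group
    have hbt : Bdd S (Subgroup.zpowers t : Set G) := by
      refine (hb.mul hbi).mono ?_
      rintro _ ⟨n, rfl⟩
      refine ⟨f n, ⟨_, rfl⟩, (f 0)⁻¹, by simp, ?_⟩
      rw [hpow n]; simp
    have ht1 := central_trivial hconj hred htN hcomm hbt
    intro n
    rw [hpow n, ht1]; simp

end red

/-! ### Finite `p`-quotients -/

theorem krull_comm {A : Type*} [CommGroup A] (hA : Group.FG A) (p : ℕ) (y : A)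
    (hy : ∀ e : ℕ, ∃ z : A, z ^ (p ^ e) = y) (hp : 1 < p) : ∃ r : ℕ, ¬ p ∣ r ∧ y ^ r = 1 := by
  have h1 : AddGroup.FG (Additive A) := inferInstance
  have h2 : Module.Finite ℤ (Additive A) := Module.Finite.iff_addGroup_fg.mpr h1
  have h3 : Additive.ofMul y ∈
      (⨅ i : ℕ, (Ideal.span {(p : ℤ)}) ^ i • ⊤ : Submodule ℤ (Additive A)) := by
    rw [Submodule.mem_iInf]
    intro e
    obtain ⟨z, hz⟩ := hy e
    have : Additive.ofMul y = ((p : ℤ) ^ e) • Additive.ofMul z := by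
      rw [← hz, ofMul_pow]
      have : ((p : ℤ) ^ e) = ((p ^ e : ℕ) : ℤ) := by push_cast; rfl
      rw [this, natCast_zsmul]
    rw [this]
    exact Submodule.smul_mem_smul (Ideal.pow_mem_pow (Ideal.mem_span_singleton_self _) e)
      Submodule.mem_top
  rw [Ideal.mem_iInf_smul_pow_eq_bot_iff] at h3
  obtain ⟨⟨r, hr⟩, h4⟩ := h3
  obtain ⟨k, rfl⟩ := Ideal.mem_span_singleton.mp hr
  have h5 : y ^ ((p : ℤ) * k) = y := congrArg Additive.toMul h4
  have h6 : y ^ (1 - (p : ℤ) * k) = 1 := by rw [zpow_sub, h5]; simp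
  refine ⟨(1 - (p : ℤ) * k).natAbs, ?_, ?_⟩
  · intro h
    rw [← Int.natCast_dvd] at h
    have : (p : ℤ) ∣ 1 := by
      have := dvd_add h (dvd_mul_right (p : ℤ) k)
      simpa using this
    have := Int.natCast_dvd_natCast.mp (by simpa using this : (p : ℤ) ∣ ((1 : ℕ) : ℤ))
    have := Nat.le_of_dvd one_pos this
    omega
  · have : y ^ (((1 - (p : ℤ) * k).natAbs : ℕ) : ℤ) = 1 := by
      rcases Int.natAbs_eq (1 - (p : ℤ) * k) with h | h
      · rw [← h]; exact h6
      · have h' : (((1 - (p : ℤ) * k).natAbs : ℕ) : ℤ) = -(1 - (p : ℤ) * k) := by omega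
        rw [h', zpow_neg, h6, inv_one]
    simpa using this

theorem isPGroup_of_center (p e : ℕ) (G : Type*) [Group G] [Group.IsNilpotent G]
    (h : ∀ z ∈ center G, z ^ (p ^ e) = 1) : IsPGroup p G := by
  revert h
  refine Group.nilpotent_center_quotient_ind
    (P := fun G _ _ => (∀ z ∈ center G, z ^ (p ^ e) = 1) → IsPGroup p G) G ?_ ?_
  · intro G _ _ _ g
    exact ⟨0, Subsingleton.elim _ _⟩
  · intro G _ _ ih hz
    have h1 := ih (by
      intro q hq
      obtain ⟨y, rfl⟩ := QuotientGroup.mk'_surjective _ q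
      rw [← map_pow, ← MonoidHom.mem_ker, QuotientGroup.ker_mk', mem_center_iff]
      intro g
      have hc : ⁅g, y⁆ ∈ center G := by
        rw [← QuotientGroup.ker_mk' (center G), MonoidHom.mem_ker, map_commutatorElement,
          commutatorElement_eq_one_iff_mul_comm]
        exact mem_center_iff.mp hq _
      have h2 := hz _ hc
      have h3 : g * y * g⁻¹ = ⁅g, y⁆ * y := by simp [commutatorElement_def]
      have h4 : Commute ⁅g, y⁆ y := (mem_center_iff.mp hc y).symm
      have h5 : g * y ^ (p ^ e) * g⁻¹ = y ^ (p ^ e) := by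
        rw [← conj_pow, h3, h4.mul_pow, h2, one_mul]
      exact mul_inv_eq_iff_eq_mul.mp h5)
    intro g
    obtain ⟨k, hk⟩ := h1 (QuotientGroup.mk' _ g)
    rw [← map_pow, ← MonoidHom.mem_ker, QuotientGroup.ker_mk'] at hk
    refine ⟨k + e, ?_⟩
    rw [pow_add, pow_mul]; exact hz _ hk

theorem finite_of_pgroup (p : ℕ) (hp : p ≠ 0) (G : Type*) [Group G] [Group.IsNilpotent G]
    (hfg : ∀ H : Subgroup G, H.FG) (h : IsPGroup p G) : Finite G := by
  revert hfg h
  refine Group.nilpotent_center_quotient_ind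
    (P := fun G _ _ => (∀ H : Subgroup G, H.FG) → IsPGroup p G → Finite G) G ?_ ?_
  · intro G _ _ _ _
    infer_instance
  · intro G _ _ ih hfg h
    have h1 : Finite (G ⧸ center G) := ih (by
      intro H
      have := fg_map (QuotientGroup.mk' (center G)) (hfg (H.comap (QuotientGroup.mk' (center G))))
      rwa [map_comap_eq_self_of_surjective (QuotientGroup.mk'_surjective _)] at this)
      (h.to_quotient _)
    have h2 : Group.FG (center G) := (Group.fg_iff_subgroup_fg _).mpr (hfg _)
    have h3 : Finite (center G) := by
      let i0 : CommGroup (center G) :=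
        { (inferInstance : Group (center G)) with
          mul_comm := fun a b => Subtype.ext (mem_center_iff.mp b.2 a) }
      have i3 : @Group.FG (center G) i0.toGroup := h2
      refine CommGroup.finite_of_fg_isMulTorsion (center G) ?_
      intro z
      exact (h.to_subgroup _).isOfFinOrder hp z
    apply Nat.finite_of_card_ne_zero
    rw [← (center G).card_mul_index]
    have := Nat.card_pos (α := center G)
    have h4 : (center G).index ≠ 0 := by
      rw [Subgroup.index]; exact Nat.card_pos.ne'
    exact mul_ne_zero this.ne' h4

/-! ### Words -/

section words
variable {k : ℕ} (w : FreeGroup (Fin k))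

/-- word values and their inverses -/
def Sw (G : Type*) [Group G] : Set G :=
  {y | (∃ a : Fin k → G, FreeGroup.lift a w = y) ∨ (∃ a : Fin k → G, FreeGroup.lift a w = y⁻¹)}

/-- word values -/
def Vw (G : Type*) [Group G] : Set G := {x : G | ∃ a : Fin k → G, FreeGroup.lift a w = x}

variable {G : Type*} [Group G]

theorem map_lift {G' : Type*} [Group G'] (f : G →* G') (a : Fin k → G) :
    f (FreeGroup.lift a w) = FreeGroup.lift (fun i => f (a i)) w := by
  have : f.comp (FreeGroup.lift a) = FreeGroup.lift (fun i => f (a i)) := by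
    ext i; simp
  exact DFunLike.congr_fun this w

theorem Sw_inv : ∀ y ∈ Sw w G, y⁻¹ ∈ Sw w G := by
  rintro y (h | h)
  · right; simpa using h
  · left; exact h

theorem Sw_conj : ∀ y ∈ Sw w G, ∀ g, g * y * g⁻¹ ∈ Sw w G := by
  rintro y (⟨a, h⟩ | ⟨a, h⟩) g
  · left
    refine ⟨fun i => MulAut.conj g (a i), ?_⟩
    have := map_lift w (MulAut.conj g).toMonoidHom a
    simp only [MulEquiv.coe_toMonoidHom] at this
    change FreeGroup.lift (fun i => (MulAut.conj g) (a i)) w = _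
    rw [← MulAut.conj_apply, ← h]; exact this.symm
  · right
    refine ⟨fun i => MulAut.conj g (a i), ?_⟩
    have := map_lift w (MulAut.conj g).toMonoidHom a
    simp only [MulEquiv.coe_toMonoidHom] at this
    change FreeGroup.lift (fun i => (MulAut.conj g) (a i)) w = _
    rw [← MulAut.conj_apply, ← map_inv, ← h]; exact this.symm

theorem pol_word (N : Subgroup G) [N.Normal] (a : Fin k → G) (i : Fin k) (b : G) (hb : b ∈ N) :
    Pol N 1 (fun n : ℤ => FreeGroup.lift (Function.update a i (a i * b ^ n)) w *
      (FreeGroup.lift a w)⁻¹) := by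
  induction w using FreeGroup.induction_on with
  | C1 =>
    have : Pol N 1 (fun _ : ℤ => (1 : G)) := Pol.one 1
    simpa using this
  | of j =>
    by_cases hj : j = i
    · subst hj
      have := (Pol.lin (N := N) b hb).conjG (a j)
      simpa using this
    · have : Pol N 1 (fun _ : ℤ => (1 : G)) := Pol.one 1
      simpa [hj] using this
  | inv_of j ih =>
    have := (ih.inv).conjG ((FreeGroup.lift a (FreeGroup.of j))⁻¹)
    convert this using 2
    simp
  | mul u v hu hv =>
    have := hu.mul (hv.conjG (FreeGroup.lift a u))
    convert this using 1
    funext n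
    simp [mul_assoc]

theorem marginal_step {N : Subgroup G} [N.Normal] [N.FiniteIndex]
    (hred : ∀ L : Subgroup G, L.Normal → L ≤ N → Bdd (Sw w G) (L : Set G) → L = ⊥)
    (c : ℕ) (hc : N.lowerCentralSeries c = ⊥) (a : Fin k → G) (i : Fin k) (b : G) (hb : b ∈ N) :
    FreeGroup.lift (Function.update a i (a i * b)) w = FreeGroup.lift a w := by
  have h := pol_const (Sw_inv w) (Sw_conj w) hred c hc (2 * c) 1 _ (by omega) (pol_word w N a i b hb)
    (by
      refine ⟨2, ?_⟩
      rintro _ ⟨n, rfl⟩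
      refine ⟨[FreeGroup.lift (Function.update a i (a i * b ^ n)) w, (FreeGroup.lift a w)⁻¹],
        by simp, ?_, by simp⟩
      intro y hy
      simp only [List.mem_cons, List.not_mem_nil, or_false] at hy
      rcases hy with rfl | rfl
      · left; exact ⟨_, rfl⟩
      · right; exact ⟨a, by simp⟩) 1
  simp only [zpow_one, zpow_zero, mul_one, Function.update_eq_self] at h
  exact mul_right_cancel h

theorem marginal {N : Subgroup G}
    (hstep : ∀ (a : Fin k → G) (i : Fin k) (b : G), b ∈ N →
      FreeGroup.lift (Function.update a i (a i * b)) w = FreeGroup.lift a w)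
    (a a' : Fin k → G) (h : ∀ i, (a i)⁻¹ * a' i ∈ N) :
    FreeGroup.lift a' w = FreeGroup.lift a w := by
  have key : ∀ s : Finset (Fin k),
      FreeGroup.lift (fun i => if i ∈ s then a' i else a i) w = FreeGroup.lift a w := by
    intro s
    induction s using Finset.induction_on with
    | empty => simp
    | insert j s hj ih =>
      rw [← ih, ← hstep (fun i => if i ∈ s then a' i else a i) j _ (h j)]
      congr 2
      funext i
      by_cases hi : i = j
      · subst hi; simp [hj]
      · simp [hi]
  have := key Finset.univ
  simpa using this

theorem comm_of_marginal {N : Subgroup G} [N.Normal]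
    (hm : ∀ a a' : Fin k → G, (∀ i, (a i)⁻¹ * a' i ∈ N) →
      FreeGroup.lift a' w = FreeGroup.lift a w)
    {x : G} (hx : x ∈ closure (Vw w G)) : ∀ g ∈ N, g * x = x * g := by
  intro g hg
  have : closure (Vw w G) ≤ centralizer {g} := by
    rw [closure_le]
    rintro _ ⟨a, rfl⟩
    rw [SetLike.mem_coe, mem_centralizer_singleton_iff]
    have h1 : g * FreeGroup.lift a w * g⁻¹ = FreeGroup.lift (fun i => g * a i * g⁻¹) w :=
      map_lift w (MulAut.conj g).toMonoidHom a
    have h5 : FreeGroup.lift (fun i => g * a i * g⁻¹) w = FreeGroup.lift a w := by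
      apply hm
      intro i
      have h3 : (a i)⁻¹ * g * a i ∈ N := by
        simpa using Normal.conj_mem (H := N) inferInstance g hg (a i)⁻¹
      have h4 := N.mul_mem h3 (N.inv_mem hg)
      change (a i)⁻¹ * (g * a i * g⁻¹) ∈ N
      convert h4 using 1; group
    exact (mul_inv_eq_iff_eq_mul.mp (h1.trans h5)).symm
  exact (mem_centralizer_singleton_iff.mp (this hx)).symm

theorem torsion_of_marginal {N : Subgroup G} [N.Normal] [N.FiniteIndex]
    (hmax : ∀ H ≤ N, H.FG) (hnil : Group.IsNilpotent N)
    (hm : ∀ a a' : Fin k → G, (∀ i, (a i)⁻¹ * a' i ∈ N) →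
      FreeGroup.lift a' w = FreeGroup.lift a w)
    {x : G} (hx : x ∈ closure (Vw w G)) (hxN : x ∈ N) : IsOfFinOrder x := by
  by_contra hinf
  have hxc := comm_of_marginal w hm hx
  obtain ⟨p, hpN, hp⟩ := Nat.exists_infinite_primes (N.index + 1)
  have hpf : Fact p.Prime := ⟨hp⟩
  obtain ⟨M, ⟨hMn, hMN, hMx⟩, hMmax⟩ := exists_maximal_subgroup N hmax
    (fun M => M.Normal ∧ M ≤ N ∧ ∀ n : ℕ, ¬ p ∣ n → x ^ n ∉ M) (fun H h => h.2.1)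
    ⟨⊥, inferInstance, bot_le, by
      intro n hn h
      rw [mem_bot] at h
      apply hinf
      rw [isOfFinOrder_iff_pow_eq_one]
      refine ⟨n, Nat.pos_of_ne_zero ?_, h⟩
      rintro rfl
      exact hn (dvd_zero p)⟩
  set π := QuotientGroup.mk' M with hπ
  have hπs : Function.Surjective π := QuotientGroup.mk'_surjective M
  have hker : π.ker = M := QuotientGroup.ker_mk' M
  set Nb := N.map π with hNb
  have hNbn : Nb.Normal := Normal.map inferInstance π hπs
  have hcm : Nb.comap π = N := comap_map_eq_self (by rw [hker]; exact hMN)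
  have hmaxb : ∀ H ≤ Nb, H.FG := by
    intro H hH
    have h1 : H.comap π ≤ N := by rw [← hcm]; exact comap_mono hH
    have h2 := fg_map π (hmax _ h1)
    rwa [map_comap_eq_self_of_surjective hπs] at h2
  have hnilb : Group.IsNilpotent Nb :=
    Group.nilpotent_of_surjective (π.subgroupMap N) (π.subgroupMap_surjective N)
  have hxb : π x ∈ Nb := mem_map_of_mem _ hxN
  -- maximality
  have hlarge : ∀ L : Subgroup (G ⧸ M), L.Normal → L ≤ Nb → L ≠ ⊥ →
      ∃ n : ℕ, ¬ p ∣ n ∧ π x ^ n ∈ L := by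
    intro L hL hLN hLb
    by_contra hcon
    push Not at hcon
    apply hLb
    have h1 : M ≤ L.comap π := hker.ge.trans (ker_le_comap π L)
    have h2 := hMmax (y := L.comap π) ⟨hL.comap π, by rw [← hcm]; exact comap_mono hLN, by
      intro n hn h
      apply hcon n hn
      rw [← map_pow]; exact h⟩ h1
    rw [← map_comap_eq_self_of_surjective hπs L, eq_bot_iff, map_le_iff_le_comap]
    exact h2.trans hker.ge
  -- the centre of `Nb`
  set Z : Subgroup (G ⧸ M) := Nb ⊓ centralizer Nb with hZ
  have hZn : Z.Normal := inferInstance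
  have hZc : ∀ y ∈ Z, ∀ z ∈ Z, y * z = z * y := fun y hy z hz =>
    mem_centralizer_iff.mp hz.2 y hy.1
  have hxZ : π x ∈ Z := by
    refine ⟨hxb, mem_centralizer_iff.mpr ?_⟩
    rintro _ ⟨g, hg, rfl⟩
    rw [← map_mul, hxc g hg, map_mul]
  have hexp : ∃ e : ℕ, ∀ z ∈ Z, z ^ (p ^ e) = 1 := by
    by_contra hcon
    push Not at hcon
    have hroot : ∀ e : ℕ, ∃ z ∈ Z, z ^ (p ^ e) = π x := by
      intro e
      let L : Subgroup (G ⧸ M) :=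
        { carrier := {y | ∃ z ∈ Z, z ^ (p ^ e) = y}
          one_mem' := ⟨1, one_mem _, one_pow _⟩
          mul_mem' := by
            rintro _ _ ⟨y, hy, rfl⟩ ⟨z, hz, rfl⟩
            exact ⟨y * z, mul_mem hy hz, (show Commute y z from hZc y hy z hz).mul_pow _⟩
          inv_mem' := by
            rintro _ ⟨y, hy, rfl⟩
            exact ⟨y⁻¹, inv_mem hy, inv_pow _ _⟩ }
      have hLn : L.Normal := by
        refine ⟨?_⟩
        rintro _ ⟨z, hz, rfl⟩ g
        exact ⟨g * z * g⁻¹, hZn.conj_mem z hz g, conj_pow⟩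
      have hLN : L ≤ Nb := by
        rintro _ ⟨z, hz, rfl⟩
        exact Nb.pow_mem hz.1 _
      have hLb : L ≠ ⊥ := by
        intro h
        obtain ⟨z, hz, hz1⟩ := hcon e
        apply hz1
        have : z ^ (p ^ e) ∈ L := ⟨z, hz, rfl⟩
        rw [h] at this
        simpa using this
      obtain ⟨n, hn, z, hz, hzn⟩ := hlarge L hLn hLN hLb
      have hcop : IsCoprime (n : ℤ) ((p ^ e : ℕ) : ℤ) := by
        rw [Nat.isCoprime_iff_coprime]
        exact Nat.Coprime.pow_right e (((Nat.Prime.coprime_iff_not_dvd hp).mpr hn).symm)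
      obtain ⟨u, v, huv⟩ := hcop
      refine ⟨z ^ u * π x ^ v, mul_mem (Z.zpow_mem hz u) (Z.zpow_mem hxZ v), ?_⟩
      have hcz : Commute (z ^ u) (π x ^ v) :=
        (show Commute z (π x) from hZc z hz _ hxZ).zpow_zpow u v
      rw [hcz.mul_pow, ← zpow_natCast, ← zpow_natCast, ← zpow_mul, ← zpow_mul, mul_comm u,
        zpow_mul, zpow_natCast, hzn, ← zpow_natCast, ← zpow_mul, ← zpow_add,
        mul_comm (n : ℤ), huv, zpow_one]
    let _ : CommGroup Z := { (inferInstance : Group Z) with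
      mul_comm := fun a b => Subtype.ext (hZc a a.2 b b.2) }
    have hZfg : Group.FG Z := (Group.fg_iff_subgroup_fg Z).mpr (hmaxb Z inf_le_left)
    obtain ⟨r, hr, hr1⟩ := krull_comm hZfg p (⟨π x, hxZ⟩ : Z) (by
      intro e
      obtain ⟨z, hz, hze⟩ := hroot e
      exact ⟨⟨z, hz⟩, Subtype.ext hze⟩) hp.one_lt
    have h1 : π x ^ r = 1 := congrArg Subtype.val hr1
    apply hMx r hr
    rw [← hker, MonoidHom.mem_ker, map_pow, h1]
  obtain ⟨e, he⟩ := hexp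
  have hpg : IsPGroup p Nb := by
    apply isPGroup_of_center p e
    intro z hz
    apply Subtype.ext
    refine he z ⟨z.2, mem_centralizer_iff.mpr ?_⟩
    intro g hg
    exact congrArg Subtype.val (mem_center_iff.mp hz ⟨g, hg⟩)
  have hfin : Finite Nb := by
    refine finite_of_pgroup p hp.ne_zero Nb ?_ hpg
    intro H
    have h1 := hmaxb (H.map Nb.subtype) (map_subtype_le H)
    have h2 : Group.FG (H.map Nb.subtype) := (Group.fg_iff_subgroup_fg _).mpr h1
    have h3 : Group.FG H := Group.fg_of_surjective
      (f := (H.equivMapOfInjective Nb.subtype Nb.subtype_injective).symm.toMonoidHom)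
      (MulEquiv.surjective _)
    exact (Group.fg_iff_subgroup_fg _).mp h3
  have hcop : Nat.Coprime (Nat.card Nb) Nb.index := by
    obtain ⟨n, hn⟩ := IsPGroup.iff_card.mp hpg
    rw [hn, hNb, index_map_eq _ hπs (by rw [hker]; exact hMN)]
    apply Nat.Coprime.pow_left
    rw [Nat.Prime.coprime_iff_not_dvd hp]
    intro hd
    have h0 : N.index ≠ 0 := FiniteIndex.index_ne_zero
    have := Nat.le_of_dvd (Nat.pos_of_ne_zero h0) hd
    omega
  obtain ⟨H, hH⟩ := exists_right_complement'_of_coprime hcop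
  have hWH : closure (Vw w G) ≤ H.comap π := by
    rw [closure_le]
    rintro _ ⟨a, rfl⟩
    have hc : ∀ i, ∃ c : G, π c ∈ H ∧ c⁻¹ * a i ∈ N := by
      intro i
      have h1 : π (a i) ∈ Nb ⊔ H := by rw [hH.isCompl.sup_eq_top]; exact mem_top _
      obtain ⟨n, hn, h, hh, hnh⟩ := mem_sup_of_normal_left.mp h1
      obtain ⟨c, rfl⟩ := hπs h
      refine ⟨c, hh, ?_⟩
      rw [← hcm, mem_comap, map_mul, map_inv, ← hnh]
      simpa [mul_assoc] using hNbn.conj_mem n hn (π c)⁻¹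
    choose c hc1 hc2 using hc
    rw [hm c a hc2, SetLike.mem_coe, mem_comap, map_lift]
    have : ∀ v : FreeGroup (Fin k), FreeGroup.lift (fun i => π (c i)) v ∈ H := by
      intro v
      induction v using FreeGroup.induction_on with
      | C1 => simp
      | of j => simpa using hc1 j
      | inv_of j _ => simpa using hc1 j
      | mul u v hu hv => rw [map_mul]; exact mul_mem hu hv
    exact this w
  have h1 : π x ∈ Nb ⊓ H := ⟨hxb, hWH hx⟩
  rw [hH.isCompl.inf_eq_bot, mem_bot] at h1
  apply hMx 1 (by simpa using hp.one_lt.ne')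
  rw [pow_one, ← hker]; exact h1

theorem reduced_bdd {N : Subgroup G} [N.Normal] [N.FiniteIndex]
    (hmax : ∀ H ≤ N, H.FG) (hnil : Group.IsNilpotent N)
    (hred : ∀ L : Subgroup G, L.Normal → L ≤ N → Bdd (Sw w G) (L : Set G) → L = ⊥) :
    Bdd (Sw w G) (closure (Vw w G) : Set G) := by
  have hVS : closure (Vw w G) ≤ closure (Sw w G) := closure_mono fun x hx => Or.inl hx
  obtain ⟨c, hc⟩ := Subgroup.nilpotent_iff_lowerCentralSeries.mp hnil
  have hc' : N.lowerCentralSeries c = ⊥ := by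
    have h1 := map_lowerCentralSeries (⊤ : Subgroup N) N.subtype c
    rw [hc, Subgroup.map_bot, ← MonoidHom.range_eq_map, range_subtype] at h1
    exact h1.symm
  have hm := marginal w (marginal_step w hred c hc')
  have htriv : ∀ x ∈ closure (Vw w G), x ∈ N → x = 1 := by
    intro x hx hxN
    have hfin := torsion_of_marginal w hmax hnil hm hx hxN
    refine central_trivial (Sw_conj w) hred hxN (comm_of_marginal w hm hx) ?_
    refine Bdd.of_finite (Sw_inv w) ?_ ?_
    · rw [← Set.finite_coe_iff]; exact finite_zpowers.mpr hfin
    · exact zpowers_le.mpr (hVS hx)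
  refine Bdd.of_finite (Sw_inv w) ?_ hVS
  refine Set.Finite.of_finite_image (f := (QuotientGroup.mk : G → G ⧸ N)) (Set.toFinite _) ?_
  intro a ha b hb hab
  have h1 : a⁻¹ * b ∈ N := QuotientGroup.eq.mp hab
  have h2 := htriv _ (mul_mem (inv_mem ha) hb) h1
  exact inv_mul_eq_one.mp h2

theorem bdd_comap {K : Subgroup G} [K.Normal] (hK : Bdd (Sw w G) (K : Set G))
    {L : Subgroup (G ⧸ K)} (hL : Bdd (Sw w (G ⧸ K)) (L : Set (G ⧸ K))) :
    Bdd (Sw w G) (L.comap (QuotientGroup.mk' K) : Set G) := by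
  obtain ⟨m, hm⟩ := hL
  have hlift : ∀ y ∈ Sw w (G ⧸ K), ∃ z ∈ Sw w G, QuotientGroup.mk' K z = y := by
    rintro y (⟨a, ha⟩ | ⟨a, ha⟩)
    · choose c hc using fun i => QuotientGroup.mk'_surjective K (a i)
      refine ⟨FreeGroup.lift c w, Or.inl ⟨c, rfl⟩, ?_⟩
      rw [map_lift, ← ha]; congr 2; funext i; exact hc i
    · choose c hc using fun i => QuotientGroup.mk'_surjective K (a i)
      refine ⟨(FreeGroup.lift c w)⁻¹, Or.inr ⟨c, by simp⟩, ?_⟩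
      rw [map_inv, inv_eq_iff_eq_inv, map_lift, ← ha]; congr 2; funext i; exact hc i
  have hlist : ∀ l : List (G ⧸ K), (∀ y ∈ l, y ∈ Sw w (G ⧸ K)) → ∃ l' : List G,
      l'.length = l.length ∧ (∀ y ∈ l', y ∈ Sw w G) ∧ QuotientGroup.mk' K l'.prod = l.prod := by
    intro l
    induction l with
    | nil => intro _; exact ⟨[], rfl, by simp, by simp⟩
    | cons a l ih =>
      intro h
      obtain ⟨l', h1, h2, h3⟩ := ih fun y hy => h y (List.mem_cons_of_mem _ hy)
      obtain ⟨z, hz, hza⟩ := hlift a (h a List.mem_cons_self)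
      refine ⟨z :: l', by simp [h1], ?_, ?_⟩
      · intro y hy
        rcases List.mem_cons.mp hy with rfl | hy
        exacts [hz, h2 y hy]
      · rw [List.prod_cons, List.prod_cons, map_mul, hza, h3]
  have h1 : Bdd (Sw w G) {g : G | ∃ l : List G, l.length ≤ m ∧ (∀ y ∈ l, y ∈ Sw w G) ∧ l.prod = g} :=
    ⟨m, fun g hg => hg⟩
  refine (h1.mul hK).mono ?_
  intro g hg
  obtain ⟨l, hl1, hl2, hl3⟩ := hm (QuotientGroup.mk' K g) hg
  obtain ⟨l', h1', h2', h3'⟩ := hlist l hl2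
  refine ⟨l'.prod, ⟨l', by omega, h2', rfl⟩, l'.prod⁻¹ * g, ?_, by group⟩
  exact QuotientGroup.eq.mp (h3'.trans hl3)

theorem main_bdd {N : Subgroup G} [N.Normal] [N.FiniteIndex]
    (hmax : ∀ H ≤ N, H.FG) (hnil : Group.IsNilpotent N) :
    Bdd (Sw w G) (closure (Vw w G) : Set G) := by
  obtain ⟨K, ⟨hKn, hKN, hKb⟩, hKmax⟩ := exists_maximal_subgroup N hmax
    (fun K => K.Normal ∧ K ≤ N ∧ Bdd (Sw w G) (K : Set G)) (fun H h => h.2.1)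
    ⟨⊥, inferInstance, bot_le, ⟨0, fun g hg => ⟨[], by simp, by simp, by
      simpa using (mem_bot.mp hg).symm⟩⟩⟩
  set π := QuotientGroup.mk' K with hπ
  have hπs : Function.Surjective π := QuotientGroup.mk'_surjective K
  have hker : π.ker = K := QuotientGroup.ker_mk' K
  have hcm : (N.map π).comap π = N := comap_map_eq_self (by rw [hker]; exact hKN)
  have i1 : (N.map π).Normal := Normal.map inferInstance π hπs
  have i2 : (N.map π).FiniteIndex := ⟨by
    rw [index_map_eq _ hπs (by rw [hker]; exact hKN)]; exact FiniteIndex.index_ne_zero⟩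
  have h := reduced_bdd w (N := N.map π) (by
      intro H hH
      have h1 : H.comap π ≤ N := by rw [← hcm]; exact comap_mono hH
      have h2 := fg_map π (hmax _ h1)
      rwa [map_comap_eq_self_of_surjective hπs] at h2)
    (Group.nilpotent_of_surjective (π.subgroupMap N) (π.subgroupMap_surjective N))
    (by
      intro L hL hLN hLb
      have h1 : K ≤ L.comap π := hker.ge.trans (ker_le_comap π L)
      have h2 := hKmax (y := L.comap π) ⟨hL.comap π, by rw [← hcm]; exact comap_mono hLN,
        bdd_comap w hKb hLb⟩ h1
      rw [← map_comap_eq_self_of_surjective hπs L, eq_bot_iff, map_le_iff_le_comap]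
      exact h2.trans hker.ge)
  refine (bdd_comap w hKb h).mono ?_
  rw [SetLike.coe_subset_coe, closure_le]
  rintro _ ⟨a, rfl⟩
  exact subset_closure ⟨fun i => π (a i), (map_lift w π a).symm⟩

end words

end Romankov


/-- Theorem of Romankov: a finitely generated virtually nilpotent group is verbally
elliptic, i.e. every word `w` has finite width: there is `N ≥ 1` such that every element
of the verbal subgroup `⟨w(G)⟩` is a product of at most `N` elements from
`w(G) ∪ w(G)⁻¹`. -/
theorem romankov_virtually_nilpotent_verbally_elliptic
    (G : Type*) [Group G] (hfg : Group.FG G)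
    (hvn : ∃ H : Subgroup G, H.FiniteIndex ∧ Group.IsNilpotent H)
    (k : ℕ) (w : FreeGroup (Fin k)) (hw : w ≠ 1) :
    ∃ N : ℕ, 1 ≤ N ∧
      ∀ g ∈ Subgroup.closure {x : G | ∃ a : Fin k → G, FreeGroup.lift a w = x},
        ∃ l : List G, l.length ≤ N ∧
          (∀ y ∈ l, (∃ a : Fin k → G, FreeGroup.lift a w = y) ∨
            (∃ a : Fin k → G, FreeGroup.lift a w = y⁻¹)) ∧
          l.prod = g := by
  obtain ⟨H, hH, hnil⟩ := hvn
  have i1 : H.normalCore.FiniteIndex := inferInstance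
  have hfgN : H.normalCore.FG := (Group.fg_iff_subgroup_fg _).mp inferInstance
  have hnilN : Group.IsNilpotent H.normalCore := by
    have h1 : Group.IsNilpotent (H.normalCore.subgroupOf H) := inferInstance
    exact Group.nilpotent_of_mulEquiv (Subgroup.subgroupOfEquivOfLe H.normalCore_le)
  obtain ⟨m, hm⟩ := Romankov.main_bdd w (N := H.normalCore)
    (Romankov.fg_of_le_nilpotent _ hfgN hnilN) hnilN
  refine ⟨m + 1, by omega, fun g hg => ?_⟩
  obtain ⟨l, h1, h2, h3⟩ := hm g hg
  exact ⟨l, by omega, h2, h3⟩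
end

section
/- Let K be an algebraically closed field of characteristic zero, let L be a finite-dimensional simple Lie algebra over K, and let A be a commutative associative unital K-algebra. Consider the current algebra A ⊗_K L, the tensor product equipped with the Lie bracket determined by [a ⊗ x, b ⊗ y] = ab ⊗ [x,y]. Then every element of the derived subalgebra [A ⊗_K L, A ⊗_K L] is a sum of at most two Lie brackets: z = [u₁,v₁] + [u₂,v₂] for some u₁,v₁,u₂,v₂ ∈ A ⊗_K L. In other words, the bracket width of A ⊗_K L is at most 2. -/
open scoped TensorProduct

/-- Two elements of `L` with trivial common centralizer. -/
lemma exists_pair_trivial_centralizer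
    (K : Type*) [Field K] [IsAlgClosed K] [CharZero K]
    (L : Type*) [LieRing L] [LieAlgebra K L] [FiniteDimensional K L]
    [LieAlgebra.IsKilling K L] :
    ∃ x y : L, ∀ w : L, ⁅x, w⁆ = 0 → ⁅w, y⁆ = 0 → w = 0 := by
  classical
  obtain ⟨x, hx⟩ := LieAlgebra.exists_isCartanSubalgebra_engel K L
  generalize hH : LieSubalgebra.engel K x = H at hx
  have := Fintype.ofFinite (LieModule.Weight K H L)
  choose e he hne using fun α : LieModule.Weight K H L => α.exists_ne_zero
  refine ⟨x, ∑ α, e α, fun w hxw hwy => ?_⟩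
  have hw : w ∈ H := by
    rw [← hH, LieSubalgebra.mem_engel_iff]
    exact ⟨1, by simpa using hxw⟩
  have hind : LinearIndependent K e := by
    have h := LieModule.iSupIndep_genWeightSpace' K H L
    rw [← LieSubmodule.iSupIndep_toSubmodule] at h
    exact h.linearIndependent _ (fun α => he α) hne
  have hz : ∑ α : LieModule.Weight K H L, α ⟨w, hw⟩ • e α = 0 := by
    rw [← hwy, lie_sum]
    refine Finset.sum_congr rfl fun α _ => ?_
    exact (LieAlgebra.IsKilling.lie_eq_smul_of_mem_rootSpace (he α) ⟨w, hw⟩).symm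
  have hα := Fintype.linearIndependent_iff.mp hind _ hz
  have hmem : (⟨w, hw⟩ : H) ∈ ⨅ α : LieModule.Weight K H L, α.ker := by
    rw [Submodule.mem_iInf]
    exact fun α => hα α
  rw [LieAlgebra.IsKilling.iInf_ker_weight_eq_bot] at hmem
  exact congrArg Subtype.val ((Submodule.mem_bot K).mp hmem)

/-- Two elements `x`, `y` of `L` with `[x, L] + [y, L] = L`. -/
lemma exists_pair_range_sup
    (K : Type*) [Field K] [IsAlgClosed K] [CharZero K]
    (L : Type*) [LieRing L] [LieAlgebra K L] [FiniteDimensional K L]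
    [LieAlgebra.IsKilling K L] :
    ∃ x y : L, ∀ w : L, ∃ u v : L, w = ⁅x, u⁆ + ⁅y, v⁆ := by
  obtain ⟨x, y, hxy⟩ := exists_pair_trivial_centralizer K L
  refine ⟨x, y, ?_⟩
  have hnd := LieAlgebra.IsKilling.killingForm_nondegenerate K L
  have htop : LinearMap.range (LieAlgebra.ad K L x) ⊔ LinearMap.range (LieAlgebra.ad K L y) = ⊤ := by
    by_contra hne
    obtain ⟨f, hf0, hf⟩ := Submodule.exists_le_ker_of_lt_top _ (lt_top_iff_ne_top.mpr hne)
    obtain ⟨w, rfl⟩ : ∃ w, killingForm K L w = f := by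
      have hinj : Function.Injective (killingForm K L) := by
        rw [← LinearMap.ker_eq_bot]; simp
      exact ((LinearMap.injective_iff_surjective_of_finrank_eq_finrank
        (Subspace.dual_finrank_eq (K := K) (V := L)).symm).mp hinj) f
    apply hf0
    have key : ∀ a : L, LinearMap.range (LieAlgebra.ad K L a) ≤ LinearMap.ker (killingForm K L w) →
        ⁅w, a⁆ = 0 := by
      intro a ha
      refine hnd.1 _ fun z => ?_
      rw [LieModule.traceForm_apply_lie_apply]
      exact ha ⟨z, rfl⟩
    have h1 := key x (le_sup_left.trans hf)
    have h2 := key y (le_sup_right.trans hf)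
    rw [hxy w (by rw [← lie_skew, h1, neg_zero]) h2, map_zero]
  intro w
  have hw : w ∈ LinearMap.range (LieAlgebra.ad K L x) ⊔ LinearMap.range (LieAlgebra.ad K L y) :=
    htop ▸ Submodule.mem_top
  obtain ⟨_, ⟨u, rfl⟩, _, ⟨v, rfl⟩, h⟩ := Submodule.mem_sup.mp hw
  exact ⟨u, v, by simpa using h.symm⟩

/-- Theorem of Kunyavskii et al.: if `L` is a finite-dimensional simple Lie algebra over
an algebraically closed field `K` of characteristic zero and `A` is a commutative
associative unital `K`-algebra, then the bracket width of the current algebra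
`A ⊗[K] L` is at most `2`: every element of its derived subalgebra (the `K`-span of all
brackets) is a sum of two brackets. -/
theorem bracket_width_current_algebra_le_two
    (K : Type*) [Field K] [IsAlgClosed K] [CharZero K]
    (L : Type*) [LieRing L] [LieAlgebra K L] [FiniteDimensional K L]
    [LieAlgebra.IsSimple K L]
    (A : Type*) [CommRing A] [Algebra K A] :
    ∀ z ∈ Submodule.span K {x : A ⊗[K] L | ∃ u v : A ⊗[K] L, x = ⁅u, v⁆},
      ∃ u₁ v₁ u₂ v₂ : A ⊗[K] L, z = ⁅u₁, v₁⁆ + ⁅u₂, v₂⁆ := by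
  intro z hz
  clear hz
  obtain ⟨x, y, hxy⟩ := exists_pair_range_sup K L
  suffices h : ∃ v₁ v₂ : A ⊗[K] L, z = ⁅(1 : A) ⊗ₜ[K] x, v₁⁆ + ⁅(1 : A) ⊗ₜ[K] y, v₂⁆ by
    obtain ⟨v₁, v₂, h⟩ := h
    exact ⟨_, v₁, _, v₂, h⟩
  induction z using TensorProduct.induction_on with
  | zero => exact ⟨0, 0, by simp⟩
  | tmul a w =>
    obtain ⟨u, v, rfl⟩ := hxy w
    refine ⟨a ⊗ₜ u, a ⊗ₜ v, ?_⟩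
    simp [LieAlgebra.ExtendScalars.bracket_tmul, TensorProduct.tmul_add]
  | add z₁ z₂ h₁ h₂ =>
    obtain ⟨a, b, rfl⟩ := h₁
    obtain ⟨c, d, rfl⟩ := h₂
    exact ⟨a + c, b + d, by rw [lie_add, lie_add]; abel⟩
end

section
/- Let K be a field of characteristic ≠ 2 and let A be a finitely generated associative K-algebra which is nil, i.e., every element of A is nilpotent. Let f ∈ K⟨X⟩ be a nonzero multilinear element in n variables, i.e., f = Σ_{σ ∈ S_n} c_σ x_{σ(1)} ⋯ x_{σ(n)} with coefficients c_σ ∈ K not all zero. Then f is strongly elliptic on A: there exist finite subsets M₁,…,M_n of the (n−1)-fold cartesian power of A such that the K-linear span of f(A) = {f(a₁,…,a_n) | aᵢ ∈ A} equals the (finite) sum, over i ∈ {1,…,n} and tuples (a₁,…,a_{i−1},a_{i+1},…,a_n) ∈ Mᵢ, of the additive subgroups f(a₁,…,a_{i−1},A,a_{i+1},…,a_n) = {f(a₁,…,a_{i−1},g,a_{i+1},…,a_n) | g ∈ A}. -/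
/-- `npowSucc a k` is the `(k+1)`-st power `a * a * ⋯ * a` of `a` (defined without
assuming a unit). -/
def npowSucc {A : Type*} [Mul A] (a : A) : ℕ → A
  | 0 => a
  | k + 1 => npowSucc a k * a

/-- Evaluation of the multilinear (noncommutative) polynomial
`∑ σ ∈ S_{n+1}, c σ • X_{σ(1)} ⋯ X_{σ(n+1)}` at the tuple `a`, in a possibly nonunital
algebra. -/
noncomputable def mlinEvalNU {K : Type*} [CommSemiring K] {A : Type*} [NonUnitalRing A]
    [Module K A] {n : ℕ} (c : Equiv.Perm (Fin (n + 1)) → K) (a : Fin (n + 1) → A) : A :=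
  ∑ σ : Equiv.Perm (Fin (n + 1)),
    c σ • (List.ofFn fun i : Fin n => a (σ i.succ)).foldl (· * ·) (a (σ 0))

section Mono
set_option linter.unusedSectionVars false
variable {K : Type*} [Field K] {A : Type*} [NonUnitalRing A] [Module K A]
  [IsScalarTower K A A] [SMulCommClass K A A]

/-- product of a nonempty tuple -/
def mono {A : Type*} [Mul A] {n : ℕ} (a : Fin (n + 1) → A) : A :=
  (List.ofFn fun i : Fin n => a i.succ).foldl (· * ·) (a 0)

theorem mono_zero (a : Fin 1 → A) : mono a = a 0 := by simp [mono]

theorem mono_last {n : ℕ} (a : Fin (n + 2) → A) :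
    mono a = mono (Fin.init a) * a (Fin.last _) := by
  unfold mono
  rw [List.ofFn_succ', List.concat_eq_append, List.foldl_append]
  rfl

theorem foldl_mul_aux (l : List A) (x y : A) :
    l.foldl (· * ·) (x * y) = x * l.foldl (· * ·) y := by
  induction l generalizing y with
  | nil => rfl
  | cons z l ih => simp only [List.foldl_cons]; rw [mul_assoc, ih]

theorem mono_head {n : ℕ} (a : Fin (n + 2) → A) :
    mono a = a 0 * mono (Fin.tail a) := by
  unfold mono
  rw [List.ofFn_succ, List.foldl_cons, foldl_mul_aux]
  rfl

theorem mono_update_add {n : ℕ} (a : Fin (n + 1) → A) (i : Fin (n + 1)) (x y : A) :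
    mono (Function.update a i (x + y)) =
      mono (Function.update a i x) + mono (Function.update a i y) := by
  induction n with
  | zero =>
    obtain rfl : i = 0 := Subsingleton.elim (α := Fin 1) _ _
    simp [mono_zero]
  | succ n ih =>
    refine Fin.lastCases ?_ (fun j => ?_) i
    · simp [mono_last, mul_add]
    · simp [mono_last, ih, add_mul, Fin.init_update_castSucc,
        Function.update_of_ne (Fin.castSucc_ne_last j).symm]

theorem mono_update_smul {n : ℕ} (a : Fin (n + 1) → A) (i : Fin (n + 1)) (k : K) (x : A) :
    mono (Function.update a i (k • x)) = k • mono (Function.update a i x) := by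
  induction n with
  | zero =>
    obtain rfl : i = 0 := Subsingleton.elim (α := Fin 1) _ _
    simp [mono_zero]
  | succ n ih =>
    refine Fin.lastCases ?_ (fun j => ?_) i
    · simp [mono_last, mul_smul_comm]
    · simp [mono_last, ih, smul_mul_assoc, Fin.init_update_castSucc,
        Function.update_of_ne (Fin.castSucc_ne_last j).symm]

theorem mono_deriv {n : ℕ} (a : Fin (n + 1) → A) (y : A) :
    y * mono a - mono a * y =
      ∑ i, mono (Function.update a i (y * a i - a i * y)) := by
  induction n with
  | zero => simp [mono_zero]
  | succ n ih =>
    rw [Fin.sum_univ_castSucc]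
    have h1 : ∀ j : Fin (n + 1), mono (Function.update a j.castSucc
        (y * a j.castSucc - a j.castSucc * y)) =
        mono (Function.update (Fin.init a) j (y * Fin.init a j - Fin.init a j * y)) *
          a (Fin.last _) := by
      intro j
      rw [mono_last, Fin.init_update_castSucc,
        Function.update_of_ne (Fin.castSucc_ne_last j).symm]
      rfl
    simp only [h1]
    rw [← Finset.sum_mul, ← ih, mono_last, mono_last]
    simp only [Fin.init_update_last, Function.update_self]
    simp only [sub_mul, mul_sub, mul_assoc]
    abel

/-- the monomial as a multilinear map -/
def monoMap (K : Type*) [Field K] (A : Type*) [NonUnitalRing A] [Module K A]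
    [IsScalarTower K A A] [SMulCommClass K A A] (n : ℕ) :
    MultilinearMap K (fun _ : Fin (n + 1) => A) A where
  toFun := mono
  map_update_add' := by
    intro inst a i x y
    convert mono_update_add a i x y
  map_update_smul' := by
    intro inst a i k x
    convert mono_update_smul a i k x

/-- the polynomial as a multilinear map -/
noncomputable def mlinMap {n : ℕ} (c : Equiv.Perm (Fin (n + 1)) → K) :
    MultilinearMap K (fun _ : Fin (n + 1) => A) A :=
  ∑ σ : Equiv.Perm (Fin (n + 1)), c σ • (monoMap K A n).domDomCongr σ

theorem mlinMap_apply {n : ℕ} (c : Equiv.Perm (Fin (n + 1)) → K) (a : Fin (n + 1) → A) :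
    mlinMap c a = ∑ σ, c σ • mono (fun i => a (σ i)) := by
  simp [mlinMap, monoMap]

theorem mlinMap_eq {n : ℕ} (c : Equiv.Perm (Fin (n + 1)) → K) (a : Fin (n + 1) → A) :
    mlinMap c a = mlinEvalNU c a := by
  rw [mlinMap_apply]; rfl

theorem mlinMap_deriv {n : ℕ} (c : Equiv.Perm (Fin (n + 1)) → K) (a : Fin (n + 1) → A) (y : A) :
    y * mlinMap c a - mlinMap c a * y =
      ∑ i, mlinMap c (Function.update a i (y * a i - a i * y)) := by
  simp only [mlinMap_apply]
  rw [Finset.sum_comm, Finset.mul_sum, Finset.sum_mul, ← Finset.sum_sub_distrib]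
  refine Finset.sum_congr rfl fun σ _ => ?_
  rw [mul_smul_comm, smul_mul_assoc, ← smul_sub, mono_deriv, Finset.smul_sum]
  rw [← Equiv.sum_comp σ (fun i => c σ • mono fun i_1 =>
    Function.update a i (y * a i - a i * y) (σ i_1))]
  refine Finset.sum_congr rfl fun i _ => ?_
  congr 2
  funext j
  by_cases h : j = i
  · subst h; simp
  · rw [Function.update_of_ne h, Function.update_of_ne (fun h' => h (σ.injective h'))]

theorem mlinMap_ext_sum {n : ℕ} (d : Equiv.Perm (Fin (n + 1)) → K) (a : Fin (n + 2) → A) :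
    ∑ τ, d τ • mono (fun i => a (Equiv.Perm.decomposeFin.symm (0, τ) i)) =
      a 0 * mlinMap d (Fin.tail a) := by
  rw [mlinMap_apply, Finset.mul_sum]
  refine Finset.sum_congr rfl fun τ _ => ?_
  rw [mono_head, mul_smul_comm]
  have h1 : Fin.tail (fun i => a (Equiv.Perm.decomposeFin.symm (0, τ) i)) =
      fun i => Fin.tail a (τ i) := by
    funext i
    simp [Fin.tail]
  rw [h1]
  simp

/-- two-sided ideal -/
def IsId (P : Submodule K A) : Prop := ∀ p ∈ P, ∀ x, x * p ∈ P ∧ p * x ∈ P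

theorem npowSucc_mul_aux (b : A) (m k : ℕ) :
    npowSucc b m * npowSucc b k = npowSucc b (m + k + 1) := by
  induction k with
  | zero => rfl
  | succ k ih =>
    change npowSucc b m * (npowSucc b k * b) = npowSucc b (m + k + 1) * b
    rw [← ih, mul_assoc]

theorem exists_sq (hnil : ∀ a : A, ∃ m : ℕ, npowSucc a m = 0) (C : Set A)
    (hC : ∀ x ∈ C, ∀ y ∈ C, x * y ∈ C) (P : Submodule K A)
    (hP : ∀ p ∈ P, ∀ x ∈ C, p * x ∈ P) (b : A) (hb : b ∈ C) (hbP : b ∉ P) :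
    ∃ m, npowSucc b m ∈ C ∧ npowSucc b m ∉ P ∧ npowSucc b m * npowSucc b m ∈ P := by
  classical
  have hmem : ∀ m, npowSucc b m ∈ C := by
    intro m
    induction m with
    | zero => exact hb
    | succ m ih => exact hC _ ih _ hb
  have hex : ∃ m, npowSucc b m ∈ P := by
    obtain ⟨m, hm⟩ := hnil b
    exact ⟨m, hm ▸ P.zero_mem⟩
  obtain ⟨m, hm⟩ : ∃ m, Nat.find hex = m + 1 := by
    refine Nat.exists_eq_succ_of_ne_zero fun h => hbP ?_
    have := Nat.find_spec hex
    rw [h] at this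
    exact this
  refine ⟨m, hmem m, Nat.find_min hex (by omega), ?_⟩
  have h1 : npowSucc b (m + 1) ∈ P := hm ▸ Nat.find_spec hex
  have h2 : ∀ j, npowSucc b (m + 1 + j) ∈ P := by
    intro j
    induction j with
    | zero => exact h1
    | succ j ih => exact hP _ ih _ hb
  rw [npowSucc_mul_aux]
  have := h2 m
  convert this using 2
  omega

theorem mono_mem_C (C : Set A) (hC : ∀ x ∈ C, ∀ y ∈ C, x * y ∈ C) {n : ℕ}
    (b : Fin (n + 1) → A) (hb : ∀ i, b i ∈ C) : mono b ∈ C := by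
  induction n with
  | zero => rw [mono_zero]; exact hb 0
  | succ n ih => rw [mono_head]; exact hC _ (hb 0) _ (ih _ fun i => hb _)

theorem mono_mem_of_pair (C : Set A) (P : Submodule K A)
    (hP : ∀ p ∈ P, ∀ x ∈ C, x * p ∈ P ∧ p * x ∈ P) {n : ℕ}
    (hC : ∀ x ∈ C, ∀ y ∈ C, x * y ∈ C)
    (b : Fin (n + 2) → A) (hb : ∀ i, b i ∈ C) (j : Fin (n + 1))
    (h : b j.castSucc * b j.succ ∈ P) : mono b ∈ P := by
  induction n with
  | zero =>
    obtain rfl : j = 0 := Subsingleton.elim (α := Fin 1) _ _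
    rw [mono_head, mono_zero]; exact h
  | succ n ih =>
    rw [mono_head]
    refine Fin.cases (fun h => ?_) (fun j h => ?_) j h
    · rw [mono_head, ← mul_assoc]
      exact (hP _ h _ (mono_mem_C C hC _ fun i => hb _)).2
    · exact (hP _ (ih (Fin.tail b) (fun i => hb _) j h) _ (hb 0)).1

theorem pi_aux (hnil : ∀ a : A, ∃ m : ℕ, npowSucc a m = 0) (n : ℕ) :
    ∀ (c : Equiv.Perm (Fin (n + 1)) → K) (_ : c ≠ 0) (C : Set A)
    (_ : ∀ x ∈ C, ∀ y ∈ C, x * y ∈ C) (P : Submodule K A)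
    (_ : ∀ p ∈ P, ∀ x ∈ C, x * p ∈ P ∧ p * x ∈ P)
    (_ : ∀ b ∈ C, (∀ x ∈ C, b * x * b ∈ P) → b ∈ P)
    (_ : ∀ a : Fin (n + 1) → A, (∀ i, a i ∈ C) → mlinMap c a ∈ P), ∀ x ∈ C, x ∈ P := by
  induction n with
  | zero =>
    intro c hc C hC P hP hs hf x hx
    have h := hf (fun _ => x) (fun _ => hx)
    have : Unique (Equiv.Perm (Fin (0 + 1))) := inferInstanceAs (Unique (Equiv.Perm (Fin 1)))
    rw [mlinMap_apply, Fintype.sum_unique] at h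
    simp only [mono_zero] at h
    have hc' : c (this.default) ≠ 0 := by
      intro h0
      apply hc
      funext σ
      rw [Subsingleton.elim σ this.default, h0]; rfl
    exact (P.smul_mem_iff hc').1 h
  | succ n ih =>
    intro c hc C hC P hP hs hf x hx
    by_contra hxP
    obtain ⟨m, haC, haP, ha2⟩ := exists_sq hnil C hC P (fun p hp x hx => (hP p hp x hx).2) x hx hxP
    generalize npowSucc x m = a at haC haP ha2
    -- normalise
    obtain ⟨σ₀, hσ₀⟩ : ∃ σ, c σ ≠ 0 := by
      by_contra! h; exact hc (funext h)
    let c' : Equiv.Perm (Fin (n + 2)) → K := fun σ => c (σ₀ * σ)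
    have hf' : ∀ b : Fin (n + 2) → A, (∀ i, b i ∈ C) → mlinMap c' b ∈ P := by
      intro b hb
      have := hf (fun i => b (σ₀⁻¹ i)) (fun i => hb _)
      rw [mlinMap_apply] at this ⊢
      rw [← Equiv.sum_comp (Equiv.mulLeft σ₀)] at this
      simpa [c'] using this
    let d : Equiv.Perm (Fin (n + 1)) → K := fun τ => c' (Equiv.Perm.decomposeFin.symm (0, τ))
    have hd : d ≠ 0 := by
      intro h
      have := congrFun h 1
      have h1 : Equiv.Perm.decomposeFin.symm ((0 : Fin (n + 2)), (1 : Equiv.Perm (Fin (n + 1)))) = 1 := by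
        ext i
        refine Fin.cases ?_ (fun i => ?_) i <;> simp
      simp only [d, c', h1, mul_one] at this
      exact hσ₀ this
    let P' : Submodule K A := P.comap (LinearMap.mulLeft K a)
    have key := ih d hd {z | ∃ r ∈ C, z = r * a} ?_ P' ?_ ?_ ?_
    · refine haP (hs a haC fun r hr => ?_)
      have := key (r * a) ⟨r, hr, rfl⟩
      simpa [P', mul_assoc] using this
    · rintro _ ⟨r, hr, rfl⟩ _ ⟨s, hs, rfl⟩
      exact ⟨r * a * s, hC _ (hC _ hr _ haC) _ hs, by simp [mul_assoc]⟩
    · rintro p hp _ ⟨r, hr, rfl⟩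
      have hp' : a * p ∈ P := hp
      refine ⟨?_, ?_⟩
      · change a * (r * a * p) ∈ P
        rw [mul_assoc r, ← mul_assoc]
        exact (hP _ hp' _ (hC _ haC _ hr)).1
      · change a * (p * (r * a)) ∈ P
        rw [← mul_assoc]
        exact (hP _ hp' _ (hC _ hr _ haC)).2
    · rintro _ ⟨r, hr, rfl⟩ h
      change a * (r * a) ∈ P
      refine hs _ (hC _ haC _ (hC _ hr _ haC)) fun y hy => ?_
      have : a * (r * a * (y * a) * (r * a)) ∈ P := h _ ⟨y, hy, rfl⟩
      simpa [mul_assoc] using this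
    · intro b hb
      change a * mlinMap d b ∈ P
      have hbC : ∀ i, (Fin.cons a b : Fin (n + 2) → A) i ∈ C := by
        intro i
        refine Fin.cases ?_ (fun i => ?_) i
        · exact haC
        · obtain ⟨r, hr, h⟩ := hb i
          simp only [Fin.cons_succ, h]
          exact hC _ hr _ haC
      have h := hf' (Fin.cons a b) hbC
      have h2 := mlinMap_ext_sum d (Fin.cons a b : Fin (n + 2) → A)
      simp only [Fin.cons_zero, Fin.tail_cons] at h2
      rw [← h2]
      rw [mlinMap_apply, ← Equiv.sum_comp Equiv.Perm.decomposeFin.symm,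
        Fintype.sum_prod_type, Fin.sum_univ_succ] at h
      refine (Submodule.add_mem_iff_left _ ?_).1 h
      refine Submodule.sum_mem _ fun p _ => Submodule.sum_mem _ fun τ _ => ?_
      refine Submodule.smul_mem _ _ ?_
      set σ := Equiv.Perm.decomposeFin.symm (p.succ, τ) with hσ
      have hσ0 : σ 0 = p.succ := by simp [hσ]
      have hne : σ.symm 0 ≠ 0 := by
        intro h
        have : σ 0 = 0 := (σ.symm_apply_eq.1 h).symm
        rw [hσ0] at this
        exact Fin.succ_ne_zero _ this
      obtain ⟨j, hj⟩ := Fin.exists_succ_eq.2 hne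
      have hj' : σ j.succ = 0 := by rw [hj, Equiv.apply_symm_apply]
      refine mono_mem_of_pair C P hP hC _ (fun i => hbC _) j ?_
      simp only [hj', Fin.cons_zero]
      have hne2 : σ j.castSucc ≠ 0 := by
        rw [← hj']
        exact fun h => (Fin.castSucc_lt_succ (i := j)).ne (σ.injective h)
      obtain ⟨i, hi⟩ := Fin.exists_succ_eq.2 hne2
      rw [← hi, Fin.cons_succ]
      obtain ⟨r, hr, h⟩ := hb i
      rw [h, mul_assoc]
      exact (hP _ ha2 _ hr).1
end Mono
section Pw
set_option linter.unusedSectionVars false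
variable {K : Type*} [Field K] {A : Type*} [NonUnitalRing A] [Module K A]
  [IsScalarTower K A A] [SMulCommClass K A A]

theorem adjoin_ind {S : Finset A} (hS : NonUnitalAlgebra.adjoin K (S : Set A) = ⊤)
    (Q : Submodule K A) (h1 : ∀ s ∈ S, s ∈ Q) (h2 : ∀ x ∈ Q, ∀ y ∈ Q, x * y ∈ Q) (x : A) :
    x ∈ Q := by
  have hx : x ∈ NonUnitalAlgebra.adjoin K (S : Set A) := by rw [hS]; trivial
  induction hx using NonUnitalAlgebra.adjoin_induction with
  | mem x hx => exact h1 x hx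
  | add x y _ _ hx hy => exact Q.add_mem hx hy
  | zero => exact Q.zero_mem
  | mul x y _ _ hx hy => exact h2 x hx y hy
  | smul r x _ hx => exact Q.smul_mem r hx

/-- `pw k` is the `(k+1)`-st power of the algebra. -/
def pw (K : Type*) [Field K] (A : Type*) [NonUnitalRing A] [Module K A] : ℕ → Submodule K A
  | 0 => ⊤
  | k + 1 => Submodule.span K {z | ∃ x ∈ pw K A k, ∃ y, z = x * y}

theorem mul_mem_pw {k : ℕ} {x : A} (hx : x ∈ pw K A k) (y : A) : x * y ∈ pw K A (k + 1) :=
  Submodule.subset_span ⟨x, hx, y, rfl⟩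

theorem pw_succ_le_iff {k : ℕ} {Q : Submodule K A} :
    pw K A (k + 1) ≤ Q ↔ ∀ x ∈ pw K A k, ∀ y, x * y ∈ Q := by
  constructor
  · intro h x hx y
    exact h (mul_mem_pw hx y)
  · intro h
    refine Submodule.span_le.2 ?_
    rintro _ ⟨x, hx, y, rfl⟩
    exact h x hx y

theorem pw_succ_le (k : ℕ) : pw K A (k + 1) ≤ pw K A k := by
  induction k with
  | zero => exact le_top
  | succ k ih =>
    rw [pw_succ_le_iff]
    intro x hx y
    exact mul_mem_pw (ih hx) y

theorem pw_isId (k : ℕ) : IsId (pw K A k) := by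
  induction k with
  | zero => intro p _ x; exact ⟨trivial, trivial⟩
  | succ k ih =>
    intro p hp x
    refine ⟨?_, mul_mem_pw (pw_succ_le k hp) x⟩
    have : pw K A (k + 1) ≤ (pw K A (k + 1)).comap (LinearMap.mulLeft K x) := by
      rw [pw_succ_le_iff]
      intro z hz y
      change x * (z * y) ∈ pw K A (k + 1)
      rw [← mul_assoc]
      exact mul_mem_pw (ih z hz x).1 y
    exact this hp

theorem pw_add_le (k l : ℕ) (Q : Submodule K A)
    (h : ∀ x ∈ pw K A k, ∀ y ∈ pw K A l, x * y ∈ Q) : pw K A (k + l + 1) ≤ Q := by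
  induction l generalizing Q with
  | zero => rw [pw_succ_le_iff]; exact fun x hx y => h x hx y trivial
  | succ l ih =>
    rw [pw_succ_le_iff]
    intro z hz w
    have := ih (Q.comap (LinearMap.mulRight K w)) (fun x hx y hy => by
      change x * y * w ∈ Q
      rw [mul_assoc]
      exact h x hx _ (mul_mem_pw hy w))
    exact this hz

theorem pw_fg {S : Finset A} (hS : NonUnitalAlgebra.adjoin K (S : Set A) = ⊤) (k : ℕ) :
    ∃ F : Finset A, (∀ p ∈ F, p ∈ pw K A k) ∧
      ∀ Q : Submodule K A, (∀ p ∈ F, p ∈ Q) → (∀ p ∈ F, ∀ x, p * x ∈ Q) → pw K A k ≤ Q := by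
  classical
  have h0 : ∀ Q : Submodule K A, (∀ p ∈ S, p ∈ Q) → (∀ p ∈ S, ∀ x, p * x ∈ Q) → ∀ x, x ∈ Q := by
    intro Q h1 h2 x
    let Q' : Submodule K A :=
      { carrier := {x | x ∈ Q ∧ ∀ y, x * y ∈ Q}
        add_mem' := fun {a b} ha hb => ⟨Q.add_mem ha.1 hb.1, fun y => by
          rw [add_mul]; exact Q.add_mem (ha.2 y) (hb.2 y)⟩
        zero_mem' := ⟨Q.zero_mem, fun y => by rw [zero_mul]; exact Q.zero_mem⟩
        smul_mem' := fun c a ha => ⟨Q.smul_mem c ha.1, fun y => by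
          rw [smul_mul_assoc]; exact Q.smul_mem c (ha.2 y)⟩ }
    have : x ∈ Q' := adjoin_ind hS Q' (fun s hs => ⟨h1 s hs, h2 s hs⟩)
      (fun a ha b hb => ⟨ha.2 b, fun y => by rw [mul_assoc]; exact ha.2 _⟩) x
    exact this.1
  induction k with
  | zero => exact ⟨S, fun _ _ => trivial, fun Q h1 h2 x _ => h0 Q h1 h2 x⟩
  | succ k ih =>
    obtain ⟨F, hF, hQ⟩ := ih
    refine ⟨(F ×ˢ S).image (fun p => p.1 * p.2), ?_, ?_⟩
    · intro p hp
      simp only [Finset.mem_image, Finset.mem_product] at hp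
      obtain ⟨⟨a, b⟩, ⟨ha, hb⟩, rfl⟩ := hp
      exact mul_mem_pw (hF a ha) b
    · intro Q h1 h2
      have h1' : ∀ a ∈ F, ∀ s ∈ S, a * s ∈ Q := fun a ha s hs =>
        h1 _ (Finset.mem_image.2 ⟨(a, s), Finset.mem_product.2 ⟨ha, hs⟩, rfl⟩)
      have h2' : ∀ a ∈ F, ∀ s ∈ S, ∀ x, a * s * x ∈ Q := fun a ha s hs =>
        h2 _ (Finset.mem_image.2 ⟨(a, s), Finset.mem_product.2 ⟨ha, hs⟩, rfl⟩)
      have h3 : ∀ a ∈ F, ∀ x, a * x ∈ Q := fun a ha x =>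
        h0 (Q.comap (LinearMap.mulLeft K a)) (fun s hs => h1' a ha s hs)
          (fun s hs x => by
            change a * (s * x) ∈ Q
            rw [← mul_assoc]; exact h2' a ha s hs x) x
      rw [pw_succ_le_iff]
      intro x hx y
      exact hQ (Q.comap (LinearMap.mulRight K y)) (fun p hp => h3 p hp y)
        (fun p hp x => by
          change p * x * y ∈ Q
          rw [mul_assoc]; exact h3 p hp _) hx

theorem exists_pw_le (hfg : ∃ S : Finset A, NonUnitalAlgebra.adjoin K (S : Set A) = ⊤)
    (I : Submodule K A) (hI : IsId I)
    (h : ∀ P : Submodule K A, IsId P → I ≤ P →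
      (∀ b, (∀ x, b * x * b ∈ P) → b ∈ P) → ∀ x, x ∈ P) : ∃ k, pw K A k ≤ I := by
  obtain ⟨S, hS⟩ := hfg
  by_contra! hcon
  let Z : Set (Submodule K A) := {P | IsId P ∧ ∀ k, ¬ pw K A k ≤ P}
  obtain ⟨P, hIP, hPmax⟩ := zorn_le_nonempty₀ Z (by
    intro ch hch hchain y hy
    have hdir : DirectedOn (· ≤ ·) ch := hchain.directedOn
    refine ⟨sSup ch, ⟨?_, ?_⟩, fun z hz => le_sSup hz⟩
    · intro p hp x
      obtain ⟨P, hP, hpP⟩ := (Submodule.mem_sSup_of_directed ⟨y, hy⟩ hdir).1 hp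
      have := (hch hP).1 p hpP x
      exact ⟨le_sSup hP this.1, le_sSup hP this.2⟩
    · intro k hk
      obtain ⟨F, hF, hQ⟩ := pw_fg hS k
      have : ∀ F' : Finset A, (∀ p ∈ F', p ∈ sSup ch) → ∃ P ∈ ch, ∀ p ∈ F', p ∈ P := by
        intro F'
        classical
        induction F' using Finset.induction_on with
        | empty => exact fun _ => ⟨y, hy, by simp⟩
        | insert a F' _ ih =>
          intro hF'
          obtain ⟨P1, hP1, h1⟩ := ih fun p hp => hF' p (Finset.mem_insert_of_mem hp)
          obtain ⟨P2, hP2, h2⟩ := (Submodule.mem_sSup_of_directed ⟨y, hy⟩ hdir).1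
            (hF' a (Finset.mem_insert_self _ _))
          obtain ⟨P3, hP3, h31, h32⟩ := hdir P1 hP1 P2 hP2
          refine ⟨P3, hP3, fun p hp => ?_⟩
          rcases Finset.mem_insert.1 hp with rfl | hp
          · exact h32 h2
          · exact h31 (h1 p hp)
      obtain ⟨P, hP, hFP⟩ := this F fun p hp => hk (hF p hp)
      exact (hch hP).2 k (hQ P hFP fun p hp x => ((hch hP).1 p (hFP p hp) x).2)) I ⟨hI, hcon⟩
  obtain ⟨⟨hPid, hPk⟩, hmax⟩ := hPmax
  -- triple products
  have L3 : ∀ J : Submodule K A, IsId J → P ≤ J →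
      (∀ x ∈ J, ∀ y ∈ J, ∀ z ∈ J, x * y * z ∈ P) → J ≤ P := by
    intro J hJ hPJ h3
    by_contra hJP
    have : ∃ k, pw K A k ≤ J := by
      by_contra! hk
      exact hJP (hmax ⟨hJ, hk⟩ hPJ)
    obtain ⟨k, hk⟩ := this
    refine hPk (k + k + 1 + k + 1) (pw_add_le _ _ _ fun x hx y hy => ?_)
    have : pw K A (k + k + 1) ≤ P.comap (LinearMap.mulRight K y) :=
      pw_add_le _ _ _ fun x1 hx1 x2 hx2 => h3 _ (hk hx1) _ (hk hx2) _ (hk hy)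
    exact this hx
  refine hPk 0 fun x _ => h P hPid hIP (fun b hb => ?_) x
  -- first: `A b A ⊆ P`
  have hAbA : ∀ x y, x * b * y ∈ P := by
    let J : Submodule K A := P ⊔ Submodule.span K {z | ∃ x y, z = x * b * y}
    have hJle : ∀ Q : Submodule K A, P ≤ Q → (∀ x y, x * b * y ∈ Q) → J ≤ Q := by
      intro Q h1 h2
      refine sup_le h1 (Submodule.span_le.2 ?_)
      rintro _ ⟨x, y, rfl⟩
      exact h2 x y
    have hmem : ∀ x y, x * b * y ∈ J := fun x y =>
      Submodule.mem_sup_right (Submodule.subset_span ⟨x, y, rfl⟩)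
    have hJid : IsId J := by
      intro p hp w
      constructor
      · refine hJle (J.comap (LinearMap.mulLeft K w)) (fun q hq => ?_) (fun x y => ?_) hp
        · exact Submodule.mem_sup_left (hPid q hq w).1
        · change w * (x * b * y) ∈ J
          have := hmem (w * x) y
          simpa [mul_assoc] using this
      · refine hJle (J.comap (LinearMap.mulRight K w)) (fun q hq => ?_) (fun x y => ?_) hp
        · exact Submodule.mem_sup_left (hPid q hq w).2
        · change (x * b * y) * w ∈ J
          have := hmem x (y * w)
          simpa [mul_assoc] using this
    have hJ2 : ∀ p ∈ J, ∀ q ∈ J, p * q ∈ P := by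
      intro p hp q hq
      refine hJle (P.comap (LinearMap.mulRight K q)) (fun r hr => (hPid r hr q).2)
        (fun x y => ?_) hp
      change x * b * y * q ∈ P
      refine hJle (P.comap (LinearMap.mulLeft K (x * b * y))) (fun r hr => (hPid r hr _).1)
        (fun x' y' => ?_) hq
      change x * b * y * (x' * b * y') ∈ P
      have := (hPid _ (hPid _ (hb (y * x')) x).1 y').2
      simpa [mul_assoc] using this
    have := L3 J hJid le_sup_left (fun x hx y hy z hz => (hPid _ (hJ2 x hx y hy) z).2)
    exact fun x y => this (hmem x y)
  let J : Submodule K A :=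
    { carrier := {b | ∀ x y, x * b * y ∈ P}
      add_mem' := fun {a b} ha hb x y => by
        rw [mul_add, add_mul]; exact P.add_mem (ha x y) (hb x y)
      zero_mem' := fun x y => by simp
      smul_mem' := fun c a ha x y => by
        rw [mul_smul_comm, smul_mul_assoc]; exact P.smul_mem c (ha x y) }
  refine L3 J ?_ ?_ (fun x _ y hy z _ => hy x z) (show b ∈ J from hAbA)
  · intro p hp w
    constructor
    · intro x y
      have := hp (x * w) y
      simpa [mul_assoc] using this
    · intro x y
      have := hp x (w * y)
      simpa [mul_assoc] using this
  · intro p hp x y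
    exact (hPid _ (hPid p hp x).1 y).2

/-- commutator map -/
def adm (K : Type*) [Field K] {A : Type*} [NonUnitalRing A] [Module K A]
    [IsScalarTower K A A] [SMulCommClass K A A] (y : A) : A →ₗ[K] A :=
  LinearMap.mulLeft K y - LinearMap.mulRight K y

theorem adm_apply (y x : A) : adm K y x = y * x - x * y := rfl

theorem comm_pi (hchar : (2 : K) ≠ 0) (hnil : ∀ a : A, ∃ m : ℕ, npowSucc a m = 0)
    {n : ℕ} (c : Equiv.Perm (Fin (n + 1)) → K) (hc : c ≠ 0) (P : Submodule K A)
    (hP : IsId P) (hs : ∀ b, (∀ x, b * x * b ∈ P) → b ∈ P)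
    (hcomm : ∀ a b : Fin (n + 1) → A,
      mlinMap c a * mlinMap c b - mlinMap c b * mlinMap c a ∈ P) : ∀ x, x ∈ P := by
  have hU : ∀ a : Fin (n + 1) → A, mlinMap c a ∈ P := by
    intro a
    set u := mlinMap c a with hu
    have hdd : ∀ x, adm K u (adm K u x) ∈ P := by
      intro x
      have : adm K u x = - ∑ i, mlinMap c (Function.update a i (x * a i - a i * x)) := by
        rw [← mlinMap_deriv, adm_apply]; abel
      rw [this, map_neg, map_sum]
      refine P.neg_mem (P.sum_mem fun i _ => hcomm _ _)
    have hd2 : ∀ x y, adm K u x * adm K u y ∈ P := by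
      intro x y
      have h1 : (2 : K) • (adm K u x * adm K u y) = adm K u (adm K u (x * y)) -
          adm K u (adm K u x) * y - x * adm K u (adm K u y) := by
        rw [two_smul]
        simp only [adm_apply]
        noncomm_ring
      rw [← P.smul_mem_iff hchar, h1]
      exact P.sub_mem (P.sub_mem (hdd _) (hP _ (hdd x) y).2) (hP _ (hdd y) x).1
    have hd : ∀ x, adm K u x ∈ P := by
      intro x
      refine hs _ fun y => ?_
      have h1 : adm K u x * y * adm K u x = adm K u x * adm K u (y * x) -
          adm K u x * adm K u y * x := by
        simp only [adm_apply]
        noncomm_ring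
      rw [h1]
      exact P.sub_mem (hd2 _ _) (hP _ (hd2 x y) x).2
    by_contra huP
    obtain ⟨m, -, hm, hm2⟩ := exists_sq hnil Set.univ (fun _ _ _ _ => trivial) P
      (fun p hp x _ => (hP p hp x).2) u trivial huP
    have hcen : ∀ j x, npowSucc u j * x - x * npowSucc u j ∈ P := by
      intro j x
      induction j with
      | zero => exact hd x
      | succ j ih =>
        change npowSucc u j * u * x - x * (npowSucc u j * u) ∈ P
        have : npowSucc u j * u * x - x * (npowSucc u j * u) =
          npowSucc u j * adm K u x + (npowSucc u j * x - x * npowSucc u j) * u := by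
          simp only [adm_apply]
          noncomm_ring
        rw [this]
        exact P.add_mem (hP _ (hd x) _).1 (hP _ ih u).2
    refine hm (hs _ fun x => ?_)
    generalize ha : npowSucc u m = a at *
    have h1 : a * x * a = a * a * x - a * (a * x - x * a) := by noncomm_ring
    rw [h1]
    refine P.sub_mem (hP _ hm2 x).2 (hP _ ?_ a).1
    rw [← ha]; exact hcen m x
  exact fun x => pi_aux hnil n c hc Set.univ (fun _ _ _ _ => trivial) P
    (fun p hp x _ => hP p hp x) (fun b _ h => hs b fun x => h x trivial) (fun a _ => hU a) x trivial
end Pw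
section Good
set_option linter.unusedSectionVars false
variable {K : Type*} [Field K] {A : Type*} [NonUnitalRing A] [Module K A]
  [IsScalarTower K A A] [SMulCommClass K A A]

/-- one slot of the image -/
noncomputable def slot {n : ℕ} (c : Equiv.Perm (Fin (n + 1)) → K)
    (p : Fin (n + 1) × (Fin (n + 1) → A)) : Submodule K A :=
  LinearMap.range ((mlinMap c).toLinearMap p.2 p.1)

theorem mem_slot {n : ℕ} (c : Equiv.Perm (Fin (n + 1)) → K) (i : Fin (n + 1))
    (b : Fin (n + 1) → A) (x : A) : mlinMap c (Function.update b i x) ∈ slot c (i, b) :=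
  ⟨x, rfl⟩

/-- contained in a finite sum of slots -/
def Good {n : ℕ} (c : Equiv.Perm (Fin (n + 1)) → K) (X : Submodule K A) : Prop :=
  ∃ s : Finset (Fin (n + 1) × (Fin (n + 1) → A)), X ≤ s.sup (slot c)

variable {n : ℕ} {c : Equiv.Perm (Fin (n + 1)) → K}

theorem Good.mono {X Y : Submodule K A} (hY : Good c Y) (h : X ≤ Y) : Good c X := by
  obtain ⟨s, hs⟩ := hY
  exact ⟨s, h.trans hs⟩

theorem good_bot : Good c (⊥ : Submodule K A) := ⟨∅, bot_le⟩

theorem Good.sup {X Y : Submodule K A} (hX : Good c X) (hY : Good c Y) : Good c (X ⊔ Y) := by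
  classical
  obtain ⟨s, hs⟩ := hX
  obtain ⟨t, ht⟩ := hY
  exact ⟨s ∪ t, by rw [Finset.sup_union]; exact sup_le_sup hs ht⟩

theorem good_finset_sup {ι : Type*} (s : Finset ι) (f : ι → Submodule K A)
    (h : ∀ i ∈ s, Good c (f i)) : Good c (s.sup f) := by
  classical
  induction s using Finset.induction_on with
  | empty => exact good_bot
  | insert a s _ ih =>
    rw [Finset.sup_insert]
    exact (h a (Finset.mem_insert_self _ _)).sup
      (ih fun i hi => h i (Finset.mem_insert_of_mem hi))

theorem good_slot (p : Fin (n + 1) × (Fin (n + 1) → A)) : Good c (slot c p) :=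
  ⟨{p}, by simp⟩

theorem Good.ad {X : Submodule K A} (hX : Good c X) (y : A) : Good c (X.map (adm K y)) := by
  classical
  obtain ⟨s, hs⟩ := hX
  refine Good.mono ?_ (Submodule.map_mono hs)
  have h1 : (s.sup (slot c)).map (adm K y) = s.sup (fun p => (slot c p).map (adm K y)) :=
    Finset.comp_sup_eq_sup_comp (Submodule.map (adm K y)) (fun a b => Submodule.map_sup _ _ _)
      (Submodule.map_bot _)
  rw [h1]
  refine good_finset_sup _ _ fun p _ => ?_
  obtain ⟨i, b⟩ := p
  refine Good.mono (Y := (Finset.univ : Finset (Fin (n + 1))).sup (fun j =>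
    slot c (i, Function.update b j (y * b j - b j * y))) ⊔ slot c (i, b))
    ((good_finset_sup _ _ fun j _ => good_slot _).sup (good_slot _)) ?_
  rw [Submodule.map_le_iff_le_comap]
  rintro _ ⟨z, rfl⟩
  rw [Submodule.mem_comap, MultilinearMap.toLinearMap_apply, adm_apply, mlinMap_deriv]
  refine Submodule.sum_mem _ fun j _ => ?_
  by_cases hj : j = i
  · subst hj
    refine Submodule.mem_sup_right ?_
    rw [Function.update_idem]
    exact mem_slot _ _ _ _
  · refine Submodule.mem_sup_left ?_
    rw [Function.update_of_ne hj, Function.update_comm (Ne.symm hj)]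
    exact (Finset.le_sup (f := fun j => slot c (i, Function.update b j (y * b j - b j * y)))
      (Finset.mem_univ j)) (mem_slot _ _ _ _)

theorem good_ad_value (a : Fin (n + 1) → A) :
    Good c (LinearMap.range (adm K (mlinMap c a))) := by
  refine Good.mono (good_finset_sup (Finset.univ : Finset (Fin (n + 1))) (fun j => slot c (j, a))
    fun j _ => good_slot _) ?_
  rintro _ ⟨x, rfl⟩
  have : adm K (mlinMap c a) x =
      - ∑ i, mlinMap c (Function.update a i (x * a i - a i * x)) := by
    rw [← mlinMap_deriv, adm_apply]; abel
  rw [this]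
  refine Submodule.neg_mem _ (Submodule.sum_mem _ fun i _ => ?_)
  exact (Finset.le_sup (f := fun j => slot c (j, a)) (Finset.mem_univ i)) (mem_slot _ _ _ _)

/-- the ideal of elements `p` with `[y, pA]` good for all `y` -/
def gId (c : Equiv.Perm (Fin (n + 1)) → K) : Submodule K A where
  carrier := {p | ∀ y, Good c ((LinearMap.range (LinearMap.mulLeft K p)).map (adm K y))}
  add_mem' := by
    intro p q hp hq y
    refine ((hp y).sup (hq y)).mono ?_
    rw [← Submodule.map_sup]
    refine Submodule.map_mono ?_
    rintro _ ⟨x, rfl⟩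
    simp only [LinearMap.mulLeft_apply, add_mul]
    exact Submodule.add_mem_sup ⟨x, rfl⟩ ⟨x, rfl⟩
  zero_mem' := by
    intro y
    refine good_bot.mono ?_
    rw [Submodule.map_le_iff_le_comap]
    rintro _ ⟨x, rfl⟩
    simp
  smul_mem' := by
    intro k p hp y
    refine (hp y).mono (Submodule.map_mono ?_)
    rintro _ ⟨x, rfl⟩
    simp only [LinearMap.mulLeft_apply, smul_mul_assoc]
    exact Submodule.smul_mem _ _ ⟨x, rfl⟩

theorem gId_isId : IsId (gId (A := A) c) := by
  intro p hp x
  constructor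
  · intro y
    refine Good.mono (((hp x).ad y).sup (hp y)) ?_
    rw [← Submodule.map_sup]
    refine Submodule.map_mono ?_
    rintro _ ⟨r, rfl⟩
    have : LinearMap.mulLeft K (x * p) r = adm K x (p * r) + p * (r * x) := by
      simp only [LinearMap.mulLeft_apply, adm_apply]
      noncomm_ring
    rw [this]
    exact Submodule.add_mem_sup (Submodule.mem_map_of_mem ⟨r, rfl⟩) ⟨r * x, rfl⟩
  · intro y
    refine (hp y).mono (Submodule.map_mono ?_)
    rintro _ ⟨r, rfl⟩
    exact ⟨x * r, by simp [mul_assoc]⟩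

theorem comm_mem_gId (a b : Fin (n + 1) → A) :
    mlinMap c a * mlinMap c b - mlinMap c b * mlinMap c a ∈ gId (A := A) c := by
  intro y
  generalize hu : mlinMap c a = u
  generalize hv : mlinMap c b = v
  have hXu : Good c (LinearMap.range (adm K u)) := hu ▸ good_ad_value a
  have hXv : Good c (LinearMap.range (adm K v)) := hv ▸ good_ad_value b
  refine Good.mono (((hXu.ad y).sup (hXu.ad (y * v))).sup hXv) ?_
  rw [Submodule.map_le_iff_le_comap]
  rintro _ ⟨r, rfl⟩
  rw [Submodule.mem_comap]
  have : adm K y (LinearMap.mulLeft K (u * v - v * u) r) =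
      adm K y (adm K u (v * r)) - adm K (y * v) (adm K u r) + adm K v (adm K u r * y) := by
    simp only [LinearMap.mulLeft_apply, adm_apply]
    noncomm_ring
  rw [this]
  refine Submodule.add_mem_sup (Submodule.sub_mem _ (Submodule.mem_sup_left ?_)
    (Submodule.mem_sup_right ?_)) ⟨_, rfl⟩
  · exact Submodule.mem_map_of_mem ⟨_, rfl⟩
  · exact Submodule.mem_map_of_mem ⟨_, rfl⟩

/-- Key step: `[A, A^M]` is good. -/
theorem exists_comm_good (hchar : (2 : K) ≠ 0)
    (hfg : ∃ S : Finset A, NonUnitalAlgebra.adjoin K (S : Set A) = ⊤)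
    (hnil : ∀ a : A, ∃ m : ℕ, npowSucc a m = 0) (hc : c ≠ 0) :
    ∃ (M : ℕ) (W : Submodule K A), Good c W ∧ ∀ x, ∀ z ∈ pw K A M, x * z - z * x ∈ W := by
  obtain ⟨k, hk⟩ := exists_pw_le hfg (gId (A := A) c) gId_isId (fun P hP hGP hs =>
    comm_pi hchar hnil c hc P hP hs fun a b => hGP (comm_mem_gId a b))
  obtain ⟨S, hS⟩ := hfg
  obtain ⟨F, hF, hQ⟩ := pw_fg hS k
  have hle : pw K A (k + 1) ≤ F.sup (fun p => LinearMap.range (LinearMap.mulLeft K p)) := by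
    rw [pw_succ_le_iff]
    intro x hx y
    have h1 : ∀ p ∈ F, ∀ z, p * z ∈ F.sup (fun p => LinearMap.range (LinearMap.mulLeft K p)) :=
      fun p hp z => (Finset.le_sup (f := fun p => LinearMap.range (LinearMap.mulLeft K p)) hp)
        ⟨z, rfl⟩
    exact hQ ((F.sup (fun p => LinearMap.range (LinearMap.mulLeft K p))).comap
      (LinearMap.mulRight K y)) (fun p hp => h1 p hp y) (fun p hp x => by
        rw [Submodule.mem_comap, LinearMap.mulRight_apply, mul_assoc]
        exact h1 p hp _) hx
  have hgood : ∀ y, Good c ((pw K A (k + 1)).map (adm K y)) := by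
    intro y
    refine Good.mono ?_ (Submodule.map_mono hle)
    have h1 : (F.sup (fun p => LinearMap.range (LinearMap.mulLeft K p))).map (adm K y) =
        F.sup (fun p => (LinearMap.range (LinearMap.mulLeft K p)).map (adm K y)) :=
      Finset.comp_sup_eq_sup_comp (Submodule.map (adm K y)) (fun a b => Submodule.map_sup _ _ _)
        (Submodule.map_bot _)
    rw [h1]
    exact good_finset_sup _ _ fun p hp => hk (hF p hp) y
  refine ⟨k + 1, S.sup (fun s => (pw K A (k + 1)).map (adm K s)),
    good_finset_sup _ _ fun s _ => hgood s, ?_⟩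
  set W := S.sup (fun s => (pw K A (k + 1)).map (adm K s)) with hW
  let Q : Submodule K A :=
    { carrier := {x | ∀ z ∈ pw K A (k + 1), x * z - z * x ∈ W}
      add_mem' := fun {a b} ha hb z hz => by
        have : (a + b) * z - z * (a + b) = (a * z - z * a) + (b * z - z * b) := by noncomm_ring
        rw [this]; exact W.add_mem (ha z hz) (hb z hz)
      zero_mem' := fun z _ => by simp
      smul_mem' := fun r a ha z hz => by
        rw [smul_mul_assoc, mul_smul_comm, ← smul_sub]
        exact W.smul_mem r (ha z hz) }
  intro x
  refine adjoin_ind hS Q ?_ ?_ x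
  · intro s hs z hz
    exact (Finset.le_sup (f := fun s => (pw K A (k + 1)).map (adm K s)) hs)
      (Submodule.mem_map_of_mem hz)
  · intro a ha b hb z hz
    have : a * b * z - z * (a * b) = (a * (b * z) - b * z * a) + (b * (z * a) - z * a * b) := by
      noncomm_ring
    rw [this]
    exact W.add_mem (ha _ (pw_isId _ z hz b).1) (hb _ (pw_isId _ z hz a).2)

theorem mono_mem_pw {M n : ℕ} (b : Fin (n + 1) → A) (i : Fin (n + 1)) (h : b i ∈ pw K A M) :
    mono b ∈ pw K A M := by
  induction n with
  | zero =>
    obtain rfl : i = 0 := Subsingleton.elim (α := Fin 1) _ _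
    rw [mono_zero]; exact h
  | succ n ih =>
    rw [mono_head]
    refine Fin.cases (fun h => ?_) (fun j h => ?_) i h
    · exact (pw_isId M _ h _).2
    · exact (pw_isId M _ (ih (Fin.tail b) j h) _).1

theorem mono_rotate {M n : ℕ} (W : Submodule K A)
    (hW : ∀ x, ∀ z ∈ pw K A M, x * z - z * x ∈ W) (b : Fin (n + 2) → A)
    (h : ∃ i, b i ∈ pw K A M) :
    mono b - mono (fun i => b (finRotate _ i)) ∈ W := by
  have h2 : mono (fun i => b (finRotate _ i)) = mono (Fin.tail b) * b 0 := by
    rw [mono_last]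
    congr 1
    · congr 1
      funext i
      simp [Fin.init, Fin.tail]
    · simp
  rw [h2, mono_head]
  obtain ⟨i, h⟩ := h
  refine Fin.cases (fun h => ?_) (fun j h => ?_) i h
  · rw [← neg_sub]
    exact W.neg_mem (hW _ _ h)
  · exact hW _ _ (mono_mem_pw (Fin.tail b) j h)

theorem exists_rot {n : ℕ} (M : ℕ) (W : Submodule K A)
    (hW : ∀ x, ∀ z ∈ pw K A M, x * z - z * x ∈ W) (k : ℕ) :
    ∀ (σ : Equiv.Perm (Fin (n + 2))), ((σ.symm 0 : Fin (n + 2)) : ℕ) = k →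
    ∃ τ : Equiv.Perm (Fin (n + 1)), ∀ a : Fin (n + 2) → A, (∃ i, a i ∈ pw K A M) →
      mono (fun i => a (σ i)) -
        mono (fun i => a (Equiv.Perm.decomposeFin.symm (0, τ) i)) ∈ W := by
  induction k with
  | zero =>
    intro σ hσ
    have h0 : σ 0 = 0 := by
      have : σ.symm 0 = 0 := Fin.ext hσ
      exact (σ.symm_apply_eq.1 this).symm
    obtain ⟨⟨p, τ⟩, rfl⟩ := Equiv.Perm.decomposeFin.symm.surjective σ
    have : p = 0 := by simpa using h0
    subst this
    exact ⟨τ, fun a _ => by simp⟩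
  | succ k ih =>
    intro σ hσ
    have hk : ((((finRotate (n + 2)).trans σ).symm 0 : Fin (n + 2)) : ℕ) = k := by
      have hk2 : k + 1 < n + 2 := hσ ▸ (σ.symm 0).2
      have : ((finRotate (n + 2)).trans σ).symm 0 = ⟨k, by omega⟩ := by
        rw [Equiv.symm_apply_eq, Equiv.trans_apply, eq_comm, ← Equiv.eq_symm_apply]
        apply Fin.ext
        rw [hσ, finRotate_of_lt (by omega)]
      rw [this]
    obtain ⟨τ, hτ⟩ := ih _ hk
    refine ⟨τ, fun a ha => ?_⟩
    have h1 := hτ a ha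
    obtain ⟨i, hi⟩ := ha
    have h2 := mono_rotate W hW (fun i => a (σ i)) ⟨σ.symm i, by simpa using hi⟩
    have := W.add_mem h2 h1
    simpa using this

/-- Reduction modulo commutators. -/
theorem exists_cyc {n : ℕ} (c : Equiv.Perm (Fin (n + 2)) → K) (M : ℕ) (W : Submodule K A)
    (hW : ∀ x, ∀ z ∈ pw K A M, x * z - z * x ∈ W) :
    ∃ d : Equiv.Perm (Fin (n + 1)) → K, ∀ a : Fin (n + 2) → A, (∃ i, a i ∈ pw K A M) →
      mlinMap c a - a 0 * mlinMap d (Fin.tail a) ∈ W := by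
  classical
  choose ρ hρ using fun σ : Equiv.Perm (Fin (n + 2)) => exists_rot M W hW _ σ rfl
  refine ⟨fun τ => ∑ σ with ρ σ = τ, c σ, fun a ha => ?_⟩
  rw [← mlinMap_ext_sum, mlinMap_apply]
  have : ∑ τ, (∑ σ with ρ σ = τ, c σ) •
      mono (fun i => a (Equiv.Perm.decomposeFin.symm (0, τ) i)) =
      ∑ σ, c σ • mono (fun i => a (Equiv.Perm.decomposeFin.symm (0, ρ σ) i)) := by
    rw [← Finset.sum_fiberwise (g := ρ)]
    refine Finset.sum_congr rfl fun τ _ => ?_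
    rw [Finset.sum_smul]
    refine Finset.sum_congr rfl fun σ hσ => ?_
    rw [(Finset.mem_filter.1 hσ).2]
  rw [this, ← Finset.sum_sub_distrib]
  refine W.sum_mem fun σ _ => ?_
  rw [← smul_sub]
  exact W.smul_mem _ (hρ σ a ha)

/-- Conclusion once values with a deep entry are under control. -/
theorem good_of_deep (hfg : ∃ S : Finset A, NonUnitalAlgebra.adjoin K (S : Set A) = ⊤)
    (N : ℕ) (V : Submodule K A) (hV : Good c V)
    (h : ∀ a : Fin (n + 1) → A, (∃ i, a i ∈ pw K A N) → mlinMap c a ∈ V) :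
    ∃ V', Good c V' ∧ ∀ a : Fin (n + 1) → A, mlinMap c a ∈ V' := by
  classical
  obtain ⟨S, hS⟩ := hfg
  have hE : ∀ N, ∃ E : Finset A, ∀ Q : Submodule K A, (∀ e ∈ E, e ∈ Q) → pw K A N ≤ Q →
      ∀ x, x ∈ Q := by
    intro N
    induction N with
    | zero => exact ⟨∅, fun Q _ h x => h trivial⟩
    | succ N ih =>
      obtain ⟨E, hE⟩ := ih
      obtain ⟨F, hF, hQ⟩ := pw_fg hS N
      refine ⟨E ∪ F, fun Q h1 h2 => hE Q (fun e he => h1 e (Finset.mem_union_left _ he)) ?_⟩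
      exact hQ Q (fun p hp => h1 p (Finset.mem_union_right _ hp))
        fun p hp x => h2 (mul_mem_pw (hF p hp) x)
  obtain ⟨E, hE⟩ := hE N
  let T : Finset (Fin (n + 1) → A) := Fintype.piFinset fun _ => E
  refine ⟨V ⊔ T.sup (fun b => slot c (0, b)),
    hV.sup (good_finset_sup _ _ fun b _ => good_slot _), ?_⟩
  set V' := V ⊔ T.sup (fun b => slot c (0, b)) with hV'
  have key : ∀ s : Finset (Fin (n + 1)), ∀ a : Fin (n + 1) → A, (∀ i, i ∉ s → a i ∈ E) →
      mlinMap c a ∈ V' := by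
    intro s
    induction s using Finset.induction_on with
    | empty =>
      intro a ha
      refine Submodule.mem_sup_right ((Finset.le_sup (f := fun b => slot c (0, b))
        (show a ∈ T from Fintype.mem_piFinset.2 fun i => ha i (by simp))) ?_)
      have := mem_slot c 0 a (a 0)
      rwa [Function.update_eq_self] at this
    | insert j s _ ih =>
      intro a ha
      have := hE (V'.comap ((mlinMap c).toLinearMap a j)) (fun e he => ?_) (fun z hz => ?_) (a j)
      · rw [Submodule.mem_comap, MultilinearMap.toLinearMap_apply,
          Function.update_eq_self] at this
        exact this
      · rw [Submodule.mem_comap, MultilinearMap.toLinearMap_apply]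
        refine ih _ fun i hi => ?_
        by_cases hij : i = j
        · subst hij; simpa using he
        · rw [Function.update_of_ne hij]
          exact ha i (by simp [hij, hi])
      · rw [Submodule.mem_comap, MultilinearMap.toLinearMap_apply]
        exact Submodule.mem_sup_left (h _ ⟨j, by simpa using hz⟩)
  exact fun a => key Finset.univ a (by simp)

/-- Values lie in a good subspace. -/
theorem exists_good (hchar : (2 : K) ≠ 0)
    (hfg : ∃ S : Finset A, NonUnitalAlgebra.adjoin K (S : Set A) = ⊤)
    (hnil : ∀ a : A, ∃ m : ℕ, npowSucc a m = 0) (n : ℕ)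
    (c : Equiv.Perm (Fin (n + 1)) → K) (hc : c ≠ 0) :
    ∃ V : Submodule K A, Good c V ∧ ∀ a : Fin (n + 1) → A, mlinMap c a ∈ V := by
  rcases n with _ | n
  · refine ⟨slot c (0, 0), good_slot _, fun a => ?_⟩
    have h := mem_slot c 0 (0 : Fin 1 → A) (a 0)
    convert h using 2
    funext i
    obtain rfl : i = 0 := Subsingleton.elim (α := Fin 1) _ _
    simp
  obtain ⟨M, W, hWg, hW⟩ := exists_comm_good hchar hfg hnil hc
  obtain ⟨d, hd⟩ := exists_cyc c M W hW
  by_cases hd0 : d = 0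
  · refine good_of_deep hfg M W hWg fun a ha => ?_
    have := hd a ha
    simpa [hd0, mlinMap_apply (0 : Equiv.Perm (Fin (n + 1)) → K)] using this
  -- the ideal of `p` with `(pw M) p` good
  let H : Submodule K A :=
    { carrier := {p | Good c ((pw K A M).map (LinearMap.mulLeft K p))}
      add_mem' := fun {p q} hp hq => by
        refine (Good.sup hp hq).mono ?_
        rw [Submodule.map_le_iff_le_comap]
        intro z hz
        rw [Submodule.mem_comap, LinearMap.mulLeft_apply, add_mul]
        exact Submodule.add_mem_sup (Submodule.mem_map_of_mem (f := LinearMap.mulLeft K p) hz)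
          (Submodule.mem_map_of_mem (f := LinearMap.mulLeft K q) hz)
      zero_mem' := by
        refine good_bot.mono ?_
        rw [Submodule.map_le_iff_le_comap]
        intro z hz
        simp
      smul_mem' := fun r p hp => by
        refine Good.mono hp ?_
        rw [Submodule.map_le_iff_le_comap]
        intro z hz
        rw [Submodule.mem_comap, LinearMap.mulLeft_apply, smul_mul_assoc]
        exact Submodule.smul_mem _ _ (Submodule.mem_map_of_mem (f := LinearMap.mulLeft K p) hz) }
  have hHid : IsId H := by
    intro p hp x
    constructor
    · refine Good.mono (Good.sup hWg hp) ?_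
      rw [Submodule.map_le_iff_le_comap]
      intro z hz
      rw [Submodule.mem_comap, LinearMap.mulLeft_apply]
      have : x * p * z = (x * (p * z) - p * z * x) + p * (z * x) := by noncomm_ring
      rw [this]
      exact Submodule.add_mem_sup (hW _ _ (pw_isId M z hz p).1)
        (Submodule.mem_map_of_mem (f := LinearMap.mulLeft K p) (pw_isId M z hz x).2)
    · refine Good.mono hp ?_
      rw [Submodule.map_le_iff_le_comap]
      intro z hz
      rw [Submodule.mem_comap, LinearMap.mulLeft_apply, mul_assoc]
      exact Submodule.mem_map_of_mem (f := LinearMap.mulLeft K p) (pw_isId M z hz x).1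
  have hHd : ∀ b : Fin (n + 1) → A, mlinMap d b ∈ H := by
    intro b
    refine Good.mono (Good.sup hWg (good_slot (0, Fin.cons 0 b))) ?_
    rw [Submodule.map_le_iff_le_comap]
    intro z hz
    rw [Submodule.mem_comap, LinearMap.mulLeft_apply]
    have h1 := hd (Fin.cons z b) ⟨0, by simpa using hz⟩
    rw [Fin.cons_zero, Fin.tail_cons] at h1
    have h2 := mem_slot c 0 (Fin.cons 0 b) z
    rw [Fin.update_cons_zero] at h2
    have h4 := hW (mlinMap d b) z hz
    have : mlinMap d b * z = (-(mlinMap c (Fin.cons z b) - z * mlinMap d b) +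
        (mlinMap d b * z - z * mlinMap d b)) + mlinMap c (Fin.cons z b) := by abel
    rw [this]
    exact Submodule.add_mem_sup (W.add_mem (W.neg_mem h1) h4) h2
  obtain ⟨k, hk⟩ := exists_pw_le hfg H hHid (fun P hP hHP hs x =>
    pi_aux hnil n d hd0 Set.univ (fun _ _ _ _ => trivial) P
      (fun p hp x _ => hP p hp x) (fun b _ h => hs b fun x => h x trivial)
      (fun a _ => hHP (hHd a)) x trivial)
  have hfg' := hfg
  obtain ⟨S, hS⟩ := hfg'
  obtain ⟨F, hF, hQ⟩ := pw_fg hS k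
  set V := F.sup (fun p => (pw K A M).map (LinearMap.mulLeft K p)) with hVdef
  have hV : Good c V := good_finset_sup _ _ fun p hp => hk (hF p hp)
  have hpV : ∀ p ∈ F, ∀ z ∈ pw K A M, p * z ∈ V := fun p hp z hz =>
    (Finset.le_sup (f := fun p => (pw K A M).map (LinearMap.mulLeft K p)) hp)
      (Submodule.mem_map_of_mem (f := LinearMap.mulLeft K p) hz)
  have hle : pw K A (k + M + 1) ≤ V := by
    refine pw_add_le _ _ _ fun x hx z hz => ?_
    refine hQ (V.comap (LinearMap.mulRight K z)) (fun p hp => hpV p hp z hz) (fun p hp y => ?_) hx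
    rw [Submodule.mem_comap, LinearMap.mulRight_apply, mul_assoc]
    exact hpV p hp _ (pw_isId M z hz y).1
  refine good_of_deep hfg (k + M + 1) V hV fun a ha => hle ?_
  obtain ⟨i, hi⟩ := ha
  rw [mlinMap_apply]
  refine Submodule.sum_mem _ fun σ _ => Submodule.smul_mem _ _ ?_
  exact mono_mem_pw (fun i => a (σ i)) (σ.symm i) (by simpa using hi)
end Good

theorem multilinear_strongly_elliptic_on_fg_nil_algebra
    (K : Type*) [Field K] (hchar : (2 : K) ≠ 0)
    (A : Type*) [NonUnitalRing A] [Module K A] [IsScalarTower K A A] [SMulCommClass K A A]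
    (hfg : ∃ S : Finset A, NonUnitalAlgebra.adjoin K (S : Set A) = ⊤)
    (hnil : ∀ a : A, ∃ m : ℕ, npowSucc a m = 0)
    (n : ℕ) (c : Equiv.Perm (Fin (n + 1)) → K) (hc : c ≠ 0) :
    ∃ (q : ℕ) (idx : Fin q → Fin (n + 1)) (tup : Fin q → (Fin (n + 1) → A)),
      ∀ z : A,
        z ∈ Submodule.span K {x : A | ∃ a : Fin (n + 1) → A, x = mlinEvalNU c a} ↔
        ∃ g : Fin q → A,
          z = ∑ j : Fin q, mlinEvalNU c (Function.update (tup j) (idx j) (g j)) := by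
  obtain ⟨V, ⟨s, hs⟩, hV⟩ := exists_good hchar hfg hnil n c hc
  let e := s.equivFin
  refine ⟨s.card, fun j => (e.symm j).1.1, fun j => (e.symm j).1.2, fun z => ⟨fun hz => ?_, ?_⟩⟩
  · have hz1 : z ∈ s.sup (slot c) := by
      refine hs (Submodule.span_le.2 ?_ hz)
      rintro _ ⟨a, rfl⟩
      rw [← mlinMap_eq]
      exact hV a
    have hle : s.sup (slot c) ≤ ⨆ j : Fin s.card, slot (A := A) c (e.symm j).1 := by
      refine Finset.sup_le fun p hp => ?_
      have := le_iSup (fun j : Fin s.card => slot (A := A) c (e.symm j).1) (e ⟨p, hp⟩)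
      simpa using this
    obtain ⟨μ, hμ⟩ := (Submodule.mem_iSup_iff_exists_finsupp _ _).1 (hle hz1)
    obtain ⟨hμ1, hμ2⟩ := hμ
    choose g hg using fun j => hμ1 j
    refine ⟨g, ?_⟩
    rw [← hμ2, Finsupp.sum_fintype _ _ (fun _ => rfl)]
    refine Finset.sum_congr rfl fun j _ => ?_
    rw [← mlinMap_eq, ← hg j]
    rfl
  · rintro ⟨g, rfl⟩
    exact Submodule.sum_mem _ fun j _ => Submodule.subset_span ⟨_, rfl⟩
end

section
/- Let K be an infinite field with char(K) ≠ 2, let n ≥ 2, and let f be a polynomial (an element of the free associative K-algebra) which is neither a polynomial identity nor a central polynomial of M_n(K). Let k ≥ 1 and let B be a unital K-algebra such that every element of A = M_n(B) is a sum of k commutators and a central element (an element of the center of A). Then every commutator [a,b] = ab − ba in A is a sum of 1936k² + 22k elements from the set f(A) − f(A) = {s − t | s, t ∈ f(A)}. -/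
namespace BresarAux

/-- `Sums V N x`: `x` is a sum of `N` elements of `V`. -/
inductive Sums {A : Type*} [AddCommGroup A] (V : Set A) : ℕ → A → Prop
  | zero : Sums V 0 0
  | succ {N : ℕ} {x v : A} : Sums V N x → v ∈ V → Sums V (N + 1) (x + v)

section Sums
variable {A : Type*} [AddCommGroup A] {V : Set A}

theorem Sums.add {N M : ℕ} {x y : A} (hx : Sums V N x) (hy : Sums V M y) :
    Sums V (N + M) (x + y) := by
  induction hy with
  | zero => simpa using hx
  | succ _ hv ih => rw [← add_assoc, ← add_assoc]; exact ih.succ hv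

theorem Sums.one {x : A} (hx : x ∈ V) : Sums V 1 x := by
  simpa using (Sums.zero (V := V)).succ hx

theorem Sums.neg {N : ℕ} {x : A} (hV : ∀ v ∈ V, -v ∈ V) (hx : Sums V N x) :
    Sums V N (-x) := by
  induction hx with
  | zero => simpa using (Sums.zero (V := V))
  | succ _ hv ih => rw [neg_add]; exact ih.succ (hV _ hv)

theorem Sums.map {N : ℕ} {x : A} (g : A →+ A) (hV : ∀ v ∈ V, g v ∈ V) (hx : Sums V N x) :
    Sums V N (g x) := by
  induction hx with
  | zero => simpa using (Sums.zero (V := V))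
  | succ _ hv ih => rw [map_add]; exact ih.succ (hV _ hv)

theorem Sums.mono {N M : ℕ} {x : A} (h0 : (0 : A) ∈ V) (hNM : N ≤ M) (hx : Sums V N x) :
    Sums V M x := by
  induction hNM with
  | refl => exact hx
  | step _ ih => simpa using ih.succ h0

theorem Sums.sum {ι : Type*} (s : Finset ι) {N : ℕ} {x : ι → A}
    (hx : ∀ i ∈ s, Sums V N (x i)) : Sums V (s.card * N) (∑ i ∈ s, x i) := by
  classical
  induction s using Finset.induction_on with
  | empty => simpa using (Sums.zero (V := V))
  | insert a s ha ih =>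
    rw [Finset.sum_insert ha, Finset.card_insert_of_notMem ha, add_mul, one_mul, add_comm (_ * _)]
    exact (hx a (by simp)).add (ih fun i hi => hx i (by simp [hi]))

theorem Sums.exists_fin {N : ℕ} {x : A} (hx : Sums V N x) :
    ∃ d : Fin N → A, (∀ j, d j ∈ V) ∧ x = ∑ j, d j := by
  induction hx with
  | zero => exact ⟨Fin.elim0, fun j => j.elim0, by simp⟩
  | @succ N x v _ hv ih =>
    obtain ⟨d, hd, rfl⟩ := ih
    refine ⟨Fin.snoc d v, fun j => ?_, ?_⟩
    · refine Fin.lastCases ?_ (fun i => ?_) j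
      · simpa using hv
      · simpa using hd i
    · rw [Fin.sum_univ_castSucc]; simp

end Sums

section Ring
variable {A : Type*} [Ring A] {V : Set A}

/-- `V` is invariant under conjugation. -/
def ConjInv (V : Set A) : Prop := ∀ u w : A, u * w = 1 → w * u = 1 → ∀ v ∈ V, u * v * w ∈ V

theorem Sums.conj (hV : ConjInv V) {u w : A} (h1 : u * w = 1) (h2 : w * u = 1) {N : ℕ} {x : A}
    (hx : Sums V N x) : Sums V N (u * x * w) := by
  exact hx.map ((AddMonoidHom.mulRight w).comp (AddMonoidHom.mulLeft u)) (hV u w h1 h2)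

theorem unip1 {z : A} (hz : z * z = 0) : (1 + z) * (1 - z) = 1 := by
  simp [mul_sub, add_mul, hz]

theorem unip2 {z : A} (hz : z * z = 0) : (1 - z) * (1 + z) = 1 := by
  simp [mul_add, sub_mul, hz]

theorem half_sq {h x : A} (hc : ∀ x, h * x = x * h) (hx : x * x = 0) : h * x * (h * x) = 0 := by
  rw [mul_assoc, ← mul_assoc x, ← hc x, mul_assoc h x, hx]; simp

theorem comm_mem_of_sq_zero {F : Set A} (hF : ConjInv F) (h : A) (hc : ∀ x, h * x = x * h)
    (h2 : h + h = 1) {x c : A} (hx : x * x = 0) (hcF : c ∈ F) :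
    ∃ s ∈ F, ∃ t ∈ F, x * c - c * x = s - t := by
  have hy := half_sq hc hx
  have e1 := unip1 hy
  have e2 := unip2 hy
  refine ⟨_, hF _ _ e1 e2 c hcF, _, hF _ _ e2 e1 c hcF, ?_⟩
  have hcx : c * (h * x) = h * (c * x) := by rw [← mul_assoc, ← hc, mul_assoc]
  calc x * c - c * x = (h + h) * (x * c) - (h + h) * (c * x) := by rw [h2]; simp
    _ = _ := by
      have : (1 + h * x) * c * (1 - h * x) - (1 - h * x) * c * (1 + h * x)
          = (h * x * c + h * x * c) - (c * (h * x) + c * (h * x)) := by noncomm_ring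
      rw [this, hcx]
      simp only [add_mul, mul_assoc]

theorem off_of_nice (hV : ConjInv V) (hneg : ∀ v ∈ V, -v ∈ V) (h : A) (hc : ∀ x, h * x = x * h)
    (h2 : h + h = 1) {c p q s t : A} (hcV : ∀ x, x * x = 0 → x * c - c * x ∈ V)
    (hp : p * p = p) (hpq : p * q = 0) (hqp : q * p = 0)
    (hcp : c * p = s) (hs : q * s = s) (ht : p * t = t) (htq : t * q = t)
    (hts : t * s = p) (hst : s * t = q) (y : A) (hy : p * y = y) (hyq : y * q = y) :
    Sums V 4 y := by
  have hps : p * s = 0 := by rw [← hs, ← mul_assoc, hpq, zero_mul]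
  have hsp : s * p = s := by rw [← hcp, mul_assoc, hp]
  have key : ∀ x, p * x = x → x * q = x → Sums V 2 (x * s - s * x) := by
    intro x hx hxq
    have hxp : x * p = 0 := by rw [← hxq, mul_assoc, hqp, mul_zero]
    have hhx : h * x * (h * x) = 0 :=
      half_sq hc (by nth_rewrite 2 [← hx]; rw [← mul_assoc, hxp, zero_mul])
    have h1 := hcV (h * x) hhx
    set v := h * x * c - c * (h * x) with hv
    have hw : (p + p - 1) * (p + p - 1) = 1 := by
      simp only [mul_sub, sub_mul, mul_add, add_mul, hp]; simp
    have h3 := hV _ _ hw hw _ h1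
    have hxs : x * s = x * c * p := by rw [← hcp, mul_assoc]
    have hsx : s * x = c * x := by rw [← hcp, mul_assoc, hx]
    have hpc : p * (c * x) = 0 := by rw [← hsx, ← mul_assoc, hps, zero_mul]
    have hcxp : c * x * p = 0 := by rw [mul_assoc, hxp, mul_zero]
    have hv' : v = h * (x * c - c * x) := by
      rw [hv, mul_sub, mul_assoc, ← mul_assoc c, ← hc, mul_assoc]
    have : x * s - s * x = v + (p + p - 1) * v * (p + p - 1) := by
      have e1 : p * v = h * (x * c) := by
        rw [hv', ← mul_assoc, ← hc, mul_assoc, mul_sub, hpc, ← mul_assoc, hx, sub_zero]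
      have e2 : v * p = h * (x * s) := by
        rw [hv', mul_assoc, sub_mul, hcxp, hxs, sub_zero]
      have e3 : p * v * p = h * (x * s) := by
        rw [e1, mul_assoc, hxs]
      rw [e1] at e3
      simp only [add_mul, mul_add, sub_mul, mul_sub, one_mul, mul_one, e1, e2, e3]
      rw [hv', hsx]
      calc x * s - c * x = (h + h) * (x * s) - (h + h) * (c * x) := by rw [h2]; simp
        _ = _ := by simp only [add_mul, mul_sub]; abel
    rw [this]
    exact (Sums.one h1).add (Sums.one h3)
  have hpmq : Sums V 2 (p - q) := by
    have := key t ht htq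
    rwa [hts, hst] at this
  -- conjugate by 1 + h y
  have hyp : y * p = 0 := by rw [← hyq, mul_assoc, hqp, mul_zero]
  have hqy : q * y = 0 := by rw [← hy, ← mul_assoc, hqp, zero_mul]
  set z := h * y with hz
  have hzp : z * p = 0 := by rw [hz, mul_assoc, hyp, mul_zero]
  have hpz : p * z = z := by rw [hz, ← mul_assoc, ← hc, mul_assoc, hy]
  have hzq : z * q = z := by rw [hz, mul_assoc, hyq]
  have hqz : q * z = 0 := by rw [hz, ← mul_assoc, ← hc, mul_assoc, hqy, mul_zero]
  have hzz : z * z = 0 := by nth_rewrite 2 [← hpz]; rw [← mul_assoc, hzp, zero_mul]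
  have e1 : (1 + z) * (1 - z) = 1 := unip1 hzz
  have e2 : (1 - z) * (1 + z) = 1 := unip2 hzz
  have h4 := hpmq.conj hV e1 e2
  have h5 := hpmq.add (h4.neg hneg)
  have : y = p - q + -((1 + z) * (p - q) * (1 - z)) := by
    have : (1 + z) * (p - q) * (1 - z) = p - q - (z + z) := by
      rw [add_mul, mul_sub z, hzp, hzq, mul_sub, mul_one, one_mul, add_mul, sub_mul, sub_mul,
        hpz, hqz, hzz, zero_mul]
      abel
    rw [this, hz, ← add_mul, h2]; simp
  rw [this]; exact h5

/-- all of `pAq` consists of sums of four elements of `V` -/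
def Off (V : Set A) (p q : A) : Prop := ∀ y, p * y = y → y * q = y → Sums V 4 y

theorem comm_off (hV : ConjInv V) (hneg : ∀ v ∈ V, -v ∈ V) {p q y z : A}
    (hpq : p * q = 0) (h1 : Off V p q) (h2 : Off V q p)
    (hy : p * y = y) (hyq : y * q = y) (hz : q * z = z) (hzp : z * p = z) :
    Sums V 12 (y * z - z * y) := by
  have hzz : z * z = 0 := by
    nth_rewrite 1 [← hzp]; nth_rewrite 2 [← hz]
    rw [mul_assoc, ← mul_assoc p, hpq]; simp
  have e1 : (1 + z) * (1 - z) = 1 := unip1 hzz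
  have e2 : (1 - z) * (1 + z) = 1 := unip2 hzz
  have a1 := h1 y hy hyq
  have a2 := h2 (z * y * z) (by rw [← mul_assoc, ← mul_assoc, hz]) (by rw [mul_assoc, hzp])
  have a3 := a1.conj hV e1 e2
  have := (a1.add (a2.neg hneg)).add (a3.neg hneg)
  convert this using 1
  simp only [add_mul, mul_sub, one_mul, mul_one]; abel

theorem comm_diag (hV : ConjInv V) (hneg : ∀ v ∈ V, -v ∈ V) {p q i j a b : A}
    (hp : p * p = p) (hpq : p * q = 0) (h1 : Off V p q) (h2 : Off V q p)
    (hi : p * i = i) (hiq : i * q = i) (hj : q * j = j) (hjp : j * p = j) (hij : i * j = p)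
    (ha : p * a = a) (hap : a * p = a) (hb : p * b = b) (hbp : b * p = b) :
    Sums V 24 (a * b - b * a) := by
  have c1 := comm_off hV hneg (y := a * i) (z := j * b) hpq h1 h2 (by rw [← mul_assoc, ha])
    (by rw [mul_assoc, hiq]) (by rw [← mul_assoc, hj]) (by rw [mul_assoc, hbp])
  have c2 := comm_off hV hneg (y := b * a * i) (z := j) hpq h1 h2 
    (by rw [← mul_assoc, ← mul_assoc, hb]) (by rw [mul_assoc, hiq]) hj hjp
  have := c1.add (c2.neg hneg)
  convert this using 1
  have x1 : a * i * (j * b) = a * b := by rw [mul_assoc, ← mul_assoc i, hij, hb]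
  have x2 : b * a * i * j = b * a := by rw [mul_assoc, hij, mul_assoc, hap]
  rw [x1, x2]; simp only [mul_assoc]; abel

theorem comm_all (hV : ConjInv V) (hneg : ∀ v ∈ V, -v ∈ V) (h0 : (0 : A) ∈ V)
    (e : Fin 4 → A) (he : ∀ i, e i * e i = e i) (ho : ∀ i j, i ≠ j → e i * e j = 0)
    (hsum : ∑ i, e i = 1) (hoff : ∀ i j, i ≠ j → Off V (e i) (e j))
    (hdiag : ∀ i, ∃ q x y : A, e i * q = 0 ∧ Off V (e i) q ∧ Off V q (e i) ∧ e i * x = x ∧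
      x * q = x ∧ q * y = y ∧ y * e i = y ∧ x * y = e i) (a b : A) :
    Sums V 448 (a * b - b * a) := by
  classical
  have A1 : ∀ x : A, ∀ i, e i * (e i * x) = e i * x := fun x i => by rw [← mul_assoc, he]
  have T : ∀ i j, Sums V 24 (e i * a * e j * (e j * b * e i) - e j * b * e i * (e i * a * e j)) := by
    intro i j
    by_cases hij : i = j
    · subst hij
      obtain ⟨q, x, y, hq, f1, f2, g1, g2, g3, g4, g5⟩ := hdiag i
      exact comm_diag hV hneg (he i) hq f1 f2 g1 g2 g3 g4 g5 (by simp only [mul_assoc, A1]) 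
        (by rw [mul_assoc, he]) (by simp only [mul_assoc, A1]) (by rw [mul_assoc, he])
    · exact (comm_off hV hneg (ho i j hij) (hoff i j hij) (hoff j i (Ne.symm hij)) 
        (by simp only [mul_assoc, A1]) 
        (by rw [mul_assoc, he]) (by simp only [mul_assoc, A1]) (by rw [mul_assoc, he])).mono h0 
        (by norm_num)
  have O : ∀ i j, Sums V 4 (if i = j then 0 else e i * (a * b - b * a) * e j) := by
    intro i j
    split_ifs with hij
    · exact (Sums.zero).mono h0 (by norm_num)
    · exact hoff i j hij _ (by simp only [mul_assoc, A1]) (by rw [mul_assoc, he])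
  have s1 := Sums.sum (Finset.univ : Finset (Fin 4 × Fin 4)) (fun i _ => T i.1 i.2)
  have s2 := Sums.sum (Finset.univ : Finset (Fin 4 × Fin 4)) (fun i _ => O i.1 i.2)
  have s := s1.add s2
  have hs : Finset.card (Finset.univ : Finset (Fin 4 × Fin 4)) * 24 +
      Finset.card (Finset.univ : Finset (Fin 4 × Fin 4)) * 4 = 448 := by simp
  rw [hs] at s
  convert s using 1
  have D : ∀ x : A, x = ∑ i, ∑ j, e i * x * e j := by
    intro x
    simp_rw [← Finset.mul_sum, hsum, mul_one, ← Finset.sum_mul, hsum, one_mul]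
  have M : ∀ x y i, e i * (x * y) * e i = ∑ j, e i * x * e j * (e j * y * e i) := by
    intro x y i
    have : ∀ j, e i * x * e j * (e j * y * e i) = e i * x * e j * y * e i := by
      intro j; simp only [mul_assoc, A1]
    simp_rw [this, ← Finset.sum_mul, ← Finset.mul_sum, hsum]; simp [mul_assoc]
  have D1 : ∑ i, e i * (a * b - b * a) * e i = 
      ∑ i, ∑ j, (e i * a * e j * (e j * b * e i) - e j * b * e i * (e i * a * e j)) := by
    simp_rw [Finset.sum_sub_distrib, mul_sub, sub_mul, Finset.sum_sub_distrib, M]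
    congr 1
    exact Finset.sum_comm
  rw [Fintype.sum_prod_type, Fintype.sum_prod_type]
  simp only
  rw [← D1, ← Finset.sum_add_distrib]
  conv_lhs => rw [D (a * b - b * a)]
  refine Finset.sum_congr rfl fun i _ => ?_
  rw [← Finset.sum_erase_add _ _ (Finset.mem_univ i), add_comm]
  congr 1
  rw [← Finset.sum_erase_add _ _ (Finset.mem_univ i)]
  simp only [if_true, add_zero]
  exact Finset.sum_congr rfl fun j hj => by rw [if_neg (Finset.ne_of_mem_erase hj).symm]

end Ring



section Greedy
open Matrix
variable {K : Type*} [Field K]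

theorem exists_scalar_mod {U : Type*} [AddCommGroup U] [Module K U] [FiniteDimensional K U]
    (S : Submodule K U) (hS : 1 < Module.finrank K (U ⧸ S)) (c : U →ₗ[K] U)
    (h : ∀ w : U, ¬ LinearIndependent K ![S.mkQ w, S.mkQ (c w)]) :
    ∃ a : K, ∀ w, c w - a • w ∈ S := by
  have h1 : ∀ w, S.mkQ w ≠ 0 → ∃ a : K, S.mkQ (c w) = a • S.mkQ w := by
    intro w hw
    have := h w
    rw [LinearIndependent.pair_iff' hw] at this
    push Not at this
    obtain ⟨a, ha⟩ := this
    exact ⟨a, ha.symm⟩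
  have h2 : ∀ w ∈ S, ∀ w', S.mkQ w' ≠ 0 → ∃ a : K, S.mkQ (c w) = a • S.mkQ w' := by
    intro w hw w' hw'
    have hw0 : S.mkQ w = 0 := by simpa using hw
    obtain ⟨a, ha⟩ := h1 (w + w') (by rw [map_add, hw0, zero_add]; exact hw')
    obtain ⟨b, hb⟩ := h1 w' hw'
    rw [map_add, map_add, map_add, hw0, zero_add, hb] at ha
    exact ⟨a - b, by rw [sub_smul, ← ha]; simp⟩
  have h3 : S ≤ LinearMap.ker (S.mkQ ∘ₗ c) := by
    intro w hw
    have : Nontrivial (U ⧸ S) := Module.nontrivial_of_finrank_pos (R := K) (by omega)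
    obtain ⟨x, hx⟩ := exists_ne (0 : U ⧸ S)
    obtain ⟨y, hxy⟩ := exists_linearIndependent_pair_of_one_lt_finrank (R := K) hS hx
    obtain ⟨x, rfl⟩ := S.mkQ_surjective x
    obtain ⟨y, rfl⟩ := S.mkQ_surjective y
    obtain ⟨a, ha⟩ := h2 w hw x hx
    obtain ⟨b, hb⟩ := h2 w hw y (hxy.ne_zero 1)
    rw [LinearIndependent.pair_iff] at hxy
    have := (hxy a (-b) (by rw [← ha, neg_smul, ← hb]; simp)).1
    simp [ha, this]
  obtain ⟨a, ha⟩ := LinearMap.exists_eq_smul_id_of_forall_notLinearIndependent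
    (f := S.liftQ (S.mkQ ∘ₗ c) h3) (by
      intro v
      obtain ⟨w, rfl⟩ := S.mkQ_surjective v
      simpa using h w)
  refine ⟨a, fun w => ?_⟩
  have := LinearMap.congr_fun ha (S.mkQ w)
  rw [← S.ker_mkQ, LinearMap.mem_ker, map_sub, map_smul, sub_eq_zero]
  simpa using this

theorem greedy_step {n m : ℕ} (hn : 2 ≤ n) (c r : Matrix (Fin n) (Fin n) K)
    (hdet : (r * c - c * r).det ≠ 0) (hm : 4 * m < n) (u : Fin m → (Fin n → K))
    (hu : LinearIndependent K (Sum.elim u (fun i => c *ᵥ u i))) :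
    ∃ u : Fin (m + 1) → (Fin n → K), LinearIndependent K (Sum.elim u (fun i => c *ᵥ u i)) := by
  set S := Submodule.span K (Set.range (Sum.elim u (fun i => c *ᵥ u i))) with hS
  have hSr : Module.finrank K S = 2 * m := by
    rw [finrank_span_eq_card hu]; simp; omega
  have hq := S.finrank_quotient_add_finrank
  rw [hSr, Module.finrank_fin_fun] at hq
  by_cases H : ∀ w : Fin n → K, ¬ LinearIndependent K ![S.mkQ w, S.mkQ (c.mulVecLin w)]
  · exfalso
    obtain ⟨a, ha⟩ := exists_scalar_mod S (by omega) c.mulVecLin H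
    have htop : (⊤ : Submodule K (Fin n → K)) ≤ S.map r.mulVecLin ⊔ S := by
      intro v _
      obtain ⟨w, rfl⟩ := (Matrix.mulVec_surjective_iff_isUnit.2
        ((Matrix.isUnit_iff_isUnit_det _).2 hdet.isUnit)) v
      have : (r * c - c * r) *ᵥ w = r *ᵥ (c *ᵥ w - a • w) + -(c *ᵥ (r *ᵥ w) - a • (r *ᵥ w)) := by
        rw [Matrix.sub_mulVec, Matrix.mulVec_sub, Matrix.mulVec_smul, ← Matrix.mulVec_mulVec,
          ← Matrix.mulVec_mulVec]; abel
      rw [this]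
      exact Submodule.add_mem_sup (Submodule.mem_map.2 ⟨_, ha w, rfl⟩) (S.neg_mem (ha (r *ᵥ w)))
    have h1 := Submodule.finrank_mono htop
    have h2 := Submodule.finrank_add_le_finrank_add_finrank (S.map r.mulVecLin) S
    have h3 := Submodule.finrank_map_le r.mulVecLin S
    rw [finrank_top, Module.finrank_fin_fun] at h1
    omega
  · push Not at H
    obtain ⟨w, hw⟩ := H
    have hli := LinearIndependent.sumElim_of_quotient (M' := S) (linearIndependent_span hu)
      ![w, c *ᵥ w] (by
        have h0 : (Submodule.Quotient.mk ∘ ![w, c *ᵥ w] : Fin 2 → ((Fin n → K) ⧸ S)) =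
            ![S.mkQ w, S.mkQ (c.mulVecLin w)] := by
          ext i; fin_cases i <;> rfl
        rw [h0]; exact hw)
    let e : Fin (m + 1) ⊕ Fin (m + 1) ≃ (Fin m ⊕ Fin m) ⊕ Fin 2 :=
      ((Equiv.sumCongr finSumFinEquiv.symm finSumFinEquiv.symm).trans
        (Equiv.sumSumSumComm (Fin m) (Fin 1) (Fin m) (Fin 1))).trans
        (Equiv.sumCongr (Equiv.refl _) finSumFinEquiv)
    refine ⟨Fin.snoc u w, ?_⟩
    rw [← linearIndependent_equiv e] at hli
    have hfun : ∀ {α : Type} (x y : α → (Fin n → K)), x = y → LinearIndependent K y →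
        LinearIndependent K x := by
      intro α x y h hy; rw [h]; exact hy
    refine hfun _ _ ?_ hli
    ext i j
    rcases i with i | i
    · refine Fin.lastCases ?_ (fun i => ?_) i
      · have : (finSumFinEquiv.symm (Fin.last m) : Fin m ⊕ Fin 1) = Sum.inr 0 := by
          rw [Equiv.symm_apply_eq]; ext; simp
        simp [e, this]
        rfl
      · have : (finSumFinEquiv.symm i.castSucc : Fin m ⊕ Fin 1) = Sum.inl i := by
          rw [Equiv.symm_apply_eq]; ext; simp
        simp [e, this]
    · refine Fin.lastCases ?_ (fun i => ?_) i
      · have : (finSumFinEquiv.symm (Fin.last m) : Fin m ⊕ Fin 1) = Sum.inr 0 := by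
          rw [Equiv.symm_apply_eq]; ext; simp
        simp [e, this]
        rfl
      · have : (finSumFinEquiv.symm i.castSucc : Fin m ⊕ Fin 1) = Sum.inl i := by
          rw [Equiv.symm_apply_eq]; ext; simp
        simp [e, this]

theorem greedy {n : ℕ} (hn : 2 ≤ n) (c r : Matrix (Fin n) (Fin n) K)
    (hdet : (r * c - c * r).det ≠ 0) :
    ∃ m, n ≤ 4 * m ∧ ∃ u : Fin m → (Fin n → K),
      LinearIndependent K (Sum.elim u (fun i => c *ᵥ u i)) := by
  by_contra hcon
  have : ∀ m, ∃ u : Fin m → (Fin n → K),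
      LinearIndependent K (Sum.elim u (fun i => c *ᵥ u i)) := by
    intro m
    induction m with
    | zero => exact ⟨Fin.elim0, linearIndependent_empty_type⟩
    | succ m ih =>
      obtain ⟨u, hu⟩ := ih
      by_cases h : 4 * m < n
      · exact greedy_step hn c r hdet h u hu
      · exact absurd ⟨m, by omega, u, hu⟩ hcon
  exact hcon ⟨n, by omega, this n⟩

end Greedy


section Skew
open Matrix
variable (K : Type*) [Field K] (N : ℕ)

/-- The polynomial ring `K[y_0, …, y_N][z]`. -/
abbrev PP := Polynomial (MvPolynomial (Fin (N + 1)) K)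

/-- The cyclic shift of the variables `y_i`. -/
noncomputable def shiftHom : PP K N →ₐ[K] PP K N :=
  Polynomial.mapAlgHom (MvPolynomial.rename (fun i : Fin (N + 1) => i + 1))

/-- the weights of the twisted cyclic permutation matrix -/
noncomputable def wt (i : Fin (N + 1)) : PP K N := if i = Fin.last N then Polynomial.X else 1

/-- the twisted cyclic permutation matrix -/
noncomputable def XX : Matrix (Fin (N + 1)) (Fin (N + 1)) (PP K N) :=
  fun i j => if j = i + 1 then wt K N i else 0

/-- the cyclic algebra (an order in it) -/
noncomputable def RR : Subalgebra K (Matrix (Fin (N + 1)) (Fin (N + 1)) (PP K N)) where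
  carrier := {M | XX K N * M = (shiftHom K N).mapMatrix M * XX K N}
  mul_mem' {a b} ha hb := by
    simp only [Set.mem_ofPred_eq] at *
    rw [map_mul, mul_assoc, ← hb, ← mul_assoc, ha, mul_assoc]
  add_mem' {a b} ha hb := by
    simp only [Set.mem_ofPred_eq] at *
    rw [map_add, mul_add, add_mul, ha, hb]
  algebraMap_mem' k := by
    simp only [Set.mem_ofPred_eq]
    rw [AlgHom.commutes, Algebra.commutes]

variable {K N}

theorem XX_mul (M : Matrix (Fin (N + 1)) (Fin (N + 1)) (PP K N)) (i j) :
    (XX K N * M) i j = wt K N i * M (i + 1) j := by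
  simp [Matrix.mul_apply, XX]

theorem mul_XX (M : Matrix (Fin (N + 1)) (Fin (N + 1)) (PP K N)) (i j) :
    (M * XX K N) i (j + 1) = M i j * wt K N j := by
  simp [Matrix.mul_apply, XX]

theorem mem_RR {M : Matrix (Fin (N + 1)) (Fin (N + 1)) (PP K N)} :
    M ∈ RR K N ↔ ∀ i j, wt K N i * M (i + 1) (j + 1) = shiftHom K N (M i j) * wt K N j := by
  constructor
  · intro h i j
    have h : XX K N * M = (shiftHom K N).mapMatrix M * XX K N := h
    have := congrFun (congrFun h i) (j + 1)
    rw [XX_mul, mul_XX] at this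
    simpa using this
  · intro h
    change XX K N * M = (shiftHom K N).mapMatrix M * XX K N
    ext1 i j
    obtain ⟨j, rfl⟩ : ∃ j', j = j' + 1 := ⟨j - 1, by simp⟩
    rw [XX_mul, mul_XX, h]; simp

theorem wt_ne (i : Fin (N + 1)) : wt K N i ≠ 0 := by
  unfold wt; split_ifs
  · exact Polynomial.X_ne_zero
  · exact one_ne_zero

theorem det_XX : (XX K N).det ≠ 0 := by
  intro h
  obtain ⟨v, hv, h⟩ := Matrix.exists_mulVec_eq_zero_iff.2 h
  apply hv
  ext1 i
  obtain ⟨i, rfl⟩ : ∃ j', i = j' + 1 := ⟨i - 1, by simp⟩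
  have := congrFun h i
  simpa [Matrix.mulVec, dotProduct, XX, wt_ne] using this

theorem XX_cancel {A B : Matrix (Fin (N + 1)) (Fin (N + 1)) (PP K N)}
    (h : XX K N * A = XX K N * B) : A = B := by
  ext1 i j
  obtain ⟨i, rfl⟩ : ∃ j', i = j' + 1 := ⟨i - 1, by simp⟩
  have := congrFun (congrFun h i) j
  rw [XX_mul, XX_mul] at this
  exact mul_left_cancel₀ (wt_ne i) this

theorem map_XX : (shiftHom K N).mapMatrix (XX K N) = XX K N := by
  ext1 i j
  simp only [AlgHom.mapMatrix_apply, Matrix.map_apply, XX, wt]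
  split_ifs <;> simp [shiftHom]

theorem coeff_shift (p : PP K N) : (shiftHom K N p).coeff 0 = 0 ↔ p.coeff 0 = 0 := by
  have hinj : Function.Injective (fun i : Fin (N + 1) => i + 1) := add_left_injective 1
  simp only [shiftHom, Polynomial.coe_mapAlgHom, Polynomial.coeff_map]
  exact map_eq_zero_iff _ (MvPolynomial.rename_injective _ hinj)

theorem wt_last : wt K N (Fin.last N) = Polynomial.X := by simp [wt]

theorem wt_castSucc (i : Fin N) : wt K N i.castSucc = 1 := by
  simp [wt, Fin.castSucc_ne_last]

theorem lower0 {M : Matrix (Fin (N + 1)) (Fin (N + 1)) (PP K N)} (hM : M ∈ RR K N)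
    (i : Fin (N + 1)) : ∀ j < i, (M i j).coeff 0 = 0 := by
  rw [mem_RR] at hM
  induction i using Fin.reverseInduction with
  | last =>
    intro j hj
    obtain ⟨j, rfl⟩ := Fin.exists_castSucc_eq.2 hj.ne
    have := hM (Fin.last N) j.castSucc
    rw [wt_last, wt_castSucc, mul_one] at this
    rw [← coeff_shift, ← this]; simp
  | cast i ih =>
    intro j hj
    obtain ⟨j, rfl⟩ := Fin.exists_castSucc_eq.2 (hj.trans_le (Fin.le_last _)).ne
    have := hM i.castSucc j.castSucc
    rw [wt_castSucc, wt_castSucc, mul_one, one_mul, Fin.coeSucc_eq_succ, Fin.coeSucc_eq_succ] at this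
    rw [← coeff_shift, ← this]
    exact ih _ (by simpa using hj)

theorem diag0 {M : Matrix (Fin (N + 1)) (Fin (N + 1)) (PP K N)} (hM : M ∈ RR K N)
    (h : (M (Fin.last N) (Fin.last N)).coeff 0 ≠ 0) (i : Fin (N + 1)) : (M i i).coeff 0 ≠ 0 := by
  rw [mem_RR] at hM
  induction i using Fin.reverseInduction with
  | last => exact h
  | cast i ih =>
    have := hM i.castSucc i.castSucc
    rw [wt_castSucc, mul_one, one_mul, Fin.coeSucc_eq_succ] at this
    rwa [Ne, ← coeff_shift, ← this]

theorem row_last {M : Matrix (Fin (N + 1)) (Fin (N + 1)) (PP K N)} (hM : M ∈ RR K N)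
    (h : ∀ j, M (Fin.last N) j = 0) : M = 0 := by
  rw [mem_RR] at hM
  have step : ∀ i, (∀ j, M i j = 0) → ∀ j, M (i + 1) j = 0 := by
    intro i hi j
    obtain ⟨j, rfl⟩ : ∃ j', j = j' + 1 := ⟨j - 1, by simp⟩
    have := hM i j
    rw [hi] at this
    simpa [wt_ne] using this
  have all : ∀ i j, M i j = 0 := by
    intro i
    induction i using Fin.induction with
    | zero => simpa using step _ h
    | succ i ih => rw [← Fin.coeSucc_eq_succ]; exact step _ ih
  ext1 i j; exact all i j

theorem det_RR (d : ℕ) : ∀ M ∈ RR K N, M ≠ 0 → ∑ i, ∑ j, (M i j).natDegree ≤ d → M.det ≠ 0 := by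
  induction d using Nat.strong_induction_on with
  | _ d ih =>
  intro M hM h0 hd
  by_cases h : (M (Fin.last N) (Fin.last N)).coeff 0 = 0
  · have hrow : ∀ j, (M (Fin.last N) j).coeff 0 = 0 := by
      intro j
      rcases (Fin.le_last j).lt_or_eq with hj | rfl
      · exact lower0 hM _ _ hj
      · exact h
    let M' : Matrix (Fin (N + 1)) (Fin (N + 1)) (PP K N) :=
      fun i j => if i = 0 then (M (Fin.last N) j).divX else M (i - 1) j
    have hM'0 : ∀ j, M' (Fin.last N + 1) j = (M (Fin.last N) j).divX := by
      intro j; simp [M']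
    have hM's : ∀ (i : Fin N) j, M' (i.castSucc + 1) j = M i.castSucc j := by
      intro i j
      have : i.castSucc + 1 ≠ 0 := by rw [Fin.coeSucc_eq_succ]; exact Fin.succ_ne_zero i
      simp only [M', if_neg this, add_sub_cancel_right]
    have hX : M = XX K N * M' := by
      ext1 i j
      rw [XX_mul]
      refine Fin.lastCases ?_ (fun i => ?_) i
      · rw [hM'0, wt_last]
        have := Polynomial.divX_mul_X_add (M (Fin.last N) j)
        rw [hrow, map_zero, add_zero, mul_comm] at this
        exact this.symm
      · rw [hM's, wt_castSucc, one_mul]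
    have hM' : M' ∈ RR K N := by
      change XX K N * M' = (shiftHom K N).mapMatrix M' * XX K N
      apply XX_cancel
      have h1 : XX K N * M = (shiftHom K N).mapMatrix M * XX K N := hM
      rw [hX, map_mul, map_XX] at h1
      rw [h1, mul_assoc]
    have h0' : M' ≠ 0 := by
      rintro h; rw [hX, h, mul_zero] at h0; exact h0 rfl
    have hlt : ∑ i, ∑ j, (M' i j).natDegree < ∑ i, ∑ j, (M i j).natDegree := by
      rw [← Equiv.sum_comp (Equiv.addRight (1 : Fin (N + 1)))]
      simp only [Equiv.coe_addRight]
      have hle : ∀ i j, (M' (i + 1) j).natDegree ≤ (M i j).natDegree := by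
        intro i j
        refine Fin.lastCases ?_ (fun i => ?_) i
        · rw [hM'0, Polynomial.natDegree_divX_eq_natDegree_tsub_one]; omega
        · rw [hM's]
      apply Finset.sum_lt_sum (fun i _ => Finset.sum_le_sum fun j _ => hle i j)
      refine ⟨Fin.last N, Finset.mem_univ _, ?_⟩
      apply Finset.sum_lt_sum (fun j _ => hle _ j)
      have : ∃ j, M (Fin.last N) j ≠ 0 := by
        by_contra hcon; push Not at hcon; exact h0 (row_last hM hcon)
      obtain ⟨j, hj⟩ := this
      refine ⟨j, Finset.mem_univ _, ?_⟩
      rw [hM'0, Polynomial.natDegree_divX_eq_natDegree_tsub_one]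
      have : (M (Fin.last N) j).natDegree ≠ 0 := by
        intro h
        apply hj
        rw [Polynomial.eq_C_of_natDegree_eq_zero h, hrow, map_zero]
      omega
    rw [hX, Matrix.det_mul]
    exact mul_ne_zero det_XX (ih _ (hlt.trans_le hd) M' hM' h0' le_rfl)
  · intro hdet
    have h1 := congrArg (Polynomial.constantCoeff) hdet
    rw [RingHom.map_det, map_zero, Matrix.det_of_isUpperTriangular] at h1
    · rw [Finset.prod_eq_zero_iff] at h1
      obtain ⟨i, _, hi⟩ := h1
      exact diag0 hM h i (by simpa using hi)
    · intro i j hij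
      simpa using lower0 hM i j hij

/-- specialization of the variables -/
noncomputable def spec (η : Fin (N + 1) → K) (ζ : K) : PP K N →ₐ[K] K :=
  (Polynomial.aeval ζ).comp (Polynomial.mapAlgHom (MvPolynomial.aeval η))

theorem exists_spec [Infinite K] {p : PP K N} (hp : p ≠ 0) : ∃ η ζ, spec η ζ p ≠ 0 := by
  by_contra hcon
  push Not at hcon
  apply hp
  ext1 k
  rw [Polynomial.coeff_zero]
  apply MvPolynomial.funext
  intro η
  have : p.map (MvPolynomial.aeval (R := K) η : MvPolynomial (Fin (N + 1)) K →ₐ[K] K).toRingHom = 0 := by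
    apply Polynomial.funext
    intro ζ
    have := hcon η ζ
    simpa [spec] using this
  have := congrArg (fun q => Polynomial.coeff q k) this
  simpa [MvPolynomial.aeval_eq_eval] using this

theorem lift_RR (η : Fin (N + 1) → K) (hη : Function.Injective η)
    (a : Matrix (Fin (N + 1)) (Fin (N + 1)) K) :
    ∃ M ∈ RR K N, (spec η 1).mapMatrix M = a := by
  classical
  let q : Fin (N + 1) → Polynomial K :=
    fun d => Lagrange.interpolate Finset.univ η (fun i => a i (i + d))
  have hq : ∀ d i, (q d).eval (η i) = a i (i + d) := fun d i =>
    Lagrange.eval_interpolate_at_node _ hη.injOn (Finset.mem_univ i)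
  let M : Matrix (Fin (N + 1)) (Fin (N + 1)) (PP K N) := fun i j =>
    Polynomial.C (Polynomial.aeval (MvPolynomial.X i) (q (j - i))) *
      (if j < i then Polynomial.X else 1)
  refine ⟨M, ?_, ?_⟩
  · rw [mem_RR]
    intro i j
    have hs : shiftHom K N (M i j) =
      Polynomial.C (Polynomial.aeval (MvPolynomial.X (i + 1)) (q (j - i))) *
      (if j < i then Polynomial.X else 1) := by
      simp only [M, map_mul]
      congr 1
      · simp only [shiftHom, Polynomial.coe_mapAlgHom, Polynomial.map_C]
        congr 1
        change MvPolynomial.rename _ _ = _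
        rw [← Polynomial.aeval_algHom_apply, MvPolynomial.rename_X]
      · split_ifs <;> simp [shiftHom]
    rw [hs]
    simp only [M, add_sub_add_right_eq_sub]
    rw [mul_left_comm, mul_assoc]
    congr 1
    refine Fin.lastCases ?_ (fun i => ?_) i <;> refine Fin.lastCases ?_ (fun j => ?_) j
    · simp
    · simp [wt_last, wt_castSucc, Fin.castSucc_lt_last]
    · simp [wt_last, wt_castSucc, Fin.castSucc_lt_last, not_lt.2 (Fin.le_last _)]
    · simp [wt_castSucc]
  · ext1 i j
    rw [AlgHom.mapMatrix_apply, Matrix.map_apply]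
    change spec η 1 (_ * _) = _
    rw [map_mul]
    have h1 : spec η 1 (Polynomial.C (Polynomial.aeval (MvPolynomial.X i) (q (j - i)))) = a i j := by
      simp only [spec, AlgHom.comp_apply, Polynomial.coe_mapAlgHom, Polynomial.map_C,
        Polynomial.aeval_C]
      change MvPolynomial.aeval η _ = _
      rw [← Polynomial.aeval_algHom_apply, MvPolynomial.aeval_X, Polynomial.coe_aeval_eq_eval, hq]
      simp
    rw [h1]
    split_ifs <;> simp [spec]

theorem exists_good [Infinite K] (f : FreeAlgebra K ℕ)
    (hf : ¬ ∀ a : ℕ → Matrix (Fin (N + 1)) (Fin (N + 1)) K,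
      FreeAlgebra.lift K a f ∈ Set.center (Matrix (Fin (N + 1)) (Fin (N + 1)) K)) :
    ∃ (a : ℕ → Matrix (Fin (N + 1)) (Fin (N + 1)) K) (r : Matrix (Fin (N + 1)) (Fin (N + 1)) K),
      (r * FreeAlgebra.lift K a f - FreeAlgebra.lift K a f * r).det ≠ 0 := by
  push Not at hf
  obtain ⟨a, ha⟩ := hf
  rw [Semigroup.mem_center_iff] at ha
  push Not at ha
  obtain ⟨b, hb⟩ := ha
  let η : Fin (N + 1) → K := fun i => Infinite.natEmbedding K i
  have hη : Function.Injective η := fun i j h => Fin.ext ((Infinite.natEmbedding K).injective h)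
  choose L hL1 hL2 using lift_RR η hη
  let a' : ℕ → RR K N := fun i => ⟨L (a i), hL1 _⟩
  have hlift : ∀ {C D : Type _} [Ring C] [Ring D] [Algebra K C] [Algebra K D] (g : C →ₐ[K] D)
      (x : ℕ → C), FreeAlgebra.lift K (fun i => g (x i)) f = g (FreeAlgebra.lift K x f) := by
    intro C D _ _ _ _ g x
    have : FreeAlgebra.lift K (fun i => g (x i)) = g.comp (FreeAlgebra.lift K x) := by
      ext i; simp
    rw [this]; rfl
  let E : RR K N := FreeAlgebra.lift K a' f
  let b' : RR K N := ⟨L b, hL1 _⟩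
  let D : RR K N := b' * E - E * b'
  have hE : ∀ η' ζ, (spec η' ζ).mapMatrix E.1 =
      FreeAlgebra.lift K (fun i => (spec η' ζ).mapMatrix (a' i).1) f := by
    intro η' ζ
    rw [hlift ((spec η' ζ).mapMatrix) (fun i => (a' i).1)]
    congr 1
    exact (hlift (RR K N).val a').symm
  have hD : D.1 ≠ 0 := by
    intro h
    have h := congrArg (spec η 1).mapMatrix h
    apply hb
    rw [map_zero] at h
    have e : D.1 = L b * E.1 - E.1 * L b := rfl
    rw [e, map_sub, map_mul, map_mul, hE, hL2] at h
    have e2 : (fun i => (spec η 1).mapMatrix (a' i).1) = a := by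
      ext1 i; exact hL2 _
    rw [e2] at h
    exact sub_eq_zero.1 h
  have hdet := det_RR _ D.1 D.2 hD le_rfl
  obtain ⟨η', ζ, h⟩ := exists_spec hdet
  refine ⟨fun i => (spec η' ζ).mapMatrix (a' i).1, (spec η' ζ).mapMatrix (L b), ?_⟩
  rw [← hE, ← map_mul, ← map_mul, ← map_sub, ← AlgHom.map_det]
  exact h

end Skew

section Mat
open Matrix
variable {n : ℕ} {K : Type*} [Field K] {B : Type*} [Ring B]

theorem exists_invol {I J : Finset (Fin n)} (hd : Disjoint I J) (hc : I.card = J.card) :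
    ∃ τ : Fin n → Fin n, Function.Involutive τ ∧ ∀ a, a ∈ J ↔ τ a ∈ I := by
  classical
  let e : I ≃ J := Finset.equivOfCardEq hc
  have hIJ : ∀ a, a ∈ I → a ∉ J := fun a h1 h2 => Finset.disjoint_left.1 hd h1 h2
  let τ : Fin n → Fin n := fun a =>
    if h : a ∈ I then (e ⟨a, h⟩ : Fin n) else if h : a ∈ J then (e.symm ⟨a, h⟩ : Fin n) else a
  have t1 : ∀ a (h : a ∈ I), τ a = e ⟨a, h⟩ := fun a h => by simp [τ, h]
  have t2 : ∀ a (h : a ∈ J), τ a = e.symm ⟨a, h⟩ := fun a h => by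
    have : a ∉ I := fun h' => hIJ a h' h
    simp [τ, h, this]
  have t3 : ∀ a, a ∉ I → a ∉ J → τ a = a := fun a h1 h2 => by simp [τ, h1, h2]
  refine ⟨τ, fun a => ?_, fun a => ?_⟩
  · by_cases h1 : a ∈ I
    · rw [t1 a h1, t2 _ (e ⟨a, h1⟩).2]; simp
    · by_cases h2 : a ∈ J
      · rw [t2 a h2, t1 _ (e.symm ⟨a, h2⟩).2]; simp
      · rw [t3 a h1 h2, t3 a h1 h2]
  · by_cases h1 : a ∈ I
    · rw [t1 a h1]
      have := (e ⟨a, h1⟩).2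
      exact ⟨fun h => absurd h (hIJ a h1), fun h => absurd this (hIJ _ h)⟩
    · by_cases h2 : a ∈ J
      · rw [t2 a h2]; simp [h2]
      · rw [t3 a h1 h2]; simp [h1, h2]

/-- permutation matrix of an involution -/
def Tm (B : Type*) [Ring B] (τ : Fin n → Fin n) : Matrix (Fin n) (Fin n) B :=
  Matrix.of fun a b => if a = τ b then 1 else 0

/-- diagonal idempotent of a finite set of indices -/
def ind (B : Type*) [Ring B] (P : Finset (Fin n)) : Matrix (Fin n) (Fin n) B :=
  Matrix.diagonal fun i => if i ∈ P then 1 else 0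

theorem mul_Tm (τ : Fin n → Fin n) (M : Matrix (Fin n) (Fin n) B) (a b) :
    (M * Tm B τ) a b = M a (τ b) := by
  simp [Matrix.mul_apply, Tm]

theorem Tm_mul {τ : Fin n → Fin n} (hτ : Function.Involutive τ) (M : Matrix (Fin n) (Fin n) B)
    (a b) : (Tm B τ * M) a b = M (τ a) b := by
  have : ∀ x, a = τ x ↔ x = τ a := fun x => by rw [eq_comm, hτ.eq_iff, eq_comm]
  simp [Matrix.mul_apply, Tm, this, eq_comm]

theorem Tm_sq {τ : Fin n → Fin n} (hτ : Function.Involutive τ) : Tm B τ * Tm B τ = 1 := by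
  ext a b
  rw [mul_Tm, Tm]; simp [hτ b, Matrix.one_apply]

theorem Tm_ind {τ : Fin n → Fin n} (hτ : Function.Involutive τ) {I J : Finset (Fin n)}
    (h : ∀ a, a ∈ J ↔ τ a ∈ I) : Tm B τ * ind B I * Tm B τ = ind B J := by
  ext a b
  rw [mul_Tm, Tm_mul hτ]
  simp [ind, Matrix.diagonal_apply, hτ.injective.eq_iff, h]

theorem ind_mul (P Q : Finset (Fin n)) : ind B P * ind B Q = ind B (P ∩ Q) := by
  simp only [ind, Matrix.diagonal_mul_diagonal]
  congr 1; ext i; by_cases h : i ∈ P <;> simp [h]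

theorem ind_empty : ind B (∅ : Finset (Fin n)) = 0 := by
  simp [ind]

theorem exists_conj {m : ℕ} (c : Matrix (Fin n) (Fin n) K) (u : Fin m → (Fin n → K))
    (hu : LinearIndependent K (Sum.elim u (fun i => c *ᵥ u i)))
    {I J : Finset (Fin n)} (hd : Disjoint I J) (hI : I.card = m) 
    {τ : Fin n → Fin n} (hτ : Function.Involutive τ) (h : ∀ a, a ∈ J ↔ τ a ∈ I) :
    ∃ g g' : Matrix (Fin n) (Fin n) K, g * g' = 1 ∧ g' * g = 1 ∧
      ∀ a, ∀ i ∈ I, (g' * c * g) a i = if a = τ i then 1 else 0 := by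
  classical
  let bb := Module.Basis.sumExtend hu
  haveI hfin : Finite ((Fin m ⊕ Fin m) ⊕ Module.Basis.sumExtendIndex hu) :=
    Module.Finite.finite_basis bb
  haveI : Finite (Module.Basis.sumExtendIndex hu) := Finite.of_injective
    (Sum.inr : _ → ((Fin m ⊕ Fin m) ⊕ Module.Basis.sumExtendIndex hu)) Sum.inr_injective
  haveI : Fintype (Module.Basis.sumExtendIndex hu) := Fintype.ofFinite _
  have hcard : Fintype.card ((Fin m ⊕ Fin m) ⊕ Module.Basis.sumExtendIndex hu) = n := by
    rw [← Module.finrank_eq_card_basis bb, Module.finrank_fin_fun]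
  let eI : I ≃ Fin m := Finset.equivFinOfCardEq hI
  have hbb : ∀ k, bb (Sum.inl k) = Sum.elim u (fun i => c *ᵥ u i) k := by
    intro k
    simp only [bb, Module.Basis.sumExtend, Module.Basis.reindex_apply, Equiv.symm_symm,
      Module.Basis.extend_apply_self]
    rfl
  let φ : Fin m ⊕ Fin m → Fin n := Sum.elim (fun k => (eI.symm k : Fin n)) (fun k => τ (eI.symm k))
  have hφ : Function.Injective φ := by
    have hne : ∀ k l, (eI.symm k : Fin n) ≠ τ (eI.symm l) := by
      intro k l e
      have h1 : (eI.symm k : Fin n) ∈ I := (eI.symm k).2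
      have h2 : (eI.symm k : Fin n) ∈ J := by
        rw [e, h, hτ]; exact (eI.symm l).2
      exact Finset.disjoint_left.1 hd h1 h2
    rintro (k | k) (l | l) e
    · simpa [φ] using e
    · exact absurd e (hne k l)
    · exact absurd e.symm (hne l k)
    · simpa [φ, hτ.injective.eq_iff] using e
  obtain ⟨E, hE⟩ : ∃ E : ((Fin m ⊕ Fin m) ⊕ Module.Basis.sumExtendIndex hu) ≃ Fin n,
      ∀ k, E (Sum.inl k) = φ k := by
    have e1 : (Module.Basis.sumExtendIndex hu) ≃ ((Set.range φ)ᶜ : Set (Fin n)) := by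
      apply Fintype.equivOfCardEq
      rw [Fintype.card_compl_set, Set.card_range_of_injective hφ, Fintype.card_fin]
      have : Fintype.card ((Fin m ⊕ Fin m) ⊕ Module.Basis.sumExtendIndex hu) = 
        Fintype.card (Fin m ⊕ Fin m) + Fintype.card (Module.Basis.sumExtendIndex hu) := by
        rw [← Fintype.card_sum]
      omega
    refine ⟨(Equiv.sumCongr (Equiv.ofInjective φ hφ) e1).trans (Equiv.Set.sumCompl _), fun k => ?_⟩
    simp
  let b := bb.reindex E
  have hb : ∀ k, b (φ k) = Sum.elim u (fun i => c *ᵥ u i) k := by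
    intro k
    rw [← hbb, ← hE]; simp [b]
  have hb2 : ∀ i ∈ I, c *ᵥ b i = b (τ i) := by
    intro i hi
    have h1 := hb (Sum.inl (eI ⟨i, hi⟩))
    have h2 := hb (Sum.inr (eI ⟨i, hi⟩))
    simp only [φ, Sum.elim_inl, Sum.elim_inr, Equiv.symm_apply_apply] at h1 h2
    rw [h1, h2]
  have hgg := (Pi.basisFun K (Fin n)).toMatrix_mul_toMatrix_flip b
  have hgg' := b.toMatrix_mul_toMatrix_flip (Pi.basisFun K (Fin n))
  refine ⟨(Pi.basisFun K (Fin n)).toMatrix b, b.toMatrix (Pi.basisFun K (Fin n)), hgg, hgg', ?_⟩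
  intro a i hi
  have hcol : ∀ x, (c * (Pi.basisFun K (Fin n)).toMatrix b) x i = 
      (Pi.basisFun K (Fin n)).toMatrix b x (τ i) := by
    intro x
    have := congrFun (hb2 i hi) x
    simpa [Matrix.mul_apply, Matrix.mulVec, dotProduct, Module.Basis.toMatrix_apply] using this
  rw [mul_assoc, Matrix.mul_apply]
  simp_rw [hcol]
  rw [← Matrix.mul_apply, hgg', Matrix.one_apply]

theorem off_matrix [Algebra K B] (h2 : (2 : K) ≠ 0) {F V : Set (Matrix (Fin n) (Fin n) B)}
    (hF : ConjInv F) (hV : ∀ x, x ∈ V ↔ ∃ s ∈ F, ∃ t ∈ F, x = s - t)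
    (hVc : ConjInv V) (hneg : ∀ v ∈ V, -v ∈ V)
    {m : ℕ} (c : Matrix (Fin n) (Fin n) K) (hcF : (Algebra.ofId K B).mapMatrix c ∈ F)
    (u : Fin m → (Fin n → K)) (hmn : 2 * m ≤ n)
    (hu : LinearIndependent K (Sum.elim u (fun i => c *ᵥ u i)))
    {P Q : Finset (Fin n)} (hPQ : Disjoint P Q) (hP : P.card ≤ m) (hQ : Q.card ≤ m) :
    Off V (ind B P) (ind B Q) := by
  classical
  obtain ⟨I, hPI, hIQ, hI⟩ := Finset.exists_subsuperset_card_eq (s := P) (t := Qᶜ) (n := m)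
    (by rw [Finset.subset_compl_iff_disjoint_right]; exact hPQ) hP
    (by rw [Finset.card_compl, Fintype.card_fin]; omega)
  obtain ⟨J, hQJ, hJI, hJ⟩ := Finset.exists_subsuperset_card_eq (s := Q) (t := Iᶜ) (n := m)
    (by rw [Finset.subset_compl_comm]; exact hIQ) hQ
    (by rw [Finset.card_compl, Fintype.card_fin]; omega)
  have hIJ : Disjoint I J := by
    rw [Finset.subset_compl_iff_disjoint_right] at hJI; exact hJI.symm
  obtain ⟨τ, hτ, hτJ⟩ := exists_invol hIJ (hI.trans hJ.symm)
  obtain ⟨g, g', hg1, hg2, hcg⟩ := exists_conj c u hu hIJ hI hτ hτJ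
  intro y hy1 hy2
  have hp : ind B I * ind B I = ind B I := by rw [ind_mul, Finset.inter_self]
  have hpq : ind B I * ind B J = 0 := by
    rw [ind_mul, Finset.disjoint_iff_inter_eq_empty.1 hIJ, ind_empty]
  have hqp : ind B J * ind B I = 0 := by
    rw [ind_mul, Finset.disjoint_iff_inter_eq_empty.1 hIJ.symm, ind_empty]
  have hT := Tm_sq (B := B) hτ
  have hq := Tm_ind (B := B) hτ hτJ
  let φ := (Algebra.ofId K B).mapMatrix (m := Fin n)
  have hc' : φ (g' * c * g) ∈ F := by
    rw [map_mul, map_mul]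
    exact hF _ _ (by rw [← map_mul, hg2, map_one]) (by rw [← map_mul, hg1, map_one]) _ hcF
  have hcp : φ (g' * c * g) * ind B I = Tm B τ * ind B I := by
    ext a i
    simp only [ind, Matrix.mul_diagonal]
    by_cases hi : i ∈ I
    · simp only [φ, AlgHom.mapMatrix_apply, Matrix.map_apply, hcg a i hi, Tm, Matrix.of_apply]
      split_ifs <;> simp
    · simp [hi]
  have hh : (algebraMap K (Matrix (Fin n) (Fin n) B) 2⁻¹) + algebraMap K _ 2⁻¹ = 1 := by
    rw [← map_add, ← two_mul, mul_inv_cancel₀ h2, map_one]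
  refine off_of_nice hVc hneg (algebraMap K _ 2⁻¹) (fun x => Algebra.commutes _ _) hh
    (c := φ (g' * c * g)) (p := ind B I) (q := ind B J) (s := Tm B τ * ind B I)
    (t := ind B I * Tm B τ) ?_ hp hpq hqp hcp ?_ ?_ ?_ ?_ ?_ y ?_ ?_
  · intro x hx
    rw [hV]
    exact comm_mem_of_sq_zero hF _ (fun x => Algebra.commutes _ _) hh hx hc'
  · rw [← hq, mul_assoc, ← mul_assoc (Tm B τ) (Tm B τ), hT, one_mul, mul_assoc, hp]
  · rw [← mul_assoc, hp]
  · rw [← hq, mul_assoc, ← mul_assoc (Tm B τ), ← mul_assoc (Tm B τ), hT, one_mul, ← mul_assoc, hp]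
  · rw [mul_assoc, ← mul_assoc (Tm B τ), hT, one_mul, hp]
  · rw [mul_assoc, ← mul_assoc (ind B I), hp, ← mul_assoc, hq]
  · rw [← hy1, ← mul_assoc, ind_mul, Finset.inter_eq_right.2 hPI]
  · rw [← hy2, mul_assoc, ind_mul, Finset.inter_eq_left.2 hQJ]

end Mat

theorem lift_map {K : Type*} [Field K] {C D : Type*} [Ring C] [Ring D] [Algebra K C] [Algebra K D]
    (f : FreeAlgebra K ℕ) (g : C →ₐ[K] D) (x : ℕ → C) :
    FreeAlgebra.lift K (fun i => g (x i)) f = g (FreeAlgebra.lift K x f) := by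
  have : FreeAlgebra.lift K (fun i => g (x i)) = g.comp (FreeAlgebra.lift K x) := by
    ext i; simp
  rw [this]; rfl

/-- conjugation as an algebra homomorphism -/
def conjHom {K A : Type*} [Field K] [Ring A] [Algebra K A] (u w : A) (h1 : u * w = 1)
    (h2 : w * u = 1) : A →ₐ[K] A where
  toFun x := u * x * w
  map_one' := by simp [h1]
  map_zero' := by simp
  map_add' x y := by simp [mul_add, add_mul]
  map_mul' x y := by
    have : u * x * w * (u * y * w) = u * x * (w * u) * y * w := by simp only [mul_assoc]
    rw [this, h2]; simp [mul_assoc]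
  commutes' r := by rw [← Algebra.commutes, mul_assoc, h1, mul_one]

end BresarAux

theorem bresar_commutator_in_image_difference
    (K : Type*) [Field K] [Infinite K] (hchar : (2 : K) ≠ 0)
    (n : ℕ) (hn : 2 ≤ n) (f : FreeAlgebra K ℕ)
    (hf_not_id : ¬ ∀ a : ℕ → Matrix (Fin n) (Fin n) K, FreeAlgebra.lift K a f = 0)
    (hf_not_central : ¬ ∀ a : ℕ → Matrix (Fin n) (Fin n) K,
      FreeAlgebra.lift K a f ∈ Set.center (Matrix (Fin n) (Fin n) K))
    (k : ℕ) (hk : 1 ≤ k) (B : Type*) [Ring B] [Algebra K B]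
    (hB : ∀ x : Matrix (Fin n) (Fin n) B,
      ∃ (u v : Fin k → Matrix (Fin n) (Fin n) B) (z : Matrix (Fin n) (Fin n) B),
        z ∈ Set.center (Matrix (Fin n) (Fin n) B) ∧
        x = (∑ i : Fin k, (u i * v i - v i * u i)) + z) :
    ∀ a b : Matrix (Fin n) (Fin n) B,
      ∃ d : Fin (1936 * k ^ 2 + 22 * k) → Matrix (Fin n) (Fin n) B,
        (∀ j, ∃ s t : Matrix (Fin n) (Fin n) B,
          (∃ e : ℕ → Matrix (Fin n) (Fin n) B, FreeAlgebra.lift K e f = s) ∧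
          (∃ e : ℕ → Matrix (Fin n) (Fin n) B, FreeAlgebra.lift K e f = t) ∧
          d j = s - t) ∧
        a * b - b * a = ∑ j, d j := by
  classical
  intro a b
  obtain ⟨N, rfl⟩ : ∃ N, n = N + 1 := ⟨n - 1, by omega⟩
  obtain ⟨e₀, r, hdet⟩ := BresarAux.exists_good f hf_not_central
  obtain ⟨m, hm, u, hu⟩ := BresarAux.greedy hn _ r hdet
  have hmn : 2 * m ≤ N + 1 := by
    have := hu.fintype_card_le_finrank
    rw [Module.finrank_fin_fun] at this
    simp at this; omega
  let F : Set (Matrix (Fin (N + 1)) (Fin (N + 1)) B) :=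
    {s | ∃ e : ℕ → Matrix (Fin (N + 1)) (Fin (N + 1)) B, FreeAlgebra.lift K e f = s}
  let V : Set (Matrix (Fin (N + 1)) (Fin (N + 1)) B) := {x | ∃ s ∈ F, ∃ t ∈ F, x = s - t}
  have hF : BresarAux.ConjInv F := by
    rintro x w h1 h2 _ ⟨e, rfl⟩
    exact ⟨_, BresarAux.lift_map f (BresarAux.conjHom x w h1 h2) e⟩
  have hVc : BresarAux.ConjInv V := by
    rintro x w h1 h2 _ ⟨s, hs, t, ht, rfl⟩
    exact ⟨_, hF x w h1 h2 s hs, _, hF x w h1 h2 t ht, by rw [mul_sub, sub_mul]⟩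
  have hneg : ∀ v ∈ V, -v ∈ V := by
    rintro _ ⟨s, hs, t, ht, rfl⟩
    exact ⟨t, ht, s, hs, by simp⟩
  have hcF : (Algebra.ofId K B).mapMatrix (FreeAlgebra.lift K e₀ f) ∈ F :=
    ⟨_, BresarAux.lift_map f ((Algebra.ofId K B).mapMatrix) e₀⟩
  have h0 : (0 : Matrix (Fin (N + 1)) (Fin (N + 1)) B) ∈ V := ⟨_, hcF, _, hcF, by simp⟩
  have off : ∀ P Q : Finset (Fin (N + 1)), Disjoint P Q → P.card ≤ m → Q.card ≤ m →
      BresarAux.Off V (BresarAux.ind B P) (BresarAux.ind B Q) := fun P Q h1 h2 h3 =>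
    BresarAux.off_matrix hchar hF (fun _ => Iff.rfl) hVc hneg _ hcF u hmn hu h1 h2 h3
  have hm0 : 0 < m := by omega
  let P : Fin 4 → Finset (Fin (N + 1)) := fun j => Finset.univ.filter fun i => i.val / m = j.val
  have hPd : ∀ i j, i ≠ j → Disjoint (P i) (P j) := by
    intro i j hij
    rw [Finset.disjoint_left]
    intro x hx hy
    simp only [P, Finset.mem_filter] at hx hy
    exact hij (Fin.ext (hx.2.symm.trans hy.2))
  have hPc : ∀ i, (P i).card ≤ m := by
    intro i
    have : (P i).card ≤ (Finset.range m).card := by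
      apply Finset.card_le_card_of_injOn (fun x => x.val % m)
      · intro x _
        simpa using Nat.mod_lt _ hm0
      · intro x hx y hy hxy
        simp only [P, Finset.coe_filter, Set.mem_setOf_eq] at hx hy
        ext
        rw [← Nat.div_add_mod x.val m, ← Nat.div_add_mod y.val m, hx.2, hy.2]
        congr 1
    simpa using this
  have main := BresarAux.comm_all hVc hneg h0 (fun i => BresarAux.ind B (P i))
    (fun i => by rw [BresarAux.ind_mul, Finset.inter_self])
    (fun i j hij => by
      rw [BresarAux.ind_mul, Finset.disjoint_iff_inter_eq_empty.1 (hPd i j hij),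
        BresarAux.ind_empty])
    (by
      ext x y
      rw [Matrix.sum_apply]
      by_cases hxy : x = y
      · subst hxy
        have hx : x.val / m < 4 := by
          rw [Nat.div_lt_iff_lt_mul hm0]; omega
        rw [Finset.sum_eq_single (⟨x.val / m, hx⟩ : Fin 4)]
        · simp [BresarAux.ind, P]
        · intro j _ hj
          have : ¬ (x.val / m = j.val) := fun h => hj (Fin.ext h.symm)
          simp [BresarAux.ind, P, this]
        · simp
      · simp [BresarAux.ind, hxy])
    (fun i j hij => off _ _ (hPd i j hij) (hPc i) (hPc j))
    (by
      intro i
      obtain ⟨Q, hQ, hQc⟩ := Finset.exists_subset_card_eq (s := (P i)ᶜ) (n := (P i).card) (by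
        rw [Finset.card_compl, Fintype.card_fin]; have := hPc i; omega)
      have hd : Disjoint (P i) Q := by
        rw [Finset.subset_compl_iff_disjoint_right] at hQ; exact hQ.symm
      obtain ⟨τ, hτ, hτQ⟩ := BresarAux.exists_invol hd hQc.symm
      have hp : BresarAux.ind B (P i) * BresarAux.ind B (P i) = BresarAux.ind B (P i) := by
        rw [BresarAux.ind_mul, Finset.inter_self]
      have hT := BresarAux.Tm_sq (B := B) hτ
      have hq := BresarAux.Tm_ind (B := B) hτ hτQ
      refine ⟨BresarAux.ind B Q, BresarAux.ind B (P i) * BresarAux.Tm B τ,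
        BresarAux.Tm B τ * BresarAux.ind B (P i), ?_, off _ _ hd (hPc i) (hQc ▸ hPc i),
        off _ _ hd.symm (hQc ▸ hPc i) (hPc i), ?_, ?_, ?_, ?_, ?_⟩
      · rw [BresarAux.ind_mul, Finset.disjoint_iff_inter_eq_empty.1 hd, BresarAux.ind_empty]
      · rw [← mul_assoc, hp]
      · rw [← hq, mul_assoc, ← mul_assoc (BresarAux.Tm B τ), ← mul_assoc (BresarAux.Tm B τ), hT,
          one_mul, ← mul_assoc, hp]
      · rw [← hq, mul_assoc, ← mul_assoc (BresarAux.Tm B τ) (BresarAux.Tm B τ), hT, one_mul,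
          mul_assoc, hp]
      · rw [mul_assoc, hp]
      · rw [mul_assoc, ← mul_assoc (BresarAux.Tm B τ), hT, one_mul, hp])
    a b
  obtain ⟨d, hd, hs⟩ := (main.mono h0 (M := 1936 * k ^ 2 + 22 * k) (by nlinarith)).exists_fin
  refine ⟨d, fun j => ?_, hs⟩
  obtain ⟨s, hs, t, ht, h⟩ := hd j
  exact ⟨s, t, hs, ht, h⟩
end
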